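/- (Euclidean case of Proposition 4.2.) Let Ω ⊆ ℝ² be open, and let f : Ω → ℝ² be continuous and lie in W^{1,2}_loc(Ω,ℝ²) with weak derivative Df. Suppose there is a measurable K : Ω → ℝ with K(x) ≥ 1, integrable on compact subsets of Ω, such that ‖Df(x)‖² ≤ K(x) · det Df(x) for almost every x ∈ Ω. Let x₀ ∈ Ω and s > 0 be such that the closed ball B̄(x₀, 2s) is contained in Ω. Then there exist r₀ ∈ (0,1) and C > 0 such that for all 0 < r < r₀: ∫₀^{2π} N( f(x₀) + r e^{iθ}, f, B(x₀,s) ) dθ ≤ C · log(1/r). -/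

import Mathlib

open MeasureTheory Set
open scoped ENNReal Real Topology

noncomputable section

/-- The plane `ℝ²` as a Euclidean space. -/
abbrev E2 : Type := EuclideanSpace ℝ (Fin 2)

/-- `f` lies in `W^{1,2}_loc(Ω, ℝ²)` with weak derivative `Df`. -/
def MemW12loc (Ω : Set E2) (f : E2 → E2) (Df : E2 → E2 →L[ℝ] E2) : Prop :=
  LocallyIntegrableOn f Ω ∧
  Measurable Df ∧
  (∀ A : Set E2, A ⊆ Ω → IsCompact A →
    ∫⁻ x in A, ENNReal.ofReal (‖Df x‖ ^ 2) < ⊤) ∧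
  (∀ φ : E2 → ℝ, ContDiff ℝ (⊤ : ℕ∞) φ → HasCompactSupport φ → tsupport φ ⊆ Ω →
    ∀ i : Fin 2,
      (∫ x in Ω, (fderiv ℝ φ x (EuclideanSpace.single i 1)) • f x) =
        - ∫ x in Ω, φ x • Df x (EuclideanSpace.single i 1))

/-- The multiplicity `N(y, f, A)`, i.e. the cardinality of `{x ∈ A : f x = y}`,
viewed in `[0,∞]`. -/
def mult (f : E2 → E2) (A : Set E2) (y : E2) : ℝ≥0∞ :=
  ((A ∩ f ⁻¹' {y}).encard : ℝ≥0∞)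

/-- The point `r e^{iθ} = (r cos θ, r sin θ)` of `ℝ²`. -/
def circlePt (r θ : ℝ) : E2 :=
  (EuclideanSpace.equiv (Fin 2) ℝ).symm ![r * Real.cos θ, r * Real.sin θ]

open MeasureTheory Set
open scoped ENNReal Real Topology


def crs (z w : ℂ) : ℝ := z.re * w.im - z.im * w.re

def nsq (z : ℂ) : ℝ := z.re ^ 2 + z.im ^ 2

lemma nsq_eq_norm (z : ℂ) : nsq z = ‖z‖ ^ 2 := by
  rw [← Complex.normSq_eq_norm_sq, Complex.normSq_apply, nsq]; ring

lemma nsq_nonneg (z : ℂ) : 0 ≤ nsq z := by unfold nsq; positivity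

lemma crs_eq (z w : ℂ) : crs z w = (starRingEnd ℂ z * w).im := by
  simp [crs]; ring

lemma abs_crs_le (z w : ℂ) : |crs z w| ≤ ‖z‖ * ‖w‖ := by
  rw [crs_eq]
  calc |(starRingEnd ℂ z * w).im| ≤ ‖starRingEnd ℂ z * w‖ := Complex.abs_im_le_norm _
    _ = ‖z‖ * ‖w‖ := by simp

lemma continuous_nsq : Continuous nsq := by unfold nsq; fun_prop

lemma continuous_crs : Continuous (fun p : ℂ × ℂ => crs p.1 p.2) := by unfold crs; fun_prop

def dX (H : ℝ × ℝ → ℂ) (p : ℝ × ℝ) : ℂ := fderiv ℝ H p (1, 0)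
def dY (H : ℝ × ℝ → ℂ) (p : ℝ × ℝ) : ℂ := fderiv ℝ H p (0, 1)

lemma continuous_dX {H : ℝ × ℝ → ℂ} (hH : ContDiff ℝ 2 H) : Continuous (dX H) := by
  unfold dX
  exact (hH.continuous_fderiv (by norm_num)).clm_apply continuous_const

lemma continuous_dY {H : ℝ × ℝ → ℂ} (hH : ContDiff ℝ 2 H) : Continuous (dY H) := by
  unfold dY
  exact (hH.continuous_fderiv (by norm_num)).clm_apply continuous_const

lemma green_deriv {H : ℝ × ℝ → ℂ} (hH : ContDiff ℝ 2 H) {ψ : ℝ × ℝ → ℝ} (hψ : ContDiff ℝ 1 ψ)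
    {G : ℝ → ℝ} {G1 : ℝ} (p : ℝ × ℝ) (hG : HasDerivAt G G1 (nsq (H p))) (e : ℝ × ℝ) :
    ∃ L : ℝ × ℝ →L[ℝ] ℝ, HasFDerivAt (fun q => ψ q * G (nsq (H q)) * crs (H q) (fderiv ℝ H q e)) L p
      ∧ ∀ d, L d = fderiv ℝ ψ p d * G (nsq (H p)) * crs (H p) (fderiv ℝ H p e)
        + ψ p * (G1 * (2 * (H p).re * (fderiv ℝ H p d).re + 2 * (H p).im * (fderiv ℝ H p d).im)) *
            crs (H p) (fderiv ℝ H p e)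
        + ψ p * G (nsq (H p)) * (crs (fderiv ℝ H p d) (fderiv ℝ H p e) +
            crs (H p) (fderiv ℝ (fderiv ℝ H) p d e)) := by
  have h1 : HasFDerivAt H (fderiv ℝ H p) p :=
    ((hH.differentiable (by norm_num)) p).hasFDerivAt
  have h2 : HasFDerivAt (fderiv ℝ H) (fderiv ℝ (fderiv ℝ H) p) p :=
    (((hH.fderiv_right (m := 1) (by norm_num)).differentiable (by norm_num)) p).hasFDerivAt
  have h3 : HasFDerivAt ψ (fderiv ℝ ψ p) p := ((hψ.differentiable (by norm_num)) p).hasFDerivAt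
  have hre : HasFDerivAt (fun q => (H q).re) (Complex.reCLM.comp (fderiv ℝ H p)) p :=
    Complex.reCLM.hasFDerivAt.comp p h1
  have him : HasFDerivAt (fun q => (H q).im) (Complex.imCLM.comp (fderiv ℝ H p)) p :=
    Complex.imCLM.hasFDerivAt.comp p h1
  have he : HasFDerivAt (fun q => fderiv ℝ H q e) ((fderiv ℝ (fderiv ℝ H) p).flip e) p := by
    exact ((ContinuousLinearMap.apply ℝ ℂ e).hasFDerivAt (x := fderiv ℝ H p)).comp p h2
  have here : HasFDerivAt (fun q => (fderiv ℝ H q e).re) (Complex.reCLM.comp ((fderiv ℝ (fderiv ℝ H) p).flip e)) p :=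
    Complex.reCLM.hasFDerivAt.comp p he
  have heim : HasFDerivAt (fun q => (fderiv ℝ H q e).im) (Complex.imCLM.comp ((fderiv ℝ (fderiv ℝ H) p).flip e)) p :=
    Complex.imCLM.hasFDerivAt.comp p he
  have hs : HasFDerivAt (fun q => nsq (H q)) _ p := (hre.pow 2).add (him.pow 2)
  have hGs : HasFDerivAt (fun q => G (nsq (H q))) _ p := hG.comp_hasFDerivAt p hs
  have hc : HasFDerivAt (fun q => crs (H q) (fderiv ℝ H q e)) _ p := (hre.mul heim).sub (him.mul here)
  refine ⟨_, (h3.mul hGs).mul hc, fun d => ?_⟩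
  simp [crs]
  ring

theorem green {H : ℝ × ℝ → ℂ} (hH : ContDiff ℝ 2 H) {ψ : ℝ × ℝ → ℝ} (hψ : ContDiff ℝ 1 ψ)
    {G G' : ℝ → ℝ} {T : ℝ} (hG : ∀ t ∈ Icc 0 T, HasDerivAt G (G' t) t)
    (hG' : ContinuousOn G' (Icc 0 T)) {a b : ℝ × ℝ} (hle : a ≤ b)
    (hT : ∀ p ∈ Icc a b, nsq (H p) ≤ T) :
    ∫ p in Icc a b, (ψ p * (2 * G (nsq (H p)) + 2 * nsq (H p) * G' (nsq (H p))) * crs (dX H p) (dY H p)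
        + G (nsq (H p)) * (fderiv ℝ ψ p (1, 0) * crs (H p) (dY H p)
          - fderiv ℝ ψ p (0, 1) * crs (H p) (dX H p)))
    = (((∫ x in a.1..b.1, -(ψ (x, b.2) * G (nsq (H (x, b.2))) * crs (H (x, b.2)) (dX H (x, b.2))))
        - ∫ x in a.1..b.1, -(ψ (x, a.2) * G (nsq (H (x, a.2))) * crs (H (x, a.2)) (dX H (x, a.2))))
        + ∫ y in a.2..b.2, ψ (b.1, y) * G (nsq (H (b.1, y))) * crs (H (b.1, y)) (dY H (b.1, y)))
        - ∫ y in a.2..b.2, ψ (a.1, y) * G (nsq (H (a.1, y))) * crs (H (a.1, y)) (dY H (a.1, y)) := by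
  have hmem : ∀ p ∈ Icc a b, nsq (H p) ∈ Icc 0 T := fun p hp => ⟨nsq_nonneg _, hT p hp⟩
  have hGc : ContinuousOn G (Icc 0 T) := fun t ht => (hG t ht).continuousAt.continuousWithinAt
  have cH : Continuous H := hH.continuous
  have csq : Continuous (fun p => nsq (H p)) := continuous_nsq.comp cH
  have cG : ContinuousOn (fun p => G (nsq (H p))) (Icc a b) := hGc.comp csq.continuousOn hmem
  have cG' : ContinuousOn (fun p => G' (nsq (H p))) (Icc a b) := hG'.comp csq.continuousOn hmem
  have cX := continuous_dX hH
  have cY := continuous_dY hH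
  have cHX : Continuous (fun p => crs (H p) (dX H p)) := continuous_crs.comp (cH.prodMk cX)
  have cHY : Continuous (fun p => crs (H p) (dY H p)) := continuous_crs.comp (cH.prodMk cY)
  have cXY : Continuous (fun p => crs (dX H p) (dY H p)) := continuous_crs.comp (cX.prodMk cY)
  have cψ := hψ.continuous
  have cψx : Continuous (fun p => fderiv ℝ ψ p (1, 0)) :=
    (hψ.continuous_fderiv (by norm_num)).clm_apply continuous_const
  have cψy : Continuous (fun p => fderiv ℝ ψ p (0, 1)) :=
    (hψ.continuous_fderiv (by norm_num)).clm_apply continuous_const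
  have key : ∀ e : ℝ × ℝ, ∃ L : ℝ × ℝ → (ℝ × ℝ →L[ℝ] ℝ), ∀ p ∈ Icc a b,
      HasFDerivAt (fun q => ψ q * G (nsq (H q)) * crs (H q) (fderiv ℝ H q e)) (L p) p
      ∧ ∀ d, L p d = fderiv ℝ ψ p d * G (nsq (H p)) * crs (H p) (fderiv ℝ H p e)
        + ψ p * (G' (nsq (H p)) * (2 * (H p).re * (fderiv ℝ H p d).re + 2 * (H p).im * (fderiv ℝ H p d).im)) *
            crs (H p) (fderiv ℝ H p e)
        + ψ p * G (nsq (H p)) * (crs (fderiv ℝ H p d) (fderiv ℝ H p e) +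
            crs (H p) (fderiv ℝ (fderiv ℝ H) p d e)) := by
    intro e
    have : ∀ p, ∃ L : (ℝ × ℝ →L[ℝ] ℝ), p ∈ Icc a b →
      HasFDerivAt (fun q => ψ q * G (nsq (H q)) * crs (H q) (fderiv ℝ H q e)) L p
      ∧ ∀ d, L d = fderiv ℝ ψ p d * G (nsq (H p)) * crs (H p) (fderiv ℝ H p e)
        + ψ p * (G' (nsq (H p)) * (2 * (H p).re * (fderiv ℝ H p d).re + 2 * (H p).im * (fderiv ℝ H p d).im)) *
            crs (H p) (fderiv ℝ H p e)
        + ψ p * G (nsq (H p)) * (crs (fderiv ℝ H p d) (fderiv ℝ H p e) +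
            crs (H p) (fderiv ℝ (fderiv ℝ H) p d e)) := by
      intro p
      by_cases hp : p ∈ Icc a b
      · obtain ⟨L, hL⟩ := green_deriv hH hψ p (hG _ (hmem p hp)) e
        exact ⟨L, fun _ => hL⟩
      · exact ⟨0, fun h => absurd h hp⟩
    choose L hL using this
    exact ⟨L, hL⟩
  obtain ⟨L1, hL1⟩ := key (0, 1)
  obtain ⟨L2, hL2⟩ := key (1, 0)
  have hsymm : ∀ p, fderiv ℝ (fderiv ℝ H) p (1, 0) (0, 1) = fderiv ℝ (fderiv ℝ H) p (0, 1) (1, 0) := by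
    intro p
    exact (hH.contDiffAt.isSymmSndFDerivAt (by simp)) _ _
  have heq : ∀ p ∈ Icc a b, L1 p (1, 0) + (-L2 p) (0, 1) =
      ψ p * (2 * G (nsq (H p)) + 2 * nsq (H p) * G' (nsq (H p))) * crs (dX H p) (dY H p)
        + G (nsq (H p)) * (fderiv ℝ ψ p (1, 0) * crs (H p) (dY H p)
          - fderiv ℝ ψ p (0, 1) * crs (H p) (dX H p)) := by
    intro p hp
    rw [neg_apply, (hL1 p hp).2, (hL2 p hp).2, hsymm p]
    have : nsq (H p) = (H p).re ^ 2 + (H p).im ^ 2 := rfl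
    generalize hg : G (nsq (H p)) = g
    generalize hg' : G' (nsq (H p)) = g'
    rw [this]
    simp only [crs, dX, dY]
    ring
  have hsub : Ioo a.1 b.1 ×ˢ Ioo a.2 b.2 ⊆ Icc a b := by
    rintro ⟨x, y⟩ ⟨hx, hy⟩
    exact ⟨⟨hx.1.le, hy.1.le⟩, ⟨hx.2.le, hy.2.le⟩⟩
  have := integral_divergence_prod_Icc_of_hasFDerivAt_of_le
    (fun q => ψ q * G (nsq (H q)) * crs (H q) (fderiv ℝ H q (0, 1)))
    (fun q => -(ψ q * G (nsq (H q)) * crs (H q) (fderiv ℝ H q (1, 0))))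
    L1 (fun p => -L2 p) a b hle
    ((cψ.continuousOn.mul cG).mul cHY.continuousOn)
    ((cψ.continuousOn.mul cG).mul cHX.continuousOn).neg
    (fun p hp => (hL1 p (hsub hp)).1) (fun p hp => ((hL2 p (hsub hp)).1).neg)
    (by
      apply IntegrableOn.congr_fun _ (fun p hp => (heq p hp).symm) measurableSet_Icc
      apply ContinuousOn.integrableOn_compact isCompact_Icc
      exact ((cψ.continuousOn.mul ((continuousOn_const.mul cG).add
        ((continuousOn_const.mul csq.continuousOn).mul cG'))).mul cXY.continuousOn).add
        (cG.mul ((cψx.mul cHY).sub (cψy.mul cHX)).continuousOn))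
  rw [← setIntegral_congr_fun measurableSet_Icc heq, this]
  rfl

open MeasureTheory Set
open scoped ENNReal Real Topology


lemma exp_path {h h' : ℝ → ℂ} {c d : ℝ} (hcd : c ≤ d) (hh : ∀ x, HasDerivAt h (h' x) x)
    (hc : Continuous h') (h0 : ∀ x ∈ Icc c d, h x ≠ 0) :
    h d = h c * Complex.exp (∫ x in c..d, h' x / h x) := by
  have ch : Continuous h := continuous_iff_continuousAt.2 fun x => (hh x).continuousAt
  have cφ : ContinuousOn (fun x => h' x / h x) (Icc c d) :=
    hc.continuousOn.div ch.continuousOn h0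
  set φ : ℝ → ℂ := IccExtend hcd ((Icc c d).domRestrict (fun x => h' x / h x)) with hφ
  have cφ' : Continuous φ := (continuousOn_iff_continuous_domRestrict.1 cφ).Icc_extend'
  have hφeq : ∀ x ∈ Icc c d, φ x = h' x / h x := fun x hx => by
    rw [hφ, IccExtend_of_mem hcd _ hx]; rfl
  have hd : ∀ x, HasDerivAt (fun x => ∫ t in c..x, φ t) (φ x) x := fun x =>
    intervalIntegral.integral_hasDerivAt_right (cφ'.intervalIntegrable _ _)
      (cφ'.stronglyMeasurableAtFilter _ _) cφ'.continuousAt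
  have hk : ∀ x, HasDerivAt (fun x => h x * Complex.exp (-∫ t in c..x, φ t))
      (h' x * Complex.exp (-∫ t in c..x, φ t) + h x * (Complex.exp (-∫ t in c..x, φ t) * (- φ x))) x :=
    fun x => (hh x).mul ((hd x).neg.cexp)
  have := constant_of_has_deriv_right_zero (a := c) (b := d)
    (f := fun x => h x * Complex.exp (-∫ t in c..x, φ t))
    (fun x _ => (hk x).continuousAt.continuousWithinAt)
    (fun x hx => by
      have := (hk x).hasDerivWithinAt (s := Ici x)
      convert this using 1
      have hx' : x ∈ Icc c d := ⟨hx.1, hx.2.le⟩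
      rw [hφeq x hx']
      have := h0 x hx'
      field_simp
      ring) d ⟨hcd, le_rfl⟩
  simp only [intervalIntegral.integral_same, neg_zero, Complex.exp_zero, mul_one] at this
  have hI : ∫ x in c..d, h' x / h x = ∫ t in c..d, φ t := by
    apply intervalIntegral.integral_congr
    intro x hx
    rw [uIcc_of_le hcd] at hx
    exact (hφeq x hx).symm
  rw [hI, ← this, mul_assoc, ← Complex.exp_add]
  simp

lemma im_div_eq (z w : ℂ) : (w / z).im = 1 / nsq z * crs z w := by
  rw [Complex.div_im, Complex.normSq_apply]
  simp only [nsq, crs]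
  rw [show z.re * z.re + z.im * z.im = z.re ^2 + z.im ^ 2 by ring]
  ring

/-- boundary of a rectangle -/
def bdry (a b : ℝ × ℝ) : Set (ℝ × ℝ) :=
  {p | p ∈ Icc a b ∧ (p.1 = a.1 ∨ p.1 = b.1 ∨ p.2 = a.2 ∨ p.2 = b.2)}

lemma hasDerivAt_row {H : ℝ × ℝ → ℂ} (hH : ContDiff ℝ 2 H) (y x : ℝ) :
    HasDerivAt (fun x => H (x, y)) (dX H (x, y)) x := by
  have h1 : HasFDerivAt H (fderiv ℝ H (x, y)) (x, y) :=
    ((hH.differentiable (by norm_num)) _).hasFDerivAt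
  exact h1.comp_hasDerivAt x ((hasDerivAt_id x).prodMk (hasDerivAt_const x y))

lemma hasDerivAt_col {H : ℝ × ℝ → ℂ} (hH : ContDiff ℝ 2 H) (x y : ℝ) :
    HasDerivAt (fun y => H (x, y)) (dY H (x, y)) y := by
  have h1 : HasFDerivAt H (fderiv ℝ H (x, y)) (x, y) :=
    ((hH.differentiable (by norm_num)) _).hasFDerivAt
  exact h1.comp_hasDerivAt y ((hasDerivAt_const y x).prodMk (hasDerivAt_id y))

theorem integrality {H : ℝ × ℝ → ℂ} (hH : ContDiff ℝ 2 H) {a b : ℝ × ℝ} (hle : a ≤ b)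
    (h0 : ∀ p ∈ bdry a b, H p ≠ 0) :
    ∃ m : ℤ, ∀ (G G' : ℝ → ℝ) (T : ℝ) (_ : ∀ t ∈ Icc 0 T, HasDerivAt G (G' t) t)
      (_ : ContinuousOn G' (Icc 0 T)) (_ : ∀ p ∈ Icc a b, nsq (H p) ≤ T)
      (_ : ∀ p ∈ bdry a b, G (nsq (H p)) = 1 / nsq (H p)),
      ∫ p in Icc a b, (2 * G (nsq (H p)) + 2 * nsq (H p) * G' (nsq (H p))) * crs (dX H p) (dY H p)
        = 2 * π * m := by
  have m1 : ∀ x ∈ Icc a.1 b.1, (x, a.2) ∈ bdry a b := fun x hx =>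
    ⟨⟨⟨hx.1, le_rfl⟩, ⟨hx.2, hle.2⟩⟩, by simp⟩
  have m2 : ∀ x ∈ Icc a.1 b.1, (x, b.2) ∈ bdry a b := fun x hx =>
    ⟨⟨⟨hx.1, hle.2⟩, ⟨hx.2, le_rfl⟩⟩, by simp⟩
  have m3 : ∀ y ∈ Icc a.2 b.2, (a.1, y) ∈ bdry a b := fun x hx =>
    ⟨⟨⟨le_rfl, hx.1⟩, ⟨hle.1, hx.2⟩⟩, by simp⟩
  have m4 : ∀ y ∈ Icc a.2 b.2, (b.1, y) ∈ bdry a b := fun x hx =>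
    ⟨⟨⟨hle.1, hx.1⟩, ⟨le_rfl, hx.2⟩⟩, by simp⟩
  have cX := continuous_dX hH
  have cY := continuous_dY hH
  have cH := hH.continuous
  have e1 := exp_path hle.1 (fun x => hasDerivAt_row hH a.2 x) (by fun_prop) (fun x hx => h0 _ (m1 x hx))
  have e2 := exp_path hle.1 (fun x => hasDerivAt_row hH b.2 x) (by fun_prop) (fun x hx => h0 _ (m2 x hx))
  have e3 := exp_path hle.2 (fun x => hasDerivAt_col hH a.1 x) (by fun_prop) (fun x hx => h0 _ (m3 x hx))
  have e4 := exp_path hle.2 (fun x => hasDerivAt_col hH b.1 x) (by fun_prop) (fun x hx => h0 _ (m4 x hx))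
  set I1 := ∫ x in a.1..b.1, dX H (x, a.2) / H (x, a.2) with hI1
  set I2 := ∫ x in a.1..b.1, dX H (x, b.2) / H (x, b.2) with hI2
  set I3 := ∫ x in a.2..b.2, dY H (a.1, x) / H (a.1, x) with hI3
  set I4 := ∫ x in a.2..b.2, dY H (b.1, x) / H (b.1, x) with hI4
  have hne : H (a.1, a.2) ≠ 0 := h0 _ (m1 _ ⟨le_rfl, hle.1⟩)
  have : Complex.exp (I1 + I4) = Complex.exp (I3 + I2) := by
    rw [Complex.exp_add, Complex.exp_add]
    apply mul_left_cancel₀ hne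
    rw [← mul_assoc, ← mul_assoc, ← e1, ← e3, ← e4, ← e2]
  obtain ⟨m, hm⟩ := Complex.exp_eq_exp_iff_exists_int.1 this
  have him := congrArg Complex.im hm
  simp only [Complex.add_im, Complex.mul_im, Complex.intCast_re, Complex.intCast_im,
    Complex.mul_re, Complex.I_re, Complex.I_im, Complex.ofReal_re, Complex.ofReal_im,
    Complex.re_ofNat, Complex.im_ofNat] at him
  refine ⟨m, fun G G' T hG hG' hT hGb => ?_⟩
  have hg := green hH (ψ := fun _ => 1) contDiff_const hG hG' hle hT
  simp only [one_mul, fderiv_fun_const, Pi.zero_apply, zero_apply, zero_mul, sub_zero, mul_zero,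
    add_zero] at hg
  rw [hg]
  have imint : ∀ (c d : ℝ) (_ : c ≤ d) (h h' : ℝ → ℂ) (_ : Continuous h) (_ : Continuous h')
      (_ : ∀ x ∈ Icc c d, h x ≠ 0) (_ : ∀ x ∈ Icc c d, G (nsq (h x)) = 1 / nsq (h x)),
      ∫ x in c..d, G (nsq (h x)) * crs (h x) (h' x) = (∫ x in c..d, h' x / h x).im := by
    intro c d hcd h h' ch ch' hn hGn
    have hintg : IntervalIntegrable (fun x => h' x / h x) volume c d :=
      ContinuousOn.intervalIntegrable_of_Icc hcd (ch'.continuousOn.div ch.continuousOn hn)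
    have := Complex.imCLM.intervalIntegral_comp_comm hintg
    simp only [Complex.imCLM_apply] at this
    rw [← this]
    apply intervalIntegral.integral_congr
    intro x hx
    rw [uIcc_of_le hcd] at hx
    simp only [hGn x hx, im_div_eq]
  simp only [intervalIntegral.integral_neg]
  rw [imint _ _ hle.1 (fun x => H (x, b.2)) (fun x => dX H (x, b.2)) (by fun_prop) (by fun_prop)
      (fun x hx => h0 _ (m2 x hx)) (fun x hx => hGb _ (m2 x hx)),
    imint _ _ hle.1 (fun x => H (x, a.2)) (fun x => dX H (x, a.2)) (by fun_prop) (by fun_prop)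
      (fun x hx => h0 _ (m1 x hx)) (fun x hx => hGb _ (m1 x hx)),
    imint _ _ hle.2 (fun x => H (b.1, x)) (fun x => dY H (b.1, x)) (by fun_prop) (by fun_prop)
      (fun x hx => h0 _ (m4 x hx)) (fun x hx => hGb _ (m4 x hx)),
    imint _ _ hle.2 (fun x => H (a.1, x)) (fun x => dY H (a.1, x)) (by fun_prop) (by fun_prop)
      (fun x hx => h0 _ (m3 x hx)) (fun x hx => hGb _ (m3 x hx))]
  rw [← hI1, ← hI2, ← hI3, ← hI4]
  linarith

open MeasureTheory Set Filter
open scoped ENNReal Real Topology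


section M3a
variable {α : Type*} [MeasurableSpace α] {μ : Measure α}

lemma conv_mul {u : ℕ → α → ℝ} {v : α → ℝ} {A : ℕ → α → ℝ} {B : α → ℝ} {C : ℝ}
    (hu : ∀ n, Integrable (u n) μ) (hv : Integrable v μ)
    (huv : Tendsto (fun n => ∫⁻ x, ‖u n x - v x‖ₑ ∂μ) atTop (𝓝 0))
    (hA : ∀ n, AEStronglyMeasurable (A n) μ) (hAC : ∀ n, ∀ᵐ x ∂μ, |A n x| ≤ C)
    (hAB : ∀ᵐ x ∂μ, Tendsto (fun n => A n x) atTop (𝓝 (B x))) :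
    Tendsto (fun n => ∫ x, A n x * u n x ∂μ) atTop (𝓝 (∫ x, B x * v x ∂μ)) := by
  have h1 : Tendsto (fun n => ∫ x, A n x * v x ∂μ) atTop (𝓝 (∫ x, B x * v x ∂μ)) := by
    apply tendsto_integral_of_dominated_convergence (fun x => C * |v x|)
    · exact fun n => (hA n).mul hv.1
    · exact hv.abs.const_mul C
    · intro n
      filter_upwards [hAC n] with x hx
      rw [norm_mul, Real.norm_eq_abs, Real.norm_eq_abs]
      gcongr
    · filter_upwards [hAB] with x hx
      exact hx.mul_const _
  have hi : ∀ n, Integrable (fun x => A n x * u n x) μ := fun n =>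
    (hu n).bdd_mul (hA n) (hAC n)
  have hi' : ∀ n, Integrable (fun x => A n x * v x) μ := fun n =>
    hv.bdd_mul (hA n) (hAC n)
  have h2 : Tendsto (fun n => ∫ x, (A n x * u n x - A n x * v x) ∂μ) atTop (𝓝 (∫ x, (0:ℝ) ∂μ)) := by
    apply tendsto_integral_of_L1 (fun _ => (0:ℝ)) aestronglyMeasurable_const
    · exact Eventually.of_forall fun n => (hi n).sub (hi' n)
    · have : Tendsto (fun n => ENNReal.ofReal C * ∫⁻ x, ‖u n x - v x‖ₑ ∂μ) atTop (𝓝 (ENNReal.ofReal C * 0)) :=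
        ENNReal.Tendsto.const_mul huv (Or.inr ENNReal.ofReal_ne_top)
      rw [mul_zero] at this
      refine tendsto_of_tendsto_of_tendsto_of_le_of_le tendsto_const_nhds this (fun _ => zero_le) ?_
      intro n
      simp only
      rw [← lintegral_const_mul' _ _ ENNReal.ofReal_ne_top]
      apply lintegral_mono_ae
      filter_upwards [hAC n] with x hx
      rw [sub_zero, ← mul_sub, enorm_mul]
      gcongr
      rw [← ofReal_norm]
      exact ENNReal.ofReal_le_ofReal hx
  simp only [integral_zero] at h2
  have := h2.add h1
  rw [zero_add] at this
  refine this.congr fun n => ?_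
  rw [integral_sub (hi n) (hi' n)]
  ring

lemma integrable_crs {a b : α → ℂ} (ha : MemLp a 2 μ) (hb : MemLp b 2 μ) :
    Integrable (fun x => crs (a x) (b x)) μ := by
  rw [← memLp_one_iff_integrable]
  exact MemLp.of_bilin (p := 2) (q := 2) (r := 1) crs 1 ha hb
    (continuous_crs.comp_aestronglyMeasurable (ha.1.prodMk hb.1))
    (Eventually.of_forall fun x => by
      rw [← NNReal.coe_le_coe]; simpa using abs_crs_le (a x) (b x))

lemma crs_L1 {an bn : ℕ → α → ℂ} {a b : α → ℂ} (ha : MemLp a 2 μ) (hb : MemLp b 2 μ)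
    (han : ∀ n, MemLp (an n) 2 μ) (hbn : ∀ n, MemLp (bn n) 2 μ)
    (hca : Tendsto (fun n => eLpNorm (fun p => an n p - a p) 2 μ) atTop (𝓝 0))
    (hcb : Tendsto (fun n => eLpNorm (fun p => bn n p - b p) 2 μ) atTop (𝓝 0)) :
    Tendsto (fun n => ∫⁻ x, ‖crs (an n x) (bn n x) - crs (a x) (b x)‖ₑ ∂μ) atTop (𝓝 0) := by
  have key : ∀ n, ∫⁻ x, ‖crs (an n x) (bn n x) - crs (a x) (b x)‖ₑ ∂μ ≤
      eLpNorm (fun p => an n p - a p) 2 μ * (eLpNorm (fun p => bn n p - b p) 2 μ + eLpNorm b 2 μ)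
      + eLpNorm a 2 μ * eLpNorm (fun p => bn n p - b p) 2 μ := by
    intro n
    have da := (han n).sub ha
    have db := (hbn n).sub hb
    have hol : ∀ (f g : α → ℂ), MemLp f 2 μ → MemLp g 2 μ →
        ∫⁻ x, ‖crs (f x) (g x)‖ₑ ∂μ ≤ eLpNorm f 2 μ * eLpNorm g 2 μ := by
      intro f g hf hg
      have := eLpNorm_le_eLpNorm_mul_eLpNorm'_of_norm (p := 2) (q := 2) (r := 1) hf.1 hg.1 crs 1
        (Eventually.of_forall fun x => by simpa using abs_crs_le (f x) (g x))
      rw [eLpNorm_one_eq_lintegral_enorm] at this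
      simpa using this
    have m1 : AEMeasurable (fun x => ‖crs (an n x - a x) (bn n x)‖ₑ) μ :=
      (integrable_crs da (hbn n)).1.enorm
    calc ∫⁻ x, ‖crs (an n x) (bn n x) - crs (a x) (b x)‖ₑ ∂μ
        ≤ ∫⁻ x, (‖crs (an n x - a x) (bn n x)‖ₑ + ‖crs (a x) (bn n x - b x)‖ₑ) ∂μ := by
          apply lintegral_mono
          intro x
          have : crs (an n x) (bn n x) - crs (a x) (b x) =
            crs (an n x - a x) (bn n x) + crs (a x) (bn n x - b x) := by
              simp [crs]; ring
          simp only [this]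
          exact enorm_add_le _ _
      _ = ∫⁻ x, ‖crs (an n x - a x) (bn n x)‖ₑ ∂μ + ∫⁻ x, ‖crs (a x) (bn n x - b x)‖ₑ ∂μ :=
          lintegral_add_left' m1 _
      _ ≤ eLpNorm (fun p => an n p - a p) 2 μ * eLpNorm (bn n) 2 μ
          + eLpNorm a 2 μ * eLpNorm (fun p => bn n p - b p) 2 μ :=
          add_le_add (hol _ _ da (hbn n)) (hol _ _ ha db)
      _ ≤ _ := by
          gcongr
          have := eLpNorm_add_le db.1 hb.1 (p := 2) (by norm_num)
          rw [sub_add_cancel] at this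
          exact this
  refine tendsto_of_tendsto_of_tendsto_of_le_of_le tendsto_const_nhds ?_ (fun _ => zero_le) key
  have t1 : Tendsto (fun n => (eLpNorm (fun p => bn n p - b p) 2 μ + eLpNorm b 2 μ)) atTop
    (𝓝 (0 + eLpNorm b 2 μ)) := hcb.add tendsto_const_nhds
  have t2 := ENNReal.Tendsto.mul hca (Or.inr (by rw [zero_add]; exact hb.2.ne)) t1 (Or.inr (by norm_num))
  have t3 := ENNReal.Tendsto.const_mul (a := eLpNorm a 2 μ) hcb (Or.inr ha.2.ne)
  simpa using t2.add t3

end M3a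

/-- Approximation data on the rectangle `Icc a b`. -/
structure Approx (a b : ℝ × ℝ) (F Fx Fy : ℝ × ℝ → ℂ) (Fn : ℕ → ℝ × ℝ → ℂ) (M : ℝ) : Prop where
  smooth : ∀ n, ContDiff ℝ 2 (Fn n)
  cont : ContinuousOn F (Icc a b)
  unif : TendstoUniformlyOn Fn F atTop (Icc a b)
  bdd : ∀ n, ∀ p ∈ Icc a b, ‖Fn n p‖ ≤ M
  memx : MemLp Fx 2 (volume.restrict (Icc a b))
  memy : MemLp Fy 2 (volume.restrict (Icc a b))
  convx : Tendsto (fun n => eLpNorm (fun p => dX (Fn n) p - Fx p) 2 (volume.restrict (Icc a b)))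
    atTop (𝓝 0)
  convy : Tendsto (fun n => eLpNorm (fun p => dY (Fn n) p - Fy p) 2 (volume.restrict (Icc a b)))
    atTop (𝓝 0)

namespace Approx

variable {a b : ℝ × ℝ} {F Fx Fy : ℝ × ℝ → ℂ} {Fn : ℕ → ℝ × ℝ → ℂ} {M : ℝ}

lemma mono (h : Approx a b F Fx Fy Fn M) {c d : ℝ × ℝ} (hs : Icc c d ⊆ Icc a b) :
    Approx c d F Fx Fy Fn M := by
  have hm : volume.restrict (Icc c d) ≤ volume.restrict (Icc a b) := Measure.restrict_mono hs le_rfl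
  refine ⟨h.smooth, h.cont.mono hs, h.unif.mono hs, fun n p hp => h.bdd n p (hs hp),
    h.memx.mono_measure hm, h.memy.mono_measure hm, ?_, ?_⟩
  · exact tendsto_of_tendsto_of_tendsto_of_le_of_le tendsto_const_nhds h.convx (fun _ => zero_le)
      (fun n => eLpNorm_mono_measure _ hm)
  · exact tendsto_of_tendsto_of_tendsto_of_le_of_le tendsto_const_nhds h.convy (fun _ => zero_le)
      (fun n => eLpNorm_mono_measure _ hm)

lemma lim (h : Approx a b F Fx Fy Fn M) {p : ℝ × ℝ} (hp : p ∈ Icc a b) :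
    Tendsto (fun n => Fn n p) atTop (𝓝 (F p)) := h.unif.tendsto_at hp

lemma bddF (h : Approx a b F Fx Fy Fn M) {p : ℝ × ℝ} (hp : p ∈ Icc a b) : ‖F p‖ ≤ M :=
  le_of_tendsto (h.lim hp).norm (Eventually.of_forall fun n => h.bdd n p hp)

lemma nsq_le {M T : ℝ} {z y : ℂ} (hz : ‖z‖ ≤ M) (hT : (M + ‖y‖) ^ 2 ≤ T) : nsq (z - y) ≤ T := by
  rw [nsq_eq_norm]
  refine le_trans ?_ hT
  gcongr
  exact (norm_sub_le _ _).trans (by gcongr)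

lemma memLp_of_cont {g : ℝ × ℝ → ℂ} (hg : ContinuousOn g (Icc a b)) :
    MemLp g 2 (volume.restrict (Icc a b)) := by
  obtain ⟨C, hC⟩ := isCompact_Icc.exists_bound_of_continuousOn hg
  have : IsFiniteMeasure (volume.restrict (Icc a b)) :=
    ⟨by simpa using isCompact_Icc.measure_lt_top⟩
  refine MemLp.of_bound (hg.aestronglyMeasurable measurableSet_Icc) C ?_
  filter_upwards [ae_restrict_mem measurableSet_Icc] with x hx using hC x hx

lemma dX_sub {H : ℝ × ℝ → ℂ} (y : ℂ) (p : ℝ × ℝ) : dX (fun q => H q - y) p = dX H p := by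
  simp [dX, fderiv_sub_const]

lemma dY_sub {H : ℝ × ℝ → ℂ} (y : ℂ) (p : ℝ × ℝ) : dY (fun q => H q - y) p = dY H p := by
  simp [dY, fderiv_sub_const]

lemma conv0 (h : Approx a b F Fx Fy Fn M) (y : ℂ) :
    Tendsto (fun n => eLpNorm (fun p => (Fn n p - y) - (F p - y)) 2 (volume.restrict (Icc a b)))
    atTop (𝓝 0) := by
  have : IsFiniteMeasure (volume.restrict (Icc a b)) :=
    ⟨by simpa using isCompact_Icc.measure_lt_top⟩
  simp only [sub_sub_sub_cancel_right]
  rw [ENNReal.tendsto_atTop_zero]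
  intro ε hε
  set V := (volume.restrict (Icc a b)) univ ^ ((2:ℝ≥0∞).toReal)⁻¹ with hV
  have hVt : V ≠ ⊤ := ENNReal.rpow_ne_top_of_nonneg (by positivity) (measure_ne_top _ _)
  obtain ⟨η, hη, hη2⟩ : ∃ η : ℝ, 0 < η ∧ V * ENNReal.ofReal η ≤ ε := by
    have : Tendsto (fun η : ℝ => V * ENNReal.ofReal η) (𝓝[>] 0) (𝓝 (V * ENNReal.ofReal 0)) := by
      apply ENNReal.Tendsto.const_mul _ (Or.inr hVt)
      exact (ENNReal.continuous_ofReal.tendsto 0).mono_left nhdsWithin_le_nhds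
    rw [ENNReal.ofReal_zero, mul_zero] at this
    have h1 := this.eventually (ge_mem_nhds hε)
    obtain ⟨η, h2, h3⟩ := (h1.and self_mem_nhdsWithin).exists
    exact ⟨η, h3, h2⟩
  obtain ⟨N, hN⟩ := eventually_atTop.1 (Metric.tendstoUniformlyOn_iff.1 h.unif η hη)
  refine ⟨N, fun n hn => ?_⟩
  refine le_trans (eLpNorm_le_of_ae_bound (C := η) ?_) hη2
  filter_upwards [ae_restrict_mem measurableSet_Icc] with x hx
  have := hN n hn x hx
  rw [dist_comm, dist_eq_norm] at this
  exact this.le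

lemma memdX (h : Approx a b F Fx Fy Fn M) (n : ℕ) : MemLp (dX (Fn n)) 2 (volume.restrict (Icc a b)) :=
  memLp_of_cont (continuous_dX (h.smooth n)).continuousOn

lemma memdY (h : Approx a b F Fx Fy Fn M) (n : ℕ) : MemLp (dY (Fn n)) 2 (volume.restrict (Icc a b)) :=
  memLp_of_cont (continuous_dY (h.smooth n)).continuousOn

/-- limit of `∫ ψ g(|Fn - y|²) crs` -/
lemma lim_term (h : Approx a b F Fx Fy Fn M) (y : ℂ) {T : ℝ} (hT : (M + ‖y‖) ^ 2 ≤ T)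
    {g : ℝ → ℝ} (hg : ContinuousOn g (Icc 0 T)) {ψ : ℝ × ℝ → ℝ} (hψ : Continuous ψ)
    {un : ℕ → ℝ × ℝ → ℝ} {u : ℝ × ℝ → ℝ}
    (hun : ∀ n, Integrable (un n) (volume.restrict (Icc a b)))
    (hu : Integrable u (volume.restrict (Icc a b)))
    (huu : Tendsto (fun n => ∫⁻ x, ‖un n x - u x‖ₑ ∂(volume.restrict (Icc a b))) atTop (𝓝 0)) :
    Tendsto (fun n => ∫ p in Icc a b, (ψ p * g (nsq (Fn n p - y))) * un n p) atTop
      (𝓝 (∫ p in Icc a b, (ψ p * g (nsq (F p - y))) * u p)) := by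
  obtain ⟨C1, hC1⟩ := (isCompact_Icc (a := (0:ℝ)) (b := T)).exists_bound_of_continuousOn hg
  obtain ⟨C2, hC2⟩ := (isCompact_Icc (a := a) (b := b)).exists_bound_of_continuousOn hψ.continuousOn
  have hmem : ∀ n, ∀ p ∈ Icc a b, nsq (Fn n p - y) ∈ Icc 0 T := fun n p hp =>
    ⟨nsq_nonneg _, nsq_le (h.bdd n p hp) hT⟩
  have hmemF : ∀ p ∈ Icc a b, nsq (F p - y) ∈ Icc 0 T := fun p hp =>
    ⟨nsq_nonneg _, nsq_le (h.bddF hp) hT⟩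
  refine conv_mul (C := C2 * C1) hun hu huu ?_ ?_ ?_
  · intro n
    apply ContinuousOn.aestronglyMeasurable _ measurableSet_Icc
    exact hψ.continuousOn.mul (hg.comp
      ((continuous_nsq.comp ((h.smooth n).continuous.sub continuous_const)).continuousOn) (hmem n))
  · intro n
    filter_upwards [ae_restrict_mem measurableSet_Icc] with p hp
    rw [abs_mul]
    exact mul_le_mul (hC2 p hp) (hC1 _ (hmem n p hp)) (abs_nonneg _) ((norm_nonneg _).trans (hC2 p hp))
  · filter_upwards [ae_restrict_mem measurableSet_Icc] with p hp
    apply Tendsto.const_mul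
    have h1 : Tendsto (fun n => nsq (Fn n p - y)) atTop (𝓝[Icc 0 T] (nsq (F p - y))) := by
      apply tendsto_nhdsWithin_of_tendsto_nhds_of_eventually_within
      · exact (continuous_nsq.tendsto _).comp ((h.lim hp).sub tendsto_const_nhds)
      · exact Eventually.of_forall fun n => hmem n p hp
    exact (hg _ (hmemF p hp)).tendsto.comp h1

/-- Limit of the Jacobian term on a sub-rectangle. -/
lemma lim_jac (h : Approx a b F Fx Fy Fn M) (y : ℂ) {T : ℝ} (hT : (M + ‖y‖) ^ 2 ≤ T)
    {g : ℝ → ℝ} (hg : ContinuousOn g (Icc 0 T)) {ψ : ℝ × ℝ → ℝ} (hψ : Continuous ψ) :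
    Tendsto (fun n => ∫ p in Icc a b, (ψ p * g (nsq (Fn n p - y))) * crs (dX (Fn n) p) (dY (Fn n) p)) atTop
      (𝓝 (∫ p in Icc a b, (ψ p * g (nsq (F p - y))) * crs (Fx p) (Fy p))) :=
  h.lim_term y hT hg hψ (fun n => integrable_crs (h.memdX n) (h.memdY n)) (integrable_crs h.memx h.memy)
    (crs_L1 h.memx h.memy h.memdX h.memdY h.convx h.convy)

lemma memF (h : Approx a b F Fx Fy Fn M) (y : ℂ) :
    MemLp (fun p => F p - y) 2 (volume.restrict (Icc a b)) :=
  memLp_of_cont (h.cont.sub continuousOn_const)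

lemma memFn (h : Approx a b F Fx Fy Fn M) (y : ℂ) (n : ℕ) :
    MemLp (fun p => Fn n p - y) 2 (volume.restrict (Icc a b)) :=
  memLp_of_cont ((h.smooth n).continuous.sub continuous_const).continuousOn

end Approx

open MeasureTheory Set Filter
open scoped ENNReal Real Topology


lemma int3 {α : Type*} [MeasurableSpace α] {μ : Measure α} {u v w : α → ℝ} (hu : Integrable u μ)
    (hv : Integrable v μ) (hw : Integrable w μ) :
    (∫ x, u x ∂μ) + (∫ x, v x ∂μ) - (∫ x, w x ∂μ) = ∫ x, (u x + v x - w x) ∂μ := by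
  have huv : Integrable (fun x => u x + v x) μ := hu.add hv
  rw [integral_sub huv hw, integral_add hu hv]

lemma int_le {α : Type*} [MeasurableSpace α] {μ : Measure α} {u v w : α → ℝ} (hu : Integrable u μ)
    (hv : Integrable v μ) (hw : Integrable w μ) (hz : ∫ x, w x ∂μ = 0)
    (hle : ∀ᵐ x ∂μ, u x ≤ v x + w x) : ∫ x, u x ∂μ ≤ ∫ x, v x ∂μ := by
  have := integral_mono_ae (g := fun x => v x + w x) hu (hv.add hw) hle
  rwa [integral_add hv hw, hz, add_zero] at this

/-- Approximation data plus the distortion inequality. -/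
structure Dist2 (a b : ℝ × ℝ) (F Fx Fy : ℝ × ℝ → ℂ) (Fn : ℕ → ℝ × ℝ → ℂ) (M : ℝ)
    (K : ℝ × ℝ → ℝ) : Prop where
  app : Approx a b F Fx Fy Fn M
  K1 : ∀ p, 1 ≤ K p
  Kint : IntegrableOn K (Icc a b)
  dx : ∀ᵐ p ∂(volume.restrict (Icc a b)), ‖Fx p‖ ^ 2 ≤ K p * crs (Fx p) (Fy p)
  dy : ∀ᵐ p ∂(volume.restrict (Icc a b)), ‖Fy p‖ ^ 2 ≤ K p * crs (Fx p) (Fy p)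

namespace Dist2

variable {a b : ℝ × ℝ} {F Fx Fy : ℝ × ℝ → ℂ} {Fn : ℕ → ℝ × ℝ → ℂ} {M : ℝ} {K : ℝ × ℝ → ℝ}

lemma mono (h : Dist2 a b F Fx Fy Fn M K) {c d : ℝ × ℝ} (hs : Icc c d ⊆ Icc a b) :
    Dist2 c d F Fx Fy Fn M K :=
  ⟨h.app.mono hs, h.K1, h.Kint.mono_set hs, ae_restrict_of_ae_restrict_of_subset hs h.dx,
    ae_restrict_of_ae_restrict_of_subset hs h.dy⟩

lemma jac_nonneg (h : Dist2 a b F Fx Fy Fn M K) :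
    ∀ᵐ p ∂(volume.restrict (Icc a b)), 0 ≤ crs (Fx p) (Fy p) := by
  filter_upwards [h.dx] with p hp
  have h1 : 0 < K p := lt_of_lt_of_le one_pos (h.K1 p)
  have h2 : 0 ≤ K p * crs (Fx p) (Fy p) := le_trans (by positivity) hp
  exact nonneg_of_mul_nonneg_right h2 h1

lemma int_term {a b : ℝ × ℝ} {H : ℝ × ℝ → ℂ} {M : ℝ} (hc : ContinuousOn H (Icc a b))
    (hM : ∀ p ∈ Icc a b, ‖H p‖ ≤ M) (y : ℂ) {T : ℝ} (hT : (M + ‖y‖) ^ 2 ≤ T)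
    {g : ℝ → ℝ} (hg : ContinuousOn g (Icc 0 T)) {ψ : ℝ × ℝ → ℝ} (hψ : Continuous ψ)
    {u : ℝ × ℝ → ℝ}
    (hu : Integrable u (volume.restrict (Icc a b))) :
    Integrable (fun p => (ψ p * g (nsq (H p - y))) * u p) (volume.restrict (Icc a b)) := by
  have hmem : ∀ p ∈ Icc a b, nsq (H p - y) ∈ Icc 0 T := fun p hp =>
    ⟨nsq_nonneg _, Approx.nsq_le (hM p hp) hT⟩
  have hcc : ContinuousOn (fun p => ψ p * g (nsq (H p - y))) (Icc a b) :=
    hψ.continuousOn.mul (hg.comp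
      (continuous_nsq.comp_continuousOn (hc.sub continuousOn_const)) hmem)
  obtain ⟨C, hC⟩ := isCompact_Icc.exists_bound_of_continuousOn hcc
  refine hu.bdd_mul (c := C) (hcc.aestronglyMeasurable measurableSet_Icc) ?_
  filter_upwards [ae_restrict_mem measurableSet_Icc] with p hp using hC p hp

lemma green_lim (h : Dist2 a b F Fx Fy Fn M K) (hab : a ≤ b) (y : ℂ) {T : ℝ}
    (hT : (M + ‖y‖) ^ 2 ≤ T)
    {G G' : ℝ → ℝ} (hG : ∀ t ∈ Icc 0 T, HasDerivAt G (G' t) t)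
    (hG' : ContinuousOn G' (Icc 0 T)) {ψ : ℝ × ℝ → ℝ} (hψ : ContDiff ℝ 1 ψ)
    (hψb : ∀ p ∈ bdry a b, ψ p = 0) :
    (∫ p in Icc a b, (ψ p * (2 * G (nsq (F p - y)) + 2 * nsq (F p - y) * G' (nsq (F p - y)))) * crs (Fx p) (Fy p))
     + (∫ p in Icc a b, (fderiv ℝ ψ p (1,0) * G (nsq (F p - y))) * crs (F p - y) (Fy p))
     - (∫ p in Icc a b, (fderiv ℝ ψ p (0,1) * G (nsq (F p - y))) * crs (F p - y) (Fx p)) = 0 := by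
  have hA := h.app
  have hGc : ContinuousOn G (Icc 0 T) := fun t ht => (hG t ht).continuousAt.continuousWithinAt
  have hgc : ContinuousOn (fun t => 2 * G t + 2 * t * G' t) (Icc 0 T) := by fun_prop
  have cψ := hψ.continuous
  have cψx : Continuous fun p => fderiv ℝ ψ p (1,0) :=
    (hψ.continuous_fderiv (by norm_num)).clm_apply continuous_const
  have cψy : Continuous fun p => fderiv ℝ ψ p (0,1) :=
    (hψ.continuous_fderiv (by norm_num)).clm_apply continuous_const
  have t1 := hA.lim_jac y hT hgc cψ
  have iY : ∀ n, Integrable (fun p => crs (Fn n p - y) (dY (Fn n) p)) (volume.restrict (Icc a b)) :=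
    fun n => integrable_crs (hA.memFn y n) (hA.memdY n)
  have iX : ∀ n, Integrable (fun p => crs (Fn n p - y) (dX (Fn n) p)) (volume.restrict (Icc a b)) :=
    fun n => integrable_crs (hA.memFn y n) (hA.memdX n)
  have t2 := hA.lim_term y hT hGc cψx iY (integrable_crs (hA.memF y) hA.memy)
    (crs_L1 (hA.memF y) hA.memy (hA.memFn y) hA.memdY (hA.conv0 y) hA.convy)
  have t3 := hA.lim_term y hT hGc cψy iX (integrable_crs (hA.memF y) hA.memx)
    (crs_L1 (hA.memF y) hA.memx (hA.memFn y) hA.memdX (hA.conv0 y) hA.convx)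
  have t := (t1.add t2).sub t3
  refine tendsto_nhds_unique t ?_
  refine tendsto_const_nhds.congr fun n => ?_
  have hs : ContDiff ℝ 2 (fun p => Fn n p - y) := (hA.smooth n).sub contDiff_const
  have hcn := (hA.smooth n).continuous.continuousOn (s := Icc a b)
  rw [int3 (int_term hcn (hA.bdd n) y hT hgc cψ (integrable_crs (hA.memdX n) (hA.memdY n)))
    (int_term hcn (hA.bdd n) y hT hGc cψx (iY n)) (int_term hcn (hA.bdd n) y hT hGc cψy (iX n))]
  have hg := green hs hψ hG hG' hab (fun p hp => Approx.nsq_le (hA.bdd n p hp) hT)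
  have z1 : ∀ x ∈ uIcc a.1 b.1, ψ (x, b.2) = 0 := fun x hx => by
    rw [uIcc_of_le hab.1] at hx
    exact hψb _ ⟨⟨⟨hx.1, hab.2⟩, ⟨hx.2, le_rfl⟩⟩, by simp⟩
  have z2 : ∀ x ∈ uIcc a.1 b.1, ψ (x, a.2) = 0 := fun x hx => by
    rw [uIcc_of_le hab.1] at hx
    exact hψb _ ⟨⟨⟨hx.1, le_rfl⟩, ⟨hx.2, hab.2⟩⟩, by simp⟩
  have z3 : ∀ x ∈ uIcc a.2 b.2, ψ (b.1, x) = 0 := fun x hx => by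
    rw [uIcc_of_le hab.2] at hx
    exact hψb _ ⟨⟨⟨hab.1, hx.1⟩, ⟨le_rfl, hx.2⟩⟩, by simp⟩
  have z4 : ∀ x ∈ uIcc a.2 b.2, ψ (a.1, x) = 0 := fun x hx => by
    rw [uIcc_of_le hab.2] at hx
    exact hψb _ ⟨⟨⟨le_rfl, hx.1⟩, ⟨hab.1, hx.2⟩⟩, by simp⟩
  have zz : ∀ {c d : ℝ} {f : ℝ → ℝ}, (∀ x ∈ uIcc c d, f x = 0) → ∫ x in c..d, f x = 0 := by
    intro c d f hf
    rw [intervalIntegral.integral_congr (g := fun _ => 0) hf]; simp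
  rw [zz (fun x hx => by simp [z1 x hx]), zz (fun x hx => by simp [z2 x hx]),
    zz (fun x hx => by simp [z3 x hx]), zz (fun x hx => by simp [z4 x hx])] at hg
  simp only [Approx.dX_sub, Approx.dY_sub] at hg
  refine (show (0:ℝ) = 0 - 0 + 0 - 0 by ring).trans (hg.symm.trans ?_)
  refine integral_congr_ae (Eventually.of_forall fun p => ?_)
  beta_reduce
  ring

lemma star (h : Dist2 a b F Fx Fy Fn M K) (hab : a ≤ b) (y : ℂ) {T : ℝ}
    (hT : (M + ‖y‖) ^ 2 ≤ T)
    {G G' : ℝ → ℝ} (hG : ∀ t ∈ Icc 0 T, HasDerivAt G (G' t) t)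
    (hG' : ContinuousOn G' (Icc 0 T)) {φ : ℝ × ℝ → ℝ} (hφ : ContDiff ℝ 1 φ)
    (hφb : ∀ p ∈ bdry a b, φ p = 0) :
    ∫ p in Icc a b, (φ p ^ 2 * (2 * G (nsq (F p - y)) + 2 * nsq (F p - y) * G' (nsq (F p - y))
        - nsq (F p - y) * G (nsq (F p - y)) ^ 2)) * crs (Fx p) (Fy p)
     ≤ ∫ p in Icc a b, (|fderiv ℝ φ p (1,0)| + |fderiv ℝ φ p (0,1)|) ^ 2 * K p := by
  have hA := h.app
  have hGc : ContinuousOn G (Icc 0 T) := fun t ht => (hG t ht).continuousAt.continuousWithinAt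
  have hgc : ContinuousOn (fun t => 2 * G t + 2 * t * G' t) (Icc 0 T) := by fun_prop
  have hgc2 : ContinuousOn (fun t => 2 * G t + 2 * t * G' t - t * G t ^ 2) (Icc 0 T) := by fun_prop
  have cφx : Continuous fun p => fderiv ℝ φ p (1,0) :=
    (hφ.continuous_fderiv (by norm_num)).clm_apply continuous_const
  have cφy : Continuous fun p => fderiv ℝ φ p (0,1) :=
    (hφ.continuous_fderiv (by norm_num)).clm_apply continuous_const
  have cφ := hφ.continuous
  have hψ : ContDiff ℝ 1 (fun p => φ p ^ 2) := hφ.pow 2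
  have cψx : Continuous fun p => fderiv ℝ (fun p => φ p ^ 2) p (1,0) :=
    (hψ.continuous_fderiv (by norm_num)).clm_apply continuous_const
  have cψy : Continuous fun p => fderiv ℝ (fun p => φ p ^ 2) p (0,1) :=
    (hψ.continuous_fderiv (by norm_num)).clm_apply continuous_const
  have hψd : ∀ p v, fderiv ℝ (fun p => φ p ^ 2) p v = 2 * φ p * fderiv ℝ φ p v := by
    intro p v
    have := ((hφ.differentiable (by norm_num)) p).hasFDerivAt.pow 2
    rw [this.fderiv]
    simp
  have hgl := h.green_lim hab y hT hG hG' hψ (fun p hp => by simp [hφb p hp])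
  have cF := hA.cont
  have bF : ∀ p ∈ Icc a b, ‖F p‖ ≤ M := fun p hp => hA.bddF hp
  have i1 := int_term cF bF y hT hgc hψ.continuous (integrable_crs hA.memx hA.memy)
  have i2 := int_term cF bF y hT hGc cψx (integrable_crs (hA.memF y) hA.memy)
  have i3 := int_term cF bF y hT hGc cψy (integrable_crs (hA.memF y) hA.memx)
  have i4 := int_term cF bF y hT hgc2 hψ.continuous (integrable_crs hA.memx hA.memy)
  have i5 : Integrable (fun p => (|fderiv ℝ φ p (1,0)| + |fderiv ℝ φ p (0,1)|) ^ 2 * K p)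
      (volume.restrict (Icc a b)) := by
    have hcc : Continuous (fun p => (|fderiv ℝ φ p (1,0)| + |fderiv ℝ φ p (0,1)|) ^ 2) := by fun_prop
    obtain ⟨C, hC⟩ := (isCompact_Icc (a := a) (b := b)).exists_bound_of_continuousOn hcc.continuousOn
    refine h.Kint.bdd_mul (c := C) hcc.aestronglyMeasurable ?_
    filter_upwards [ae_restrict_mem measurableSet_Icc] with p hp using hC p hp
  rw [int3 i1 i2 i3] at hgl
  refine int_le i4 i5 ((i1.add i2).sub i3) hgl ?_
  filter_upwards [h.dx, h.dy, h.jac_nonneg] with p hx hy hJ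
  simp only [Pi.add_apply, Pi.sub_apply, hψd]
  set J := crs (Fx p) (Fy p)
  set t := nsq (F p - y) with ht
  set X := fderiv ℝ φ p (1,0)
  set Y := fderiv ℝ φ p (0,1)
  set c1 := crs (F p - y) (Fy p) with hc1
  set c2 := crs (F p - y) (Fx p) with hc2
  set S := Real.sqrt (K p) with hS
  set W := Real.sqrt J with hW
  have hK : S ^ 2 = K p := Real.sq_sqrt (zero_le_one.trans (h.K1 p))
  have hJW : W ^ 2 = J := Real.sq_sqrt hJ
  have hS0 : 0 ≤ S := Real.sqrt_nonneg _
  have hW0 : 0 ≤ W := Real.sqrt_nonneg _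
  set n := ‖F p - y‖ with hn
  have hn0 : 0 ≤ n := norm_nonneg _
  have htn : t = n ^ 2 := nsq_eq_norm _
  rw [← hK, ← hJW, ← mul_pow] at hx hy
  have hx' : ‖Fx p‖ ≤ S * W := le_of_sq_le_sq hx (by positivity)
  have hy' : ‖Fy p‖ ≤ S * W := le_of_sq_le_sq hy (by positivity)
  have b1 : |c1| ≤ n * (S * W) := (abs_crs_le _ _).trans (by gcongr)
  have b2 : |c2| ≤ n * (S * W) := (abs_crs_le _ _).trans (by gcongr)
  set g := G t
  have e1 : |2 * φ p * X * g * c1 - 2 * φ p * Y * g * c2| ≤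
      2 * ((|X| + |Y|) * S) * (|φ p| * |g| * n * W) := by
    calc _ ≤ |2 * φ p * X * g * c1| + |2 * φ p * Y * g * c2| := abs_sub _ _
      _ = 2 * |φ p| * |X| * |g| * |c1| + 2 * |φ p| * |Y| * |g| * |c2| := by
        simp [abs_mul]
      _ ≤ 2 * |φ p| * |X| * |g| * (n * (S * W)) + 2 * |φ p| * |Y| * |g| * (n * (S * W)) := by gcongr
      _ = _ := by ring
  have e2 := two_mul_le_add_sq ((|X| + |Y|) * S) (|φ p| * |g| * n * W)
  have e3 := neg_le_of_abs_le (e1.trans e2)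
  have e4 : (|φ p| * |g| * n * W) ^ 2 = φ p ^ 2 * (t * g ^ 2) * J := by
    rw [mul_pow, mul_pow, mul_pow, sq_abs, sq_abs, hJW, htn]; ring
  have e5 : ((|X| + |Y|) * S) ^ 2 = (|X| + |Y|) ^ 2 * K p := by rw [mul_pow, hK]
  rw [e4, e5] at e3
  linarith

end Dist2

open MeasureTheory Set Filter
open scoped ENNReal Real Topology


namespace Dist2

variable {a b : ℝ × ℝ} {F Fx Fy : ℝ × ℝ → ℂ} {Fn : ℕ → ℝ × ℝ → ℂ} {M : ℝ} {K : ℝ × ℝ → ℝ}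

lemma star2 (h : Dist2 a b F Fx Fy Fn M K) {a' b' : ℝ × ℝ} (h1 : a.1 < a'.1) (h2 : a'.1 ≤ b'.1)
    (h3 : b'.1 < b.1) (h4 : a.2 < a'.2) (h5 : a'.2 ≤ b'.2) (h6 : b'.2 < b.2) :
    ∃ C : ℝ, 0 ≤ C ∧ ∀ (y : ℂ) (T : ℝ) (_ : (M + ‖y‖) ^ 2 ≤ T) (G G' : ℝ → ℝ)
      (_ : ∀ t ∈ Icc 0 T, HasDerivAt G (G' t) t) (_ : ContinuousOn G' (Icc 0 T))
      (_ : ∀ t ∈ Icc 0 T, 0 ≤ 2 * G t + 2 * t * G' t - t * G t ^ 2),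
      ∫ p in Icc a' b', (2 * G (nsq (F p - y)) + 2 * nsq (F p - y) * G' (nsq (F p - y))
        - nsq (F p - y) * G (nsq (F p - y)) ^ 2) * crs (Fx p) (Fy p) ≤ C := by
  set φ : ℝ × ℝ → ℝ := fun p => (p.1 - a.1) * (b.1 - p.1) * (p.2 - a.2) * (b.2 - p.2) with hφdef
  have hφ : ContDiff ℝ 1 φ := by unfold φ; fun_prop
  have hφb : ∀ p ∈ bdry a b, φ p = 0 := by
    rintro p ⟨_, h | h | h | h⟩ <;> simp [φ, h]
  have hab : a ≤ b := ⟨(h1.trans_le (h2.trans h3.le)).le, (h4.trans_le (h5.trans h6.le)).le⟩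
  set c0 : ℝ := (a'.1 - a.1) * (b.1 - b'.1) * (a'.2 - a.2) * (b.2 - b'.2) with hc0
  have p1 : 0 < a'.1 - a.1 := by linarith
  have p2 : 0 < b.1 - b'.1 := by linarith
  have p3 : 0 < a'.2 - a.2 := by linarith
  have p4 : 0 < b.2 - b'.2 := by linarith
  have c0p : 0 < c0 := by positivity
  have hφc : ∀ p ∈ Icc a' b', c0 ≤ φ p := by
    rintro p ⟨⟨ha, hb⟩, ⟨hc, hd⟩⟩
    have q1 : a'.1 - a.1 ≤ p.1 - a.1 := by linarith
    have q2 : b.1 - b'.1 ≤ b.1 - p.1 := by linarith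
    have q3 : a'.2 - a.2 ≤ p.2 - a.2 := by linarith
    have q4 : b.2 - b'.2 ≤ b.2 - p.2 := by linarith
    simp only [c0, φ]
    have := p1.trans_le q1
    have := p2.trans_le q2
    have := p3.trans_le q3
    have := p4.trans_le q4
    gcongr
  have hsub : Icc a' b' ⊆ Icc a b := Icc_subset_Icc ⟨h1.le, h4.le⟩ ⟨h3.le, h6.le⟩
  refine ⟨(c0 ^ 2)⁻¹ * ∫ p in Icc a b, (|fderiv ℝ φ p (1,0)| + |fderiv ℝ φ p (0,1)|) ^ 2 * K p, ?_, ?_⟩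
  · have : 0 ≤ ∫ p in Icc a b, (|fderiv ℝ φ p (1,0)| + |fderiv ℝ φ p (0,1)|) ^ 2 * K p := by
      apply integral_nonneg
      intro p
      have : 0 ≤ K p := zero_le_one.trans (h.K1 p)
      simp only [Pi.zero_apply]
      positivity
    positivity
  intro y T hT G G' hG hG' hpos
  have hs := h.star hab y hT hG hG' hφ hφb
  have hGc : ContinuousOn G (Icc 0 T) := fun t ht => (hG t ht).continuousAt.continuousWithinAt
  have hgc2 : ContinuousOn (fun t => 2 * G t + 2 * t * G' t - t * G t ^ 2) (Icc 0 T) := by fun_prop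
  have hA := h.app
  have bF : ∀ p ∈ Icc a b, ‖F p‖ ≤ M := fun p hp => hA.bddF hp
  have hmem : ∀ p ∈ Icc a b, nsq (F p - y) ∈ Icc 0 T := fun p hp =>
    ⟨nsq_nonneg _, Approx.nsq_le (bF p hp) hT⟩
  have i4 := int_term hA.cont bF y hT hgc2 (hφ.pow 2).continuous (integrable_crs hA.memx hA.memy)
  have i5 := int_term hA.cont bF y hT hgc2 (continuous_const (y := (1:ℝ))) (integrable_crs hA.memx hA.memy)
  simp only [one_mul] at i5
  have hn : ∀ᵐ p ∂(volume.restrict (Icc a b)), 0 ≤ (2 * G (nsq (F p - y)) + 2 * nsq (F p - y) * G' (nsq (F p - y))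
        - nsq (F p - y) * G (nsq (F p - y)) ^ 2) * crs (Fx p) (Fy p) := by
    filter_upwards [h.jac_nonneg, ae_restrict_mem measurableSet_Icc] with p hp hm
    exact mul_nonneg (hpos _ (hmem p hm)) hp
  rw [le_inv_mul_iff₀ (by positivity), ← integral_const_mul]
  refine le_trans ?_ (le_trans (setIntegral_mono_set i4 ?_ (Eventually.of_forall hsub)) hs)
  · refine setIntegral_mono_ae_restrict ((IntegrableOn.mono_set i5 hsub).const_mul _) (IntegrableOn.mono_set i4 hsub) ?_
    filter_upwards [ae_restrict_of_ae_restrict_of_subset hsub hn, ae_restrict_mem measurableSet_Icc] with p hp hm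
    rw [mul_assoc (φ p ^ 2)]
    have := hφc p hm
    gcongr
  · filter_upwards [hn] with p hp
    simp only [Pi.zero_apply]
    rw [mul_assoc]
    positivity

end Dist2

namespace Approx
variable {a b : ℝ × ℝ} {F Fx Fy : ℝ × ℝ → ℂ} {Fn : ℕ → ℝ × ℝ → ℂ} {M : ℝ}

lemma isCompact_bdry (a b : ℝ × ℝ) : IsCompact (bdry a b) := by
  have : bdry a b = Icc a b ∩ {p | p.1 = a.1 ∨ p.1 = b.1 ∨ p.2 = a.2 ∨ p.2 = b.2} := rfl
  rw [this]
  apply isCompact_Icc.inter_right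
  refine (isClosed_eq continuous_fst continuous_const).union
    ((isClosed_eq continuous_fst continuous_const).union
    ((isClosed_eq continuous_snd continuous_const).union (isClosed_eq continuous_snd continuous_const)))

lemma int_lim (h : Approx a b F Fx Fy Fn M) (hab : a ≤ b) (y : ℂ) {ρ : ℝ} (hρ : 0 < ρ)
    (hb : ∀ p ∈ bdry a b, ρ < ‖F p - y‖) {T : ℝ} (hT : (M + ‖y‖) ^ 2 ≤ T) :
    ∃ m : ℤ, ∀ (G G' : ℝ → ℝ) (_ : ∀ t ∈ Icc 0 T, HasDerivAt G (G' t) t)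
      (_ : ContinuousOn G' (Icc 0 T)) (_ : ∀ t, ρ ^ 2 ≤ t → G t = 1 / t),
      ∫ p in Icc a b, (2 * G (nsq (F p - y)) + 2 * nsq (F p - y) * G' (nsq (F p - y)))
        * crs (Fx p) (Fy p) = 2 * π * m := by
  have hsub : bdry a b ⊆ Icc a b := fun p hp => hp.1
  obtain ⟨N, hN⟩ : ∃ N, ∀ n ≥ N, ∀ p ∈ bdry a b, ρ < ‖Fn n p - y‖ := by
    have hne : (bdry a b).Nonempty := ⟨a, left_mem_Icc.2 hab, Or.inl rfl⟩
    obtain ⟨q, hq, hqm⟩ := (isCompact_bdry a b).exists_isMinOn hne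
      (f := fun p => ‖F p - y‖) ((h.cont.mono hsub).sub continuousOn_const).norm
    have hp := hb q hq
    obtain ⟨N, hN⟩ := eventually_atTop.1 (Metric.tendstoUniformlyOn_iff.1 h.unif (‖F q - y‖ - ρ) (by linarith))
    refine ⟨N, fun n hn p hpp => ?_⟩
    have e1 := hN n hn p (hsub hpp)
    have e2 : ‖F q - y‖ ≤ ‖F p - y‖ := hqm hpp
    rw [dist_eq_norm] at e1
    have e3 : ‖F p - y‖ ≤ ‖F p - Fn n p‖ + ‖Fn n p - y‖ := by
      simpa using norm_add_le (F p - Fn n p) (Fn n p - y)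
    linarith
  have hm : ∀ n, ∃ m : ℤ, ∀ (G G' : ℝ → ℝ) (_ : ∀ t ∈ Icc 0 T, HasDerivAt G (G' t) t)
      (_ : ContinuousOn G' (Icc 0 T)) (_ : ∀ t, ρ ^ 2 ≤ t → G t = 1 / t), N ≤ n →
      ∫ p in Icc a b, (2 * G (nsq (Fn n p - y)) + 2 * nsq (Fn n p - y) * G' (nsq (Fn n p - y)))
        * crs (dX (Fn n) p) (dY (Fn n) p) = 2 * π * m := by
    intro n
    by_cases hn : N ≤ n
    · have hs : ContDiff ℝ 2 (fun p => Fn n p - y) := (h.smooth n).sub contDiff_const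
      obtain ⟨m, hm⟩ := integrality hs hab (fun p hp h0 => by
        have := hN n hn p hp
        rw [h0, norm_zero] at this
        linarith)
      refine ⟨m, fun G G' hG hG' hGr _ => ?_⟩
      have := hm G G' T hG hG' (fun p hp => nsq_le (h.bdd n p hp) hT) (fun p hp => by
        apply hGr
        rw [nsq_eq_norm]
        have := hN n hn p hp
        gcongr)
      simpa only [dX_sub, dY_sub] using this
    · exact ⟨0, fun _ _ _ _ _ h => absurd h hn⟩
  choose m hm using hm
  have key : ∀ (G G' : ℝ → ℝ) (_ : ∀ t ∈ Icc 0 T, HasDerivAt G (G' t) t)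
      (_ : ContinuousOn G' (Icc 0 T)) (_ : ∀ t, ρ ^ 2 ≤ t → G t = 1 / t),
      Tendsto (fun n => 2 * π * (m n : ℝ)) atTop (𝓝 (∫ p in Icc a b, (2 * G (nsq (F p - y)) + 2 * nsq (F p - y) * G' (nsq (F p - y)))
        * crs (Fx p) (Fy p))) := by
    intro G G' hG hG' hGr
    have hGc : ContinuousOn G (Icc 0 T) := fun t ht => (hG t ht).continuousAt.continuousWithinAt
    have hgc : ContinuousOn (fun t => 2 * G t + 2 * t * G' t) (Icc 0 T) := by fun_prop
    have t1 := h.lim_jac y hT hgc (continuous_const (y := (1:ℝ)))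
    simp only [one_mul] at t1
    refine t1.congr' ?_
    filter_upwards [eventually_ge_atTop N] with n hn
    exact hm n G G' hG hG' hGr hn
  by_cases hex : ∃ (G G' : ℝ → ℝ), (∀ t ∈ Icc 0 T, HasDerivAt G (G' t) t) ∧
      (ContinuousOn G' (Icc 0 T)) ∧ (∀ t, ρ ^ 2 ≤ t → G t = 1 / t)
  · obtain ⟨G, G', h1, h2, h3⟩ := hex
    have t := key G G' h1 h2 h3
    set I := ∫ p in Icc a b, (2 * G (nsq (F p - y)) + 2 * nsq (F p - y) * G' (nsq (F p - y)))
        * crs (Fx p) (Fy p)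
    have t2 : Tendsto (fun n => (m n : ℝ)) atTop (𝓝 (I / (2 * π))) := by
      refine (t.div_const (2 * π)).congr fun n => ?_
      have := Real.pi_pos
      field_simp
    obtain ⟨k, hk⟩ := Int.isClosedEmbedding_coe_real.isClosed_range.mem_of_tendsto t2
      (Eventually.of_forall fun n => mem_range_self (m n))
    refine ⟨k, fun G G' h1 h2 h3 => ?_⟩
    have := tendsto_nhds_unique (key G G' h1 h2 h3) t
    rw [this]
    have hpi := Real.pi_pos
    rw [hk]
    field_simp
  · exact ⟨0, fun G G' h1 h2 h3 => absurd ⟨G, G', h1, h2, h3⟩ hex⟩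

end Approx

open MeasureTheory Set Filter
open scoped ENNReal Real Topology


lemma aemeasurable_liminf_nat {α : Type*} [MeasurableSpace α] {μ : Measure α} {u : ℕ → α → ℝ≥0∞}
    (hu : ∀ n, AEMeasurable (u n) μ) : AEMeasurable (fun y => liminf (fun n => u n y) atTop) μ := by
  refine ⟨fun y => liminf (fun n => (hu n).mk (u n) y) atTop,
    Measurable.liminf fun n => (hu n).measurable_mk, ?_⟩
  filter_upwards [ae_all_iff.2 fun n => (hu n).ae_eq_mk] with y hy
  simp only [hy]

namespace Approx
variable {a b : ℝ × ℝ} {F Fx Fy : ℝ × ℝ → ℂ} {Fn : ℕ → ℝ × ℝ → ℂ} {M : ℝ}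

lemma restrict_Icc_prod (a b : ℝ × ℝ) : (volume : Measure (ℝ × ℝ)).restrict (Icc a b) =
    (volume.restrict (Icc a.1 b.1)).prod (volume.restrict (Icc a.2 b.2)) := by
  rw [Measure.prod_restrict, Icc_prod_Icc]
  rfl

lemma ftc_row {H : ℝ × ℝ → ℂ} (hH : ContDiff ℝ 2 H) (y0 : ℂ) {T : ℝ}
    {g g' : ℝ → ℝ} (hg : ∀ t ∈ Icc 0 T, HasDerivAt g (g' t) t)
    (hg' : ContinuousOn g' (Icc 0 T)) {c d y : ℝ} (hT : ∀ x ∈ Icc c d, nsq (H (x, y) - y0) ≤ T)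
    {x x' : ℝ} (hx : x ∈ Icc c d) (hx' : x' ∈ Icc c d) (hxx : x ≤ x') :
    ‖g (nsq (H (x', y) - y0)) - g (nsq (H (x, y) - y0))‖ₑ ≤
      ∫⁻ x in Icc c d, ‖g' (nsq (H (x, y) - y0)) * (2 * ‖H (x, y) - y0‖)‖ₑ * ‖dX H (x, y)‖ₑ := by
  have hs : Icc x x' ⊆ Icc c d := Icc_subset_Icc hx.1 hx'.2
  set D : ℝ → ℝ := fun x => g' (nsq (H (x, y) - y0)) * (2 * (H (x, y) - y0).re * (dX H (x, y)).re +
    2 * (H (x, y) - y0).im * (dX H (x, y)).im) with hD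
  have hmem : ∀ x ∈ Icc c d, nsq (H (x, y) - y0) ∈ Icc 0 T := fun x hx => ⟨nsq_nonneg _, hT x hx⟩
  have hder : ∀ z ∈ uIcc x x', HasDerivAt (fun x => g (nsq (H (x, y) - y0))) (D z) z := by
    intro z hz
    rw [uIcc_of_le hxx] at hz
    have h1 := (hasDerivAt_row hH y z).sub_const y0
    have h2 : HasDerivAt (fun x => (H (x, y) - y0).re) (dX H (z, y)).re z :=
      Complex.reCLM.hasFDerivAt.comp_hasDerivAt z h1
    have h3 : HasDerivAt (fun x => (H (x, y) - y0).im) (dX H (z, y)).im z :=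
      Complex.imCLM.hasFDerivAt.comp_hasDerivAt z h1
    have h4 : HasDerivAt (fun x => nsq (H (x, y) - y0)) (2 * (H (z, y) - y0).re * (dX H (z, y)).re +
        2 * (H (z, y) - y0).im * (dX H (z, y)).im) z := by
      unfold nsq
      refine ((h2.pow 2).add (h3.pow 2)).congr_deriv ?_
      norm_num
    exact (hg _ (hmem z (hs hz))).comp z h4
  have cH := hH.continuous
  have cdX := continuous_dX hH
  have hDc : ContinuousOn D (uIcc x x') := by
    rw [uIcc_of_le hxx]
    refine ContinuousOn.mul (hg'.comp (t := Icc 0 T) ?_ fun z hz => hmem z (hs hz)) ?_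
    · exact (continuous_nsq.comp (by fun_prop : Continuous fun x => H (x, y) - y0)).continuousOn
    · apply Continuous.continuousOn
      fun_prop
  have := intervalIntegral.integral_eq_sub_of_hasDerivAt hder hDc.intervalIntegrable
  rw [← this, intervalIntegral.integral_of_le hxx]
  calc _ ≤ ∫⁻ x in Ioc x x', ‖D x‖ₑ := enorm_integral_le_lintegral_enorm _
    _ ≤ ∫⁻ x in Icc c d, ‖D x‖ₑ := lintegral_mono_set (Ioc_subset_Icc_self.trans hs)
    _ ≤ _ := by
      apply lintegral_mono
      intro z
      simp only [hD]
      rw [← ofReal_norm, ← ofReal_norm, ← ofReal_norm, ← ENNReal.ofReal_mul (norm_nonneg _)]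
      apply ENNReal.ofReal_le_ofReal
      rw [norm_mul, norm_mul (g' _) (2 * _), mul_assoc ‖g' _‖]
      gcongr
      rw [Real.norm_eq_abs, Real.norm_of_nonneg (by positivity)]
      set u := H (z, y) - y0
      set v := dX H (z, y)
      have : 2 * u.re * v.re + 2 * u.im * v.im = 2 * (starRingEnd ℂ u * v).re := by simp; ring
      rw [this, abs_mul, abs_two, mul_assoc]
      gcongr
      calc |(starRingEnd ℂ u * v).re| ≤ ‖starRingEnd ℂ u * v‖ := Complex.abs_re_le_norm _
        _ = ‖u‖ * ‖v‖ := by simp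

lemma acl_row (h : Approx a b F Fx Fy Fn M) :
    ∀ᵐ y ∂(volume.restrict (Icc a.2 b.2)), ∀ (y0 : ℂ) (T : ℝ) (_ : (M + ‖y0‖) ^ 2 ≤ T)
      (g g' : ℝ → ℝ) (_ : ∀ t ∈ Icc 0 T, HasDerivAt g (g' t) t)
      (_ : ContinuousOn g' (Icc 0 T)), ∀ x ∈ Icc a.1 b.1, ∀ x' ∈ Icc a.1 b.1, x ≤ x' →
      ‖g (nsq (F (x', y) - y0)) - g (nsq (F (x, y) - y0))‖ₑ ≤
      ∫⁻ x in Icc a.1 b.1, ‖g' (nsq (F (x, y) - y0)) * (2 * ‖F (x, y) - y0‖)‖ₑ * ‖Fx (x, y)‖ₑ := by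
  have hfin : IsFiniteMeasure (volume.restrict (Icc a b)) :=
    ⟨by simpa using isCompact_Icc.measure_lt_top⟩
  set u : ℕ → ℝ → ℝ≥0∞ := fun n y => ∫⁻ x in Icc a.1 b.1, ‖dX (Fn n) (x, y) - Fx (x, y)‖ₑ with hu
  have hLim : Tendsto (fun n => ∫⁻ p in Icc a b, ‖dX (Fn n) p - Fx p‖ₑ) atTop (𝓝 0) := by
    set V := (volume.restrict (Icc a b)) univ ^ (1 / (1:ℝ≥0∞).toReal - 1 / (2:ℝ≥0∞).toReal) with hV
    have hVt : V ≠ ⊤ := ENNReal.rpow_ne_top_of_nonneg (by norm_num) (measure_ne_top _ _)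
    have t := ENNReal.Tendsto.mul_const (b := V) h.convx (Or.inr hVt)
    rw [zero_mul] at t
    refine tendsto_of_tendsto_of_tendsto_of_le_of_le tendsto_const_nhds t (fun _ => zero_le) ?_
    intro n
    simp only
    rw [← eLpNorm_one_eq_lintegral_enorm]
    exact eLpNorm_le_eLpNorm_mul_rpow_measure_univ (by norm_num) ((h.memdX n).sub h.memx).1
  have hmeas : ∀ n, AEMeasurable (fun p => ‖dX (Fn n) p - Fx p‖ₑ) (volume.restrict (Icc a b)) :=
    fun n => ((h.memdX n).sub h.memx).1.enorm
  rw [restrict_Icc_prod] at hmeas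
  have hul : Tendsto (fun n => ∫⁻ y in Icc a.2 b.2, u n y) atTop (𝓝 0) := by
    refine hLim.congr fun n => ?_
    rw [restrict_Icc_prod, lintegral_prod_symm _ (hmeas n)]
  have hum : ∀ n, AEMeasurable (u n) (volume.restrict (Icc a.2 b.2)) := fun n =>
    (hmeas n).prod_swap.lintegral_prod_right'
  have hlimz : ∀ᵐ y ∂(volume.restrict (Icc a.2 b.2)), liminf (fun n => u n y) atTop = 0 := by
    have h1 := lintegral_liminf_le' (u := atTop) hum
    rw [hul.liminf_eq] at h1
    have h2 := (lintegral_eq_zero_iff' (aemeasurable_liminf_nat hum)).1 (le_antisymm h1 zero_le)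
    exact h2
  have hFxm : AEStronglyMeasurable Fx ((volume.restrict (Icc a.1 b.1)).prod (volume.restrict (Icc a.2 b.2))) := by
    rw [← restrict_Icc_prod]; exact h.memx.1
  have hmr : ∀ᵐ y ∂(volume.restrict (Icc a.2 b.2)), AEStronglyMeasurable (fun x => Fx (x, y))
      (volume.restrict (Icc a.1 b.1)) := hFxm.prod_swap.prodMk_left
  have hfr : ∀ᵐ y ∂(volume.restrict (Icc a.2 b.2)), ∫⁻ x in Icc a.1 b.1, ‖Fx (x, y)‖ₑ < ⊤ := by
    have h1 : ∫⁻ p in Icc a b, ‖Fx p‖ₑ < ⊤ :=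
      (h.memx.integrable (by norm_num)).2
    rw [restrict_Icc_prod, lintegral_prod_symm _ hFxm.enorm] at h1
    exact ae_lt_top' (hFxm.enorm.prod_swap.lintegral_prod_right') h1.ne
  filter_upwards [hlimz, hmr, hfr, ae_restrict_mem measurableSet_Icc] with y hl hm hf hy
  intro y0 T hT g g' hg hg' x hx x' hx' hxx
  have hQ : ∀ x ∈ Icc a.1 b.1, (x, y) ∈ Icc a b := fun x hx => ⟨⟨hx.1, hy.1⟩, ⟨hx.2, hy.2⟩⟩
  have hgc : ContinuousOn g (Icc 0 T) := fun t ht => (hg t ht).continuousAt.continuousWithinAt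
  have hmemn : ∀ n, ∀ p ∈ Icc a b, nsq (Fn n p - y0) ∈ Icc 0 T := fun n p hp =>
    ⟨nsq_nonneg _, nsq_le (h.bdd n p hp) hT⟩
  have hmemF : ∀ p ∈ Icc a b, nsq (F p - y0) ∈ Icc 0 T := fun p hp =>
    ⟨nsq_nonneg _, nsq_le (h.bddF hp) hT⟩
  have hnl : ∀ p ∈ Icc a b, Tendsto (fun n => nsq (Fn n p - y0)) atTop (𝓝[Icc 0 T] (nsq (F p - y0))) := by
    intro p hp
    apply tendsto_nhdsWithin_of_tendsto_nhds_of_eventually_within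
    · exact (continuous_nsq.tendsto _).comp ((h.lim hp).sub tendsto_const_nhds)
    · exact Eventually.of_forall fun n => hmemn n p hp
  obtain ⟨C1, hC1⟩ := (isCompact_Icc (a := (0:ℝ)) (b := T)).exists_bound_of_continuousOn hg'
  set C : ℝ≥0∞ := ENNReal.ofReal (C1 * (2 * (M + ‖y0‖))) with hC
  set A : ℕ → ℝ → ℝ≥0∞ := fun n x => ‖g' (nsq (Fn n (x, y) - y0)) * (2 * ‖Fn n (x, y) - y0‖)‖ₑ with hA
  have hAC : ∀ n, ∀ x ∈ Icc a.1 b.1, A n x ≤ C := by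
    intro n x hx
    simp only [hA, hC]
    rw [← ofReal_norm]
    apply ENNReal.ofReal_le_ofReal
    rw [norm_mul]
    refine mul_le_mul (hC1 _ (hmemn n _ (hQ x hx))) ?_ (norm_nonneg _) ((norm_nonneg _).trans (hC1 _ (hmemn n _ (hQ x hx))))
    rw [Real.norm_of_nonneg (by positivity)]
    have := norm_sub_le (Fn n (x, y)) y0
    have := h.bdd n _ (hQ x hx)
    linarith
  have hAm : ∀ n, AEMeasurable (A n) (volume.restrict (Icc a.1 b.1)) := by
    intro n
    have cH := (h.smooth n).continuous
    have : ContinuousOn (fun x => g' (nsq (Fn n (x, y) - y0)) * (2 * ‖Fn n (x, y) - y0‖)) (Icc a.1 b.1) := by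
      refine ContinuousOn.mul (hg'.comp (t := Icc 0 T) ?_ fun z hz => hmemn n _ (hQ z hz)) ?_
      · exact (continuous_nsq.comp (by fun_prop : Continuous fun x => Fn n (x, y) - y0)).continuousOn
      · apply Continuous.continuousOn
        fun_prop
    exact (this.aestronglyMeasurable measurableSet_Icc).enorm
  set v : ℕ → ℝ≥0∞ := fun n => ∫⁻ x in Icc a.1 b.1, A n x * ‖Fx (x, y)‖ₑ with hv
  have tv : Tendsto v atTop (𝓝 (∫⁻ x in Icc a.1 b.1, ‖g' (nsq (F (x, y) - y0)) * (2 * ‖F (x, y) - y0‖)‖ₑ * ‖Fx (x, y)‖ₑ)) := by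
    apply tendsto_lintegral_of_dominated_convergence' (fun x => C * ‖Fx (x, y)‖ₑ)
    · exact fun n => (hAm n).mul hm.enorm
    · intro n
      filter_upwards [ae_restrict_mem measurableSet_Icc] with x hx
      gcongr
      exact hAC n x hx
    · rw [lintegral_const_mul' _ _ ENNReal.ofReal_ne_top]
      exact ENNReal.mul_ne_top ENNReal.ofReal_ne_top hf.ne
    · filter_upwards [ae_restrict_mem measurableSet_Icc] with x hx
      refine ENNReal.Tendsto.mul_const ?_ (Or.inr enorm_ne_top)
      refine (continuous_enorm.tendsto _).comp ?_
      refine Tendsto.mul ((hg' _ (hmemF _ (hQ x hx))).tendsto.comp (hnl _ (hQ x hx))) ?_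
      exact (((h.lim (hQ x hx)).sub tendsto_const_nhds).norm).const_mul 2
  have tL : Tendsto (fun n => ‖g (nsq (Fn n (x', y) - y0)) - g (nsq (Fn n (x, y) - y0))‖ₑ) atTop
      (𝓝 ‖g (nsq (F (x', y) - y0)) - g (nsq (F (x, y) - y0))‖ₑ) := by
    refine (continuous_enorm.tendsto _).comp (Tendsto.sub ?_ ?_)
    · exact (hgc _ (hmemF _ (hQ x' hx'))).tendsto.comp (hnl _ (hQ x' hx'))
    · exact (hgc _ (hmemF _ (hQ x hx))).tendsto.comp (hnl _ (hQ x hx))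
  have hle : ∀ n, ‖g (nsq (Fn n (x', y) - y0)) - g (nsq (Fn n (x, y) - y0))‖ₑ ≤ C * u n y + v n := by
    intro n
    refine (ftc_row (h.smooth n) y0 hg hg' (fun z hz => (hmemn n _ (hQ z hz)).2) hx hx' hxx).trans ?_
    have e1 : C * u n y = ∫⁻ x in Icc a.1 b.1, C * ‖dX (Fn n) (x, y) - Fx (x, y)‖ₑ :=
      (lintegral_const_mul' _ _ ENNReal.ofReal_ne_top).symm
    have e2 : AEMeasurable (fun x => A n x * ‖Fx (x, y)‖ₑ) (volume.restrict (Icc a.1 b.1)) :=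
      (hAm n).mul hm.enorm
    have e3 : C * u n y + v n = ∫⁻ x in Icc a.1 b.1, (C * ‖dX (Fn n) (x, y) - Fx (x, y)‖ₑ + A n x * ‖Fx (x, y)‖ₑ) := by
      rw [lintegral_add_right' _ e2, e1]
    rw [e3]
    apply setLIntegral_mono_ae' measurableSet_Icc
    refine Eventually.of_forall fun z hz => ?_
    calc A n z * ‖dX (Fn n) (z, y)‖ₑ ≤ A n z * (‖dX (Fn n) (z, y) - Fx (z, y)‖ₑ + ‖Fx (z, y)‖ₑ) := by
          gcongr
          simpa using enorm_add_le (dX (Fn n) (z, y) - Fx (z, y)) (Fx (z, y))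
      _ = A n z * ‖dX (Fn n) (z, y) - Fx (z, y)‖ₑ + A n z * ‖Fx (z, y)‖ₑ := mul_add _ _ _
      _ ≤ _ := by
          gcongr
          exact hAC n z hz
  have hcl : MapClusterPt (0:ℝ≥0∞) atTop (fun n => u n y) := by
    rw [mapClusterPt_iff_frequently]
    intro s hs
    obtain ⟨ε, hε, hεs⟩ := ENNReal.nhds_zero_basis.mem_iff.1 hs
    have : ∃ᶠ n in atTop, u n y < ε := frequently_lt_of_liminf_lt (h := by rw [hl]; exact hε)
    exact this.mono fun n hn => hεs hn
  obtain ⟨U, hU, hUt⟩ := mapClusterPt_iff_ultrafilter.1 hcl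
  have tR : Tendsto (fun n => C * u n y + v n) U (𝓝 (C * 0 + ∫⁻ x in Icc a.1 b.1, ‖g' (nsq (F (x, y) - y0)) * (2 * ‖F (x, y) - y0‖)‖ₑ * ‖Fx (x, y)‖ₑ)) :=
    (ENNReal.Tendsto.const_mul hUt (Or.inr ENNReal.ofReal_ne_top)).add (tv.mono_left hU)
  rw [mul_zero, zero_add] at tR
  exact le_of_tendsto_of_tendsto' (tL.mono_left hU) tR hle

lemma swap (h : Approx a b F Fx Fy Fn M) :
    Approx a.swap b.swap (F ∘ Prod.swap) (Fy ∘ Prod.swap) (Fx ∘ Prod.swap) (fun n => Fn n ∘ Prod.swap) M := by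
  have hms : ∀ p : ℝ × ℝ, p ∈ Icc a.swap b.swap → p.swap ∈ Icc a b := fun p hp =>
    ⟨⟨hp.1.2, hp.1.1⟩, ⟨hp.2.2, hp.2.1⟩⟩
  have hmp : MeasurePreserving (Prod.swap : ℝ × ℝ → ℝ × ℝ) (volume.restrict (Icc a.swap b.swap))
      (volume.restrict (Icc a b)) := by
    rw [restrict_Icc_prod, restrict_Icc_prod]
    exact Measure.measurePreserving_swap
  have dXs : ∀ n p, dX (Fn n ∘ Prod.swap) p = dY (Fn n) p.swap := by
    intro n p
    have h1 := ((h.smooth n).differentiable (by norm_num) p.swap).hasFDerivAt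
    have h2 := (ContinuousLinearEquiv.prodComm ℝ ℝ ℝ).hasFDerivAt (x := p)
    have h3 : HasFDerivAt (Fn n ∘ Prod.swap) _ p := h1.comp p h2
    rw [dX, h3.fderiv]; rfl
  have dYs : ∀ n p, dY (Fn n ∘ Prod.swap) p = dX (Fn n) p.swap := by
    intro n p
    have h1 := ((h.smooth n).differentiable (by norm_num) p.swap).hasFDerivAt
    have h2 := (ContinuousLinearEquiv.prodComm ℝ ℝ ℝ).hasFDerivAt (x := p)
    have h3 : HasFDerivAt (Fn n ∘ Prod.swap) _ p := h1.comp p h2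
    rw [dY, h3.fderiv]; rfl
  refine ⟨?_, ?_, ?_, ?_, ?_, ?_, ?_, ?_⟩
  · exact fun n => (h.smooth n).comp (ContinuousLinearEquiv.prodComm ℝ ℝ ℝ).contDiff
  · exact h.cont.comp continuous_swap.continuousOn hms
  · exact (h.unif.comp Prod.swap).mono hms
  · exact fun n p hp => h.bdd n _ (hms p hp)
  · exact h.memy.comp_measurePreserving hmp
  · exact h.memx.comp_measurePreserving hmp
  · refine h.convy.congr fun n => ?_
    simp only [dXs]
    exact (eLpNorm_comp_measurePreserving ((h.memdY n).sub h.memy).1 hmp).symm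
  · refine h.convx.congr fun n => ?_
    simp only [dYs]
    exact (eLpNorm_comp_measurePreserving ((h.memdX n).sub h.memx).1 hmp).symm

end Approx

open MeasureTheory Set Filter
open scoped ENNReal Real Topology


def Ld (R δ t : ℝ) : ℝ := Real.log (R / (t + δ))
def Gd (R δ t : ℝ) : ℝ := 1 / ((t + δ) * Ld R δ t)
def Gd' (R δ t : ℝ) : ℝ := - (Ld R δ t - 1) / ((t + δ) ^ 2 * Ld R δ t ^ 2)

section profile
variable {R δ T t : ℝ}

lemma Ld_ge (hδ : 0 < δ) (hδ1 : δ ≤ 1) (hR : Real.exp 1 * (T + 1) ≤ R) (ht : t ∈ Icc 0 T) :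
    1 ≤ Ld R δ t := by
  have h0 : 0 < t + δ := by linarith [ht.1]
  rw [Ld, Real.le_log_iff_exp_le, le_div_iff₀ h0]
  · refine le_trans ?_ hR
    have := Real.exp_pos 1
    gcongr
    exact ht.2
  · apply div_pos _ h0
    have := Real.exp_pos 1
    have : 0 ≤ T := ht.1.trans ht.2
    refine lt_of_lt_of_le ?_ hR
    positivity

lemma R_pos (hR : Real.exp 1 * (T + 1) ≤ R) (hT : 0 ≤ T) : 0 < R := by
  have := Real.exp_pos 1
  refine lt_of_lt_of_le ?_ hR
  positivity

lemma hasDerivAt_Ld (hδ : 0 < δ) (hR : 0 < R) (ht : 0 ≤ t) :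
    HasDerivAt (Ld R δ) (- (1 / (t + δ))) t := by
  have h0 : 0 < t + δ := by linarith
  have h1 : HasDerivAt (fun t => t + δ) 1 t := (hasDerivAt_id t).add_const δ
  have h2 := (hasDerivAt_const t R).div h1 h0.ne'
  have h3 := h2.log (by simpa using (div_pos hR h0).ne')
  refine h3.congr_deriv ?_
  simp
  field_simp

lemma hasDerivAt_Gd (hδ : 0 < δ) (hδ1 : δ ≤ 1) (hR : Real.exp 1 * (T + 1) ≤ R) (ht : t ∈ Icc 0 T) :
    HasDerivAt (Gd R δ) (Gd' R δ t) t := by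
  have h0 : 0 < t + δ := by linarith [ht.1]
  have hL := Ld_ge hδ hδ1 hR ht
  have hL0 : 0 < Ld R δ t := by linarith
  have h1 : HasDerivAt (fun t => t + δ) 1 t := (hasDerivAt_id t).add_const δ
  have h2 := h1.mul (hasDerivAt_Ld hδ (R_pos hR (ht.1.trans ht.2)) ht.1)
  have h3 := (hasDerivAt_const t (1:ℝ)).div h2 (mul_pos h0 hL0).ne'
  refine h3.congr_deriv ?_
  simp only [Gd']
  simp
  field_simp
  ring

lemma hasDerivAt_logLd (hδ : 0 < δ) (hδ1 : δ ≤ 1) (hR : Real.exp 1 * (T + 1) ≤ R) (ht : t ∈ Icc 0 T) :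
    HasDerivAt (fun t => Real.log (Ld R δ t)) (- Gd R δ t) t := by
  have h0 : 0 < t + δ := by linarith [ht.1]
  have hL := Ld_ge hδ hδ1 hR ht
  have hL0 : 0 < Ld R δ t := by linarith
  refine ((hasDerivAt_Ld hδ (R_pos hR (ht.1.trans ht.2)) ht.1).log hL0.ne').congr_deriv ?_
  simp only [Gd]
  field_simp

lemma continuousOn_Gd (hδ : 0 < δ) (hδ1 : δ ≤ 1) (hR : Real.exp 1 * (T + 1) ≤ R) :
    ContinuousOn (Gd R δ) (Icc 0 T) := fun _ ht =>
  (hasDerivAt_Gd hδ hδ1 hR ht).continuousAt.continuousWithinAt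

lemma continuousOn_Gd' (hδ : 0 < δ) (hδ1 : δ ≤ 1) (hR : Real.exp 1 * (T + 1) ≤ R) :
    ContinuousOn (Gd' R δ) (Icc 0 T) := by
  have hL : ContinuousOn (Ld R δ) (Icc 0 T) := fun t ht =>
    (hasDerivAt_Ld hδ (R_pos hR (ht.1.trans ht.2)) ht.1).continuousAt.continuousWithinAt
  refine ContinuousOn.div (by fun_prop) (by fun_prop) fun t ht => ?_
  have h0 : 0 < t + δ := by linarith [ht.1]
  have := Ld_ge hδ hδ1 hR ht
  positivity

lemma Gd_ineq (hδ : 0 < δ) (hδ1 : δ ≤ 1) (hR : Real.exp 1 * (T + 1) ≤ R) (ht : t ∈ Icc 0 T) :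
    t * Gd R δ t ^ 2 ≤ 2 * Gd R δ t + 2 * t * Gd' R δ t - t * Gd R δ t ^ 2 := by
  have h0 : 0 < t + δ := by linarith [ht.1]
  have hL := Ld_ge hδ hδ1 hR ht
  have hL0 : 0 < Ld R δ t := by linarith
  have : 2 * Gd R δ t + 2 * t * Gd' R δ t - t * Gd R δ t ^ 2 =
      t * Gd R δ t ^ 2 + 2 * δ * Ld R δ t / ((t + δ) ^ 2 * Ld R δ t ^ 2) := by
    simp only [Gd, Gd']
    field_simp
    ring
  rw [this]
  have : 0 ≤ 2 * δ * Ld R δ t / ((t + δ) ^ 2 * Ld R δ t ^ 2) := by positivity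
  linarith

end profile

lemma contOn_comp_nsq {X : Type*} [TopologicalSpace X] {g : ℝ → ℝ} {T : ℝ} (hg : ContinuousOn g (Icc 0 T)) {H : X → ℂ} {s : Set X}
    (hH : ContinuousOn H s) {y0 : ℂ} (hm : ∀ p ∈ s, nsq (H p - y0) ∈ Icc 0 T) :
    ContinuousOn (fun p => g (nsq (H p - y0))) s :=
  hg.comp (continuous_nsq.comp_continuousOn (hH.sub continuousOn_const)) hm

namespace Approx
variable {a b : ℝ × ℝ} {F Fx Fy : ℝ × ℝ → ℂ} {Fn : ℕ → ℝ × ℝ → ℂ} {M : ℝ}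

lemma dichot (h : Approx a b F Fx Fy Fn M) (y0 : ℂ) {T R : ℝ} (hT : (M + ‖y0‖) ^ 2 ≤ T)
    (hR : Real.exp 1 * (T + 1) ≤ R) {B : ℝ≥0∞} (hB : B ≠ ⊤)
    (hbd : ∀ δ : ℝ, 0 < δ → δ ≤ 1 → ∫⁻ p in Icc a b, ‖-Gd R δ (nsq (F p - y0)) * (2 * ‖F p - y0‖)‖ₑ
      * ‖Fx p‖ₑ ≤ B) :
    ∀ᵐ v ∂(volume.restrict (Icc a.2 b.2)), ∀ x ∈ Icc a.1 b.1, ∀ x' ∈ Icc a.1 b.1,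
      F (x, v) = y0 → F (x', v) = y0 := by
  set δ : ℕ → ℝ := fun n => 1 / ((n : ℝ) + 1) with hδ
  have hδ0 : ∀ n, 0 < δ n := fun n => by simp only [hδ]; positivity
  have hδ1 : ∀ n, δ n ≤ 1 := fun n => by
    simp only [hδ]
    rw [div_le_one (by positivity)]
    have : (0:ℝ) ≤ n := by positivity
    linarith
  have hδl : Tendsto δ atTop (𝓝 0) := tendsto_one_div_add_atTop_nhds_zero_nat
  have hT0 : 0 ≤ T := le_trans (by positivity) hT
  have hR0 := R_pos hR hT0
  have hmemF : ∀ p ∈ Icc a b, nsq (F p - y0) ∈ Icc 0 T := fun p hp =>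
    ⟨nsq_nonneg _, nsq_le (h.bddF hp) hT⟩
  have hm : ∀ n, AEMeasurable (fun p => ‖-Gd R (δ n) (nsq (F p - y0)) * (2 * ‖F p - y0‖)‖ₑ
      * ‖Fx p‖ₑ) (volume.restrict (Icc a b)) := by
    intro n
    refine AEMeasurable.mul ?_ h.memx.1.enorm
    have cF := h.cont
    have : ContinuousOn (fun p => -Gd R (δ n) (nsq (F p - y0)) * (2 * ‖F p - y0‖)) (Icc a b) := by
      exact ContinuousOn.mul (contOn_comp_nsq (continuousOn_Gd (hδ0 n) (hδ1 n) hR) cF hmemF).neg (by fun_prop)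
    exact (this.aestronglyMeasurable measurableSet_Icc).enorm
  set w : ℕ → ℝ → ℝ≥0∞ := fun n v => ∫⁻ x in Icc a.1 b.1,
    ‖-Gd R (δ n) (nsq (F (x, v) - y0)) * (2 * ‖F (x, v) - y0‖)‖ₑ * ‖Fx (x, v)‖ₑ with hw
  rw [restrict_Icc_prod] at hm
  have hwm : ∀ n, AEMeasurable (w n) (volume.restrict (Icc a.2 b.2)) := fun n =>
    (hm n).prod_swap.lintegral_prod_right'
  have hwB : ∀ n, ∫⁻ v in Icc a.2 b.2, w n v ≤ B := by
    intro n
    refine le_trans (le_of_eq ?_) (hbd (δ n) (hδ0 n) (hδ1 n))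
    rw [restrict_Icc_prod, lintegral_prod_symm _ (hm n)]
  have hfin : ∀ᵐ v ∂(volume.restrict (Icc a.2 b.2)), liminf (fun n => w n v) atTop < ⊤ := by
    refine ae_lt_top' (aemeasurable_liminf_nat hwm) (ne_top_of_le_ne_top hB ?_)
    refine (lintegral_liminf_le' (u := atTop) hwm).trans ?_
    refine liminf_le_of_frequently_le' ?_
    exact Frequently.of_forall hwB
  filter_upwards [hfin, h.acl_row, ae_restrict_mem measurableSet_Icc] with v hv hac hvm x hx x' hx' h0
  by_contra hne
  have hQ : ∀ x ∈ Icc a.1 b.1, (x, v) ∈ Icc a b := fun x hx => ⟨⟨hx.1, hvm.1⟩, ⟨hx.2, hvm.2⟩⟩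
  set t' := nsq (F (x', v) - y0) with ht'
  have ht'0 : 0 < t' := by
    rw [ht', nsq_eq_norm]
    have : 0 < ‖F (x', v) - y0‖ := norm_pos_iff.2 (sub_ne_zero.2 hne)
    positivity
  have key : ∀ n, ‖Real.log (Ld R (δ n) 0) - Real.log (Ld R (δ n) t')‖ₑ ≤ w n v := by
    intro n
    have hac' := hac y0 T hT (fun t => Real.log (Ld R (δ n) t)) (fun t => - Gd R (δ n) t)
      (fun t ht => hasDerivAt_logLd (hδ0 n) (hδ1 n) hR ht) (continuousOn_Gd (hδ0 n) (hδ1 n) hR).neg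
    have e0 : nsq (F (x, v) - y0) = 0 := by rw [h0]; simp [nsq]
    rcases le_total x x' with hxx | hxx
    · have := hac' x hx x' hx' hxx
      simp only [e0] at this
      rw [← enorm_neg, neg_sub]
      exact this
    · have := hac' x' hx' x hx hxx
      simp only [e0] at this
      exact this
  have tinf : Tendsto (fun n => Real.log (Ld R (δ n) 0) - Real.log (Ld R (δ n) t')) atTop atTop := by
    have t1 : Tendsto (fun n => Real.log (Ld R (δ n) t')) atTop (𝓝 (Real.log (Ld R 0 t'))) := by
      have hL1 : 1 ≤ Ld R 0 t' := by
        have : Tendsto (fun n => Ld R (δ n) t') atTop (𝓝 (Ld R 0 t')) := by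
          unfold Ld
          refine Tendsto.log ?_ (by rw [add_zero]; positivity)
          exact tendsto_const_nhds.div (tendsto_const_nhds.add hδl) (by rw [add_zero]; positivity)
        exact ge_of_tendsto' this fun n => Ld_ge (hδ0 n) (hδ1 n) hR (hmemF _ (hQ x' hx'))
      refine Tendsto.log ?_ (by positivity)
      unfold Ld
      refine Tendsto.log ?_ (by rw [add_zero]; positivity)
      exact tendsto_const_nhds.div (tendsto_const_nhds.add hδl) (by rw [add_zero]; positivity)
    have t2 : Tendsto (fun n => Real.log (Ld R (δ n) 0)) atTop atTop := by
      refine Real.tendsto_log_atTop.comp (Real.tendsto_log_atTop.comp ?_)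
      have : (fun n : ℕ => R / (0 + δ n)) = fun n : ℕ => R * ((n:ℝ) + 1) := by
        funext n; simp [hδ]
      rw [this]
      exact (tendsto_natCast_atTop_atTop.atTop_add tendsto_const_nhds).const_mul_atTop hR0
    simp only [sub_eq_add_neg]
    exact t2.atTop_add t1.neg
  have tw : Tendsto (fun n => w n v) atTop (𝓝 ⊤) := by
    refine tendsto_of_tendsto_of_tendsto_of_le_of_le (g := fun n => ENNReal.ofReal (Real.log (Ld R (δ n) 0) - Real.log (Ld R (δ n) t')))
      (ENNReal.tendsto_ofReal_atTop.comp tinf) tendsto_const_nhds ?_ (fun _ => le_top)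
    intro n
    refine le_trans ?_ (key n)
    rw [← ofReal_norm]
    exact ENNReal.ofReal_le_ofReal (le_abs_self _)
  rw [tw.liminf_eq] at hv
  exact lt_irrefl _ hv

/-- dichotomy plus connectivity: a.e. row avoids `y0`. -/
lemma avoid_rows (hc : ContinuousOn F (Icc a b)) (hab : a.1 < b.1) {y0 : ℂ}
    (hrow : ∀ᵐ v ∂(volume.restrict (Icc a.2 b.2)), ∀ x ∈ Icc a.1 b.1, ∀ x' ∈ Icc a.1 b.1,
      F (x, v) = y0 → F (x', v) = y0)
    (hcol : ∀ᵐ u ∂(volume.restrict (Icc a.1 b.1)), ∀ v ∈ Icc a.2 b.2, ∀ v' ∈ Icc a.2 b.2,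
      F (u, v) = y0 → F (u, v') = y0) {q : ℝ × ℝ} (hq : q ∈ Icc a b) (hne : F q ≠ y0) :
    ∀ᵐ v ∂(volume.restrict (Icc a.2 b.2)), ∀ x ∈ Icc a.1 b.1, F (x, v) ≠ y0 := by
  by_contra hcon
  have hf : ∃ᶠ v in ae (volume.restrict (Icc a.2 b.2)), ¬ ∀ x ∈ Icc a.1 b.1, F (x, v) ≠ y0 :=
    Filter.not_eventually.1 hcon
  obtain ⟨v, hv, hvr, hvm⟩ := (hf.and_eventually (hrow.and (ae_restrict_mem measurableSet_Icc))).exists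
  push Not at hv
  obtain ⟨x, hx, hxv⟩ := hv
  have h1 : ∀ᵐ u ∂(volume.restrict (Icc a.1 b.1)), ∀ v' ∈ Icc a.2 b.2, F (u, v') = y0 := by
    filter_upwards [hcol, ae_restrict_mem measurableSet_Icc] with u hu hum v' hv'
    exact hu v hvm v' hv' (hvr x hx u hum hxv)
  have hq2 : q.2 ∈ Icc a.2 b.2 := ⟨hq.1.2, hq.2.2⟩
  have hq1 : q.1 ∈ Icc a.1 b.1 := ⟨hq.1.1, hq.2.1⟩
  have h2 : EqOn (fun u => F (u, q.2)) (fun _ => y0) (Icc a.1 b.1) := by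
    refine Measure.eqOn_Icc_of_ae_eq volume hab.ne ?_ ?_ continuousOn_const
    · filter_upwards [h1] with u hu using hu _ hq2
    · refine hc.comp (by fun_prop) fun u hu => ⟨⟨hu.1, hq2.1⟩, ⟨hu.2, hq2.2⟩⟩
  exact hne (h2 hq1)

end Approx

namespace Dist2

variable {a b : ℝ × ℝ} {F Fx Fy : ℝ × ℝ → ℂ} {Fn : ℕ → ℝ × ℝ → ℂ} {M : ℝ} {K : ℝ × ℝ → ℝ}

lemma avoid (h : Dist2 a b F Fx Fy Fn M K) {a' b' : ℝ × ℝ} (h1 : a.1 < a'.1) (h2 : a'.1 < b'.1)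
    (h3 : b'.1 < b.1) (h4 : a.2 < a'.2) (h5 : a'.2 < b'.2) (h6 : b'.2 < b.2) (y0 : ℂ)
    {q : ℝ × ℝ} (hq : q ∈ Icc a' b') (hne : F q ≠ y0) :
    (∀ᵐ v ∂(volume.restrict (Icc a'.2 b'.2)), ∀ x ∈ Icc a'.1 b'.1, F (x, v) ≠ y0) ∧
    (∀ᵐ u ∂(volume.restrict (Icc a'.1 b'.1)), ∀ v ∈ Icc a'.2 b'.2, F (u, v) ≠ y0) := by
  obtain ⟨C, hC0, hC⟩ := h.star2 h1 h2.le h3 h4 h5.le h6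
  have hsub : Icc a' b' ⊆ Icc a b := Icc_subset_Icc ⟨h1.le, h4.le⟩ ⟨h3.le, h6.le⟩
  have h' := h.mono hsub
  have hA := h'.app
  set T := (M + ‖y0‖) ^ 2 with hTdef
  set R := Real.exp 1 * (T + 1) with hRdef
  have hmemF : ∀ p ∈ Icc a' b', nsq (F p - y0) ∈ Icc 0 T := fun p hp =>
    ⟨nsq_nonneg _, Approx.nsq_le (hA.bddF hp) le_rfl⟩
  have hbound : ∀ (V : ℝ × ℝ → ℂ), (∀ᵐ p ∂(volume.restrict (Icc a' b')), ‖V p‖ ^ 2 ≤ K p * crs (Fx p) (Fy p)) →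
      ∀ δ : ℝ, 0 < δ → δ ≤ 1 → ∫⁻ p in Icc a' b', ‖-Gd R δ (nsq (F p - y0)) * (2 * ‖F p - y0‖)‖ₑ
      * ‖V p‖ₑ ≤ ENNReal.ofReal ((∫ p in Icc a' b', K p) + C) := by
    intro V hV δ hδ hδ1
    have hst := hC y0 T le_rfl (Gd R δ) (Gd' R δ) (fun t ht => hasDerivAt_Gd hδ hδ1 le_rfl ht)
      (continuousOn_Gd' hδ hδ1 le_rfl) (fun t ht => by
        have := Gd_ineq hδ hδ1 (le_refl R) ht
        refine le_trans ?_ this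
        have := ht.1
        positivity)
    have hgc := continuousOn_Gd hδ hδ1 (le_refl R)
    have hgc' := continuousOn_Gd' hδ hδ1 (le_refl R)
    have hg1 : ContinuousOn (fun t => 2 * Gd R δ t + 2 * t * Gd' R δ t - t * Gd R δ t ^ 2) (Icc 0 T) := by fun_prop
    have bF : ∀ p ∈ Icc a' b', ‖F p‖ ≤ M := fun p hp => hA.bddF hp
    have i1 := int_term hA.cont bF y0 le_rfl hg1 (continuous_const (y := (1:ℝ))) (integrable_crs hA.memx hA.memy)
    simp only [one_mul] at i1
    have hle : ∀ᵐ p ∂(volume.restrict (Icc a' b')), ‖-Gd R δ (nsq (F p - y0)) * (2 * ‖F p - y0‖)‖ₑ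
        * ‖V p‖ₑ ≤ ENNReal.ofReal (K p + (2 * Gd R δ (nsq (F p - y0)) + 2 * nsq (F p - y0) * Gd' R δ (nsq (F p - y0))
        - nsq (F p - y0) * Gd R δ (nsq (F p - y0)) ^ 2) * crs (Fx p) (Fy p)) := by
      filter_upwards [hV, h'.jac_nonneg, ae_restrict_mem measurableSet_Icc] with p hp hJ hm
      rw [← ofReal_norm, ← ofReal_norm, ← ENNReal.ofReal_mul (norm_nonneg _)]
      apply ENNReal.ofReal_le_ofReal
      have hin := Gd_ineq hδ hδ1 (le_refl R) (hmemF p hm)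
      set J := crs (Fx p) (Fy p)
      set t := nsq (F p - y0) with ht
      have htn : t = ‖F p - y0‖ ^ 2 := nsq_eq_norm _
      set G := Gd R δ t
      have e1 : ‖-G * (2 * ‖F p - y0‖)‖ = 2 * |G| * ‖F p - y0‖ := by
        rw [norm_mul, norm_neg, Real.norm_eq_abs, Real.norm_of_nonneg (by positivity)]; ring
      rw [e1]
      set S := Real.sqrt (K p) with hS
      set W := Real.sqrt J with hW
      have hK : S ^ 2 = K p := Real.sq_sqrt (zero_le_one.trans (h.K1 p))
      have hJW : W ^ 2 = J := Real.sq_sqrt hJ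
      have hS0 : 0 ≤ S := Real.sqrt_nonneg _
      have hW0 : 0 ≤ W := Real.sqrt_nonneg _
      rw [← hK, ← hJW, ← mul_pow] at hp
      have hp' : ‖V p‖ ≤ S * W := le_of_sq_le_sq hp (by positivity)
      calc 2 * |G| * ‖F p - y0‖ * ‖V p‖ ≤ 2 * |G| * ‖F p - y0‖ * (S * W) := by gcongr
        _ = 2 * S * (|G| * ‖F p - y0‖ * W) := by ring
        _ ≤ S ^ 2 + (|G| * ‖F p - y0‖ * W) ^ 2 := two_mul_le_add_sq _ _
        _ = K p + (t * G ^ 2) * J := by rw [hK, mul_pow, mul_pow, sq_abs, hJW, htn]; ring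
        _ ≤ _ := by gcongr
    refine (lintegral_mono_ae hle).trans ?_
    have i2 : Integrable (fun p => K p + (2 * Gd R δ (nsq (F p - y0)) + 2 * nsq (F p - y0) * Gd' R δ (nsq (F p - y0))
        - nsq (F p - y0) * Gd R δ (nsq (F p - y0)) ^ 2) * crs (Fx p) (Fy p)) (volume.restrict (Icc a' b')) :=
      Integrable.add h'.Kint i1
    rw [← ofReal_integral_eq_lintegral_ofReal i2]
    · apply ENNReal.ofReal_le_ofReal
      rw [integral_add h'.Kint i1]
      linarith
    · filter_upwards [h'.jac_nonneg, ae_restrict_mem measurableSet_Icc] with p hJ hm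
      have hin := Gd_ineq hδ hδ1 (le_refl R) (hmemF p hm)
      have h0 : 0 ≤ nsq (F p - y0) * Gd R δ (nsq (F p - y0)) ^ 2 :=
        mul_nonneg (nsq_nonneg _) (sq_nonneg _)
      exact add_nonneg (zero_le_one.trans (h.K1 p)) (mul_nonneg (h0.trans hin) hJ)
  have hrow := hA.dichot y0 le_rfl (le_refl R) ENNReal.ofReal_ne_top (hbound Fx h'.dx)
  have hcol := hA.swap.dichot y0 le_rfl (le_refl R) (B := ENNReal.ofReal ((∫ p in Icc a' b', K p) + C))
    ENNReal.ofReal_ne_top (fun δ hδ hδ1 => by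
      refine le_trans (le_of_eq ?_) (hbound Fy h'.dy δ hδ hδ1)
      have hmp : MeasurePreserving (Prod.swap : ℝ × ℝ → ℝ × ℝ) (volume.restrict (Icc a'.swap b'.swap))
          (volume.restrict (Icc a' b')) := by
        rw [Approx.restrict_Icc_prod, Approx.restrict_Icc_prod]
        exact Measure.measurePreserving_swap
      exact hmp.lintegral_comp_emb MeasurableEquiv.prodComm.measurableEmbedding
        (fun p => ‖-Gd R δ (nsq (F p - y0)) * (2 * ‖F p - y0‖)‖ₑ * ‖Fy p‖ₑ))
  simp only [Prod.fst_swap, Prod.snd_swap, Function.comp_apply, Prod.swap_prod_mk] at hcol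
  refine ⟨Approx.avoid_rows hA.cont h2 hrow hcol hq hne, ?_⟩
  have := Approx.avoid_rows (a := a'.swap) (b := b'.swap) (F := F ∘ Prod.swap) hA.swap.cont h5 (y0 := y0)
    (by simpa using hcol) (by simpa using hrow) (q := q.swap) ⟨⟨hq.1.2, hq.1.1⟩, ⟨hq.2.2, hq.2.1⟩⟩ (by simpa using hne)
  simpa using this

end Dist2

open MeasureTheory Set Filter
open scoped ENNReal Real Topology


section profile2
variable {ρ t : ℝ}

def Gp (ρ t : ℝ) : ℝ := if t ≤ ρ ^ 2 then 2 / ρ ^ 2 - t / ρ ^ 4 else 1 / t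
def Gp' (ρ t : ℝ) : ℝ := if t ≤ ρ ^ 2 then - 1 / ρ ^ 4 else - 1 / t ^ 2
def hp (ρ t : ℝ) : ℝ := 4 / ρ ^ 2 * max 0 (1 - t / ρ ^ 2)

lemma Gp_hp (hρ : 0 < ρ) : 2 * Gp ρ t + 2 * t * Gp' ρ t = hp ρ t := by
  unfold Gp Gp' hp
  split_ifs with h
  · rw [max_eq_right (by rw [sub_nonneg, div_le_one (by positivity)]; exact h)]
    field_simp; ring
  · push Not at h
    have : 0 < t := lt_trans (by positivity) h
    rw [max_eq_left (by rw [sub_nonpos, one_le_div (by positivity)]; exact h.le)]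
    field_simp; ring

lemma continuous_hp : Continuous (hp ρ) := by unfold hp; fun_prop

lemma hp_nonneg : 0 ≤ hp ρ t := by unfold hp; positivity

lemma hp_le (ht : 0 ≤ t) : hp ρ t ≤ 4 / ρ ^ 2 := by
  unfold hp
  refine mul_le_of_le_one_right (by positivity) (max_le zero_le_one ?_)
  have : 0 ≤ t / ρ ^ 2 := by positivity
  linarith

lemma hp_zero (hρ : 0 < ρ) (h : ρ ^ 2 ≤ t) : hp ρ t = 0 := by
  unfold hp
  rw [max_eq_left (by rw [sub_nonpos, one_le_div (by positivity)]; exact h), mul_zero]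

lemma hp_pos (hρ : 0 < ρ) (h : t < ρ ^ 2) : 0 < hp ρ t := by
  unfold hp
  have : 0 < 1 - t / ρ ^ 2 := by rw [sub_pos, div_lt_one (by positivity)]; exact h
  have := lt_max_of_lt_right (b := (0:ℝ)) this
  positivity

lemma Gp_eq (hρ : 0 < ρ) (h : ρ ^ 2 ≤ t) : Gp ρ t = 1 / t := by
  unfold Gp
  split_ifs with h'
  · have := le_antisymm h' h
    subst this; field_simp; ring
  · rfl

lemma hasDerivAt_Gp (hρ : 0 < ρ) (t : ℝ) : HasDerivAt (Gp ρ) (Gp' ρ t) t := by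
  have h1 : ∀ t : ℝ, HasDerivAt (fun t => 2 / ρ ^ 2 - t / ρ ^ 4) (-1 / ρ ^ 4) t := fun t => by
    have := ((hasDerivAt_id t).div_const (ρ ^ 4)).const_sub (2 / ρ ^ 2)
    simpa [neg_div] using this
  have h2 : ∀ t : ℝ, t ≠ 0 → HasDerivAt (fun t : ℝ => 1 / t) (-1 / t ^ 2) t := fun t ht => by
    have := hasDerivAt_inv ht
    simpa [neg_div] using this
  rcases lt_trichotomy t (ρ ^ 2) with h | h | h
  · rw [Gp', if_pos h.le]
    refine (h1 t).congr_of_eventuallyEq ?_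
    filter_upwards [Iio_mem_nhds h] with u hu
    rw [Gp, if_pos (le_of_lt hu)]
  · have ht : 0 < t := by rw [h]; positivity
    have e : Gp' ρ t = -1 / ρ ^ 4 := by rw [Gp', if_pos h.le]
    have e2 : Gp' ρ t = -1 / t ^ 2 := by rw [e, h]; ring_nf
    have w1 : HasDerivWithinAt (Gp ρ) (Gp' ρ t) (Iic t) t := by
      rw [e]
      refine (h1 t).hasDerivWithinAt.congr (fun u hu => ?_) ?_
      · rw [Gp, if_pos (le_trans hu h.le)]
      · rw [Gp, if_pos h.le]
    have w2 : HasDerivWithinAt (Gp ρ) (Gp' ρ t) (Ici t) t := by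
      rw [e2]
      refine (h2 t ht.ne').hasDerivWithinAt.congr (fun u hu => ?_) ?_
      · exact Gp_eq hρ (h.ge.trans hu)
      · exact Gp_eq hρ h.ge
    have := w1.union w2
    rwa [Iic_union_Ici, hasDerivWithinAt_univ] at this
  · rw [Gp', if_neg (not_le.2 h)]
    have ht : 0 < t := lt_trans (by positivity) h
    refine (h2 t ht.ne').congr_of_eventuallyEq ?_
    filter_upwards [Ioi_mem_nhds h] with u hu
    exact Gp_eq hρ (le_of_lt hu)

lemma continuous_Gp' (hρ : 0 < ρ) : Continuous (Gp' ρ) := by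
  have e : Gp' ρ = fun t => - 1 / (max t (ρ ^ 2)) ^ 2 := by
    funext t
    unfold Gp'
    split_ifs with h
    · rw [max_eq_right h]; ring_nf
    · rw [max_eq_left (not_le.1 h).le]
  rw [e]
  refine Continuous.div (by fun_prop) (by fun_prop) fun t => ?_
  have : 0 < max t (ρ ^ 2) := lt_max_of_lt_right (by positivity)
  positivity

end profile2

namespace Dist2

variable {a b : ℝ × ℝ} {F Fx Fy : ℝ × ℝ → ℂ} {Fn : ℕ → ℝ × ℝ → ℂ} {M : ℝ} {K : ℝ × ℝ → ℝ}

lemma int_hp (h : Dist2 a b F Fx Fy Fn M K) (ρ : ℝ) (y : ℂ) :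
    Integrable (fun p => hp ρ (nsq (F p - y)) * crs (Fx p) (Fy p)) (volume.restrict (Icc a b)) := by
  have := int_term (T := (M + ‖y‖) ^ 2) h.app.cont (fun p hp => h.app.bddF hp) y le_rfl
    (continuous_hp (ρ := ρ)).continuousOn (continuous_const (y := (1:ℝ))) (integrable_crs h.app.memx h.app.memy)
  simpa only [one_mul] using this

lemma degree (h : Dist2 a b F Fx Fy Fn M K) (hab : a ≤ b) (y : ℂ) {ρ : ℝ} (hρ : 0 < ρ)
    (hb : ∀ p ∈ bdry a b, ρ < ‖F p - y‖) :
    ∃ m : ℤ, ∀ ρ', 0 < ρ' → ρ' ≤ ρ →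
      ∫ p in Icc a b, hp ρ' (nsq (F p - y)) * crs (Fx p) (Fy p) = 2 * π * m := by
  obtain ⟨m, hm⟩ := h.app.int_lim hab y hρ hb le_rfl
  refine ⟨m, fun ρ' h0 h1 => ?_⟩
  rw [← hm (Gp ρ') (Gp' ρ') (fun t _ => hasDerivAt_Gp h0 t) (continuous_Gp' h0).continuousOn
    (fun t ht => Gp_eq h0 (le_trans (by gcongr) ht))]
  simp_rw [Gp_hp h0]

lemma deg_pos (h : Dist2 a b F Fx Fy Fn M K) (hab1 : a.1 ≤ b.1) (hab2 : a.2 < b.2) {x1 : ℝ × ℝ}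
    (hx1 : x1 ∈ Icc a b) {ρ : ℝ} (hρ : 0 < ρ)
    (hb : ∀ p ∈ bdry a b, ρ < ‖F p - F x1‖) :
    0 < ∫ p in Icc a b, hp ρ (nsq (F p - F x1)) * crs (Fx p) (Fy p) := by
  set y := F x1 with hy
  have hnn : 0 ≤ᵐ[volume.restrict (Icc a b)] fun p => hp ρ (nsq (F p - y)) * crs (Fx p) (Fy p) := by
    filter_upwards [h.jac_nonneg] with p hp
    exact mul_nonneg hp_nonneg hp
  refine lt_of_le_of_ne (integral_nonneg_of_ae hnn) fun h0 => ?_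
  have hz := (integral_eq_zero_iff_of_nonneg_ae hnn (h.int_hp ρ y)).1 h0.symm
  have hz2 : ∀ᵐ p ∂(volume.restrict (Icc a b)),
      ‖(Gp ρ (nsq (F p - y)) + nsq (F p - y) * Gp' ρ (nsq (F p - y))) * (2 * ‖F p - y‖)‖ₑ * ‖Fx p‖ₑ = 0 := by
    filter_upwards [hz, h.dx] with p hp1 hp2
    rcases lt_or_ge (nsq (F p - y)) (ρ ^ 2) with hlt | hge
    · have : crs (Fx p) (Fy p) = 0 := by
        rcases mul_eq_zero.1 hp1 with h' | h'
        · exact absurd h' (hp_pos hρ hlt).ne'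
        · exact h'
      rw [this, mul_zero] at hp2
      have : Fx p = 0 := by
        have : ‖Fx p‖ = 0 := by nlinarith [norm_nonneg (Fx p)]
        simpa using this
      rw [this]; simp
    · have e : Gp ρ (nsq (F p - y)) + nsq (F p - y) * Gp' ρ (nsq (F p - y)) = 0 := by
        have := Gp_hp (ρ := ρ) (t := nsq (F p - y)) hρ
        rw [hp_zero hρ hge] at this
        linarith
      rw [e]; simp
  rw [Approx.restrict_Icc_prod] at hz2
  have hz3 := Measure.ae_ae_of_ae_prod (Measure.measurePreserving_swap.quasiMeasurePreserving.ae hz2)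
  have hrow : ∀ᵐ v ∂(volume.restrict (Icc a.2 b.2)), ∀ x ∈ Icc a.1 b.1,
      nsq (F (x, v) - y) * Gp ρ (nsq (F (x, v) - y)) - 1 = 0 := by
    filter_upwards [hz3, h.app.acl_row, ae_restrict_mem measurableSet_Icc] with v hv hacl hvm x hx
    have hG : ∀ t ∈ Icc 0 ((M + ‖y‖) ^ 2), HasDerivAt (fun t => t * Gp ρ t - 1) (Gp ρ t + t * Gp' ρ t) t := by
      intro t _
      have := ((hasDerivAt_id t).mul (hasDerivAt_Gp hρ t)).sub_const 1
      simpa using this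
    have hGc : Continuous (Gp ρ) := continuous_iff_continuousAt.2 fun t => (hasDerivAt_Gp hρ t).continuousAt
    have hGc' := continuous_Gp' hρ
    have key := hacl y _ le_rfl (fun t => t * Gp ρ t - 1) (fun t => Gp ρ t + t * Gp' ρ t) hG
      (by fun_prop) a.1 ⟨le_rfl, hab1⟩ x hx hx.1
    have e0 : ∫⁻ x in Icc a.1 b.1, ‖(Gp ρ (nsq (F (x, v) - y)) + nsq (F (x, v) - y) * Gp' ρ (nsq (F (x, v) - y)))
        * (2 * ‖F (x, v) - y‖)‖ₑ * ‖Fx (x, v)‖ₑ = 0 := by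
      rw [lintegral_congr_ae (g := fun _ => 0)]
      · simp
      · filter_upwards [hv] with u hu using hu
    rw [e0] at key
    have hbp : (a.1, v) ∈ bdry a b := ⟨⟨⟨le_rfl, hvm.1⟩, ⟨hab1, hvm.2⟩⟩, Or.inl rfl⟩
    have hbb := hb _ hbp
    have hpos : ρ ^ 2 ≤ nsq (F (a.1, v) - y) := by
      rw [nsq_eq_norm]; gcongr
    have e1 : nsq (F (a.1, v) - y) * Gp ρ (nsq (F (a.1, v) - y)) - 1 = 0 := by
      have : 0 < nsq (F (a.1, v) - y) := lt_of_lt_of_le (by positivity) hpos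
      rw [Gp_eq hρ hpos]; field_simp; ring
    simp only [e1, sub_zero] at key
    simpa using key
  have hm1 : x1.1 ∈ Icc a.1 b.1 := ⟨hx1.1.1, hx1.2.1⟩
  have hm2 : x1.2 ∈ Icc a.2 b.2 := ⟨hx1.1.2, hx1.2.2⟩
  have hGc : Continuous (Gp ρ) := continuous_iff_continuousAt.2 fun t => (hasDerivAt_Gp hρ t).continuousAt
  have hEq : EqOn (fun v => nsq (F (x1.1, v) - y) * Gp ρ (nsq (F (x1.1, v) - y)) - 1) (fun _ => 0) (Icc a.2 b.2) := by
    refine Measure.eqOn_Icc_of_ae_eq volume hab2.ne ?_ ?_ continuousOn_const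
    · filter_upwards [hrow] with v hv using hv _ hm1
    · have hFc : ContinuousOn (fun v => F (x1.1, v)) (Icc a.2 b.2) :=
        h.app.cont.comp (by fun_prop) fun v hv => ⟨⟨hm1.1, hv.1⟩, ⟨hm1.2, hv.2⟩⟩
      have hn : ContinuousOn (fun v => nsq (F (x1.1, v) - y)) (Icc a.2 b.2) :=
        continuous_nsq.comp_continuousOn (hFc.sub continuousOn_const)
      exact (hn.mul (hGc.comp_continuousOn hn)).sub continuousOn_const
  have := hEq hm2
  simp [hy, nsq] at this

lemma density (h : Dist2 a b F Fx Fy Fn M K) (hab1 : a.1 < b.1) (hab2 : a.2 < b.2) {x1 : ℝ × ℝ}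
    (hx1 : x1 ∈ Icc a b) (hb : ∀ p ∈ bdry a b, F p ≠ F x1) :
    ∃ δ > 0, ∀ y', ‖y' - F x1‖ < δ → ∀ ρ, 0 < ρ → ρ < δ →
      ENNReal.ofReal (π * ρ ^ 2 / 2) ≤
        ∫⁻ p in Icc a b ∩ F ⁻¹' (Metric.closedBall y' ρ), ENNReal.ofReal (crs (Fx p) (Fy p)) := by
  set y := F x1 with hy
  have hab : a ≤ b := ⟨hab1.le, hab2.le⟩
  obtain ⟨ρ0, hρ0, hb0⟩ : ∃ ρ0 > 0, ∀ p ∈ bdry a b, 2 * ρ0 < ‖F p - y‖ := by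
    have hne : (bdry a b).Nonempty := ⟨a, left_mem_Icc.2 hab, Or.inl rfl⟩
    have hc : ContinuousOn (fun p => ‖F p - y‖) (bdry a b) :=
      ((h.app.cont.mono fun p hp => hp.1).sub continuousOn_const).norm
    obtain ⟨p0, hp0, hmin⟩ := (Approx.isCompact_bdry a b).exists_isMinOn hne hc
    have : 0 < ‖F p0 - y‖ := norm_pos_iff.2 (sub_ne_zero.2 (hb p0 hp0))
    refine ⟨‖F p0 - y‖ / 3, by positivity, fun p hp => ?_⟩
    have h' : ‖F p0 - y‖ ≤ ‖F p - y‖ := hmin hp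
    linarith
  have hpos := h.deg_pos hab1.le hab2 hx1 hρ0 (fun p hp => by have := hb0 p hp; linarith)
  have hJ := integrable_crs h.app.memx h.app.memy
  have hcontA : ContinuousAt (fun y' => ∫ p in Icc a b, hp ρ0 (nsq (F p - y')) * crs (Fx p) (Fy p)) y := by
    refine continuousAt_of_dominated (bound := fun p => 4 / ρ0 ^ 2 * |crs (Fx p) (Fy p)|)
      (Eventually.of_forall fun y' => (h.int_hp ρ0 y').aestronglyMeasurable)
      (Eventually.of_forall fun y' => Eventually.of_forall fun p => ?_) (hJ.abs.const_mul _)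
      (Eventually.of_forall fun p => ?_)
    · rw [norm_mul, Real.norm_of_nonneg hp_nonneg, Real.norm_eq_abs]
      gcongr
      exact hp_le (nsq_nonneg _)
    · have : Continuous fun y' => hp ρ0 (nsq (F p - y')) * crs (Fx p) (Fy p) :=
        (continuous_hp.comp (continuous_nsq.comp (by fun_prop))).mul continuous_const
      exact this.continuousAt
  obtain ⟨δ1, hδ1, hδ⟩ := Metric.eventually_nhds_iff.1 (hcontA.eventually (lt_mem_nhds hpos))
  refine ⟨min δ1 ρ0, lt_min hδ1 hρ0, fun y' hy' ρ h0 hρ => ?_⟩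
  have hp1 := hδ (y := y') (by rw [dist_eq_norm]; exact hy'.trans_le (min_le_left _ _))
  obtain ⟨m, hm⟩ := h.degree hab y' hρ0 (fun p hp => by
    have h1 := hb0 p hp
    have h2 := hy'.trans_le (min_le_right _ _)
    have h3 : ‖F p - y‖ ≤ ‖F p - y'‖ + ‖y' - y‖ := by
      simpa using norm_add_le (F p - y') (y' - y)
    linarith)
  have e1 := hm ρ0 hρ0 le_rfl
  rw [e1] at hp1
  have hm1 : (1:ℝ) ≤ m := by
    have : (0:ℝ) < m := by
      by_contra hc
      push Not at hc
      have : 2 * π * m ≤ 0 := mul_nonpos_of_nonneg_of_nonpos (by positivity) hc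
      linarith
    exact_mod_cast this
  have e2 := hm ρ h0 (hρ.le.trans (min_le_right _ _))
  have hge : 2 * π ≤ ∫ p in Icc a b, hp ρ (nsq (F p - y')) * crs (Fx p) (Fy p) := by
    rw [e2]
    exact le_mul_of_one_le_right (by positivity) hm1
  have hnn : 0 ≤ᵐ[volume.restrict (Icc a b)] fun p => hp ρ (nsq (F p - y')) * crs (Fx p) (Fy p) := by
    filter_upwards [h.jac_nonneg] with p hp
    exact mul_nonneg hp_nonneg hp
  have hcl : MeasurableSet (Icc a b ∩ F ⁻¹' (Metric.closedBall y' ρ)) :=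
    (h.app.cont.preimage_isClosed_of_isClosed isClosed_Icc Metric.isClosed_closedBall).measurableSet
  have hup : ENNReal.ofReal (2 * π) ≤ ENNReal.ofReal (4 / ρ ^ 2) *
      ∫⁻ p in Icc a b ∩ F ⁻¹' (Metric.closedBall y' ρ), ENNReal.ofReal (crs (Fx p) (Fy p)) := by
    refine (ENNReal.ofReal_le_ofReal hge).trans ?_
    rw [ofReal_integral_eq_lintegral_ofReal (h.int_hp ρ y') hnn, ← lintegral_const_mul' _ _ ENNReal.ofReal_ne_top,
      ← lintegral_indicator hcl, ← lintegral_indicator measurableSet_Icc]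
    refine lintegral_mono fun p => ?_
    by_cases hpm : p ∈ Icc a b
    · rw [indicator_of_mem hpm]
      by_cases hpb : ‖F p - y'‖ ≤ ρ
      · have hmem : p ∈ Icc a b ∩ F ⁻¹' (Metric.closedBall y' ρ) := ⟨hpm, by simpa [dist_eq_norm] using hpb⟩
        rw [indicator_of_mem hmem, ENNReal.ofReal_mul hp_nonneg]
        gcongr
        exact hp_le (nsq_nonneg _)
      · rw [hp_zero h0, zero_mul, ENNReal.ofReal_zero]
        · exact zero_le
        · push Not at hpb
          rw [nsq_eq_norm]; gcongr
    · rw [indicator_of_notMem hpm]; exact zero_le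
  have : ENNReal.ofReal (π * ρ ^ 2 / 2) = ENNReal.ofReal (ρ ^ 2 / 4) * ENNReal.ofReal (2 * π) := by
    rw [← ENNReal.ofReal_mul (by positivity)]; congr 1; ring
  rw [this]
  calc _ ≤ ENNReal.ofReal (ρ ^ 2 / 4) * (ENNReal.ofReal (4 / ρ ^ 2) *
      ∫⁻ p in Icc a b ∩ F ⁻¹' (Metric.closedBall y' ρ), ENNReal.ofReal (crs (Fx p) (Fy p))) := by gcongr
    _ = _ := by
      rw [← mul_assoc, ← ENNReal.ofReal_mul (by positivity)]
      have : ρ ^ 2 / 4 * (4 / ρ ^ 2) = 1 := by field_simp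
      rw [this]; simp

end Dist2

open MeasureTheory Set Filter
open scoped ENNReal Real Topology


lemma exists_ae_between {P : ℝ → Prop} {c d u v : ℝ} (h : ∀ᵐ x ∂(volume.restrict (Icc c d)), P x)
    (hc : c ≤ u) (huv : u < v) (hd : v ≤ d) : ∃ x, u < x ∧ x < v ∧ P x := by
  have h1 : ∀ᵐ x ∂(volume.restrict (Ioo u v)), P x :=
    ae_restrict_of_ae_restrict_of_subset (t := Icc c d) (fun x hx => ⟨hc.trans hx.1.le, hx.2.le.trans hd⟩) h
  have hne : (ae (volume.restrict (Ioo u v))).NeBot := by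
    rw [ae_neBot, Ne, Measure.restrict_eq_zero, Real.volume_Ioo]
    simpa using huv
  obtain ⟨x, hx, hP⟩ := ((ae_restrict_mem measurableSet_Ioo).and h1).exists
  exact ⟨x, hx.1, hx.2, hP⟩

namespace Dist2

variable {a b : ℝ × ℝ} {F Fx Fy : ℝ × ℝ → ℂ} {Fn : ℕ → ℝ × ℝ → ℂ} {M : ℝ} {K : ℝ × ℝ → ℝ}

lemma exists_rect (h : Dist2 a b F Fx Fy Fn M K) {a' b' : ℝ × ℝ} (h1 : a.1 < a'.1) (h2 : a'.1 < b'.1)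
    (h3 : b'.1 < b.1) (h4 : a.2 < a'.2) (h5 : a'.2 < b'.2) (h6 : b'.2 < b.2)
    {q : ℝ × ℝ} (hq : q ∈ Icc a' b') {x1 : ℝ × ℝ} (hx : x1 ∈ Ioo a'.1 b'.1 ×ˢ Ioo a'.2 b'.2)
    (hne : F q ≠ F x1) {ε : ℝ} (hε : 0 < ε) :
    ∃ c d : ℝ × ℝ, c.1 < d.1 ∧ c.2 < d.2 ∧ x1 ∈ Icc c d ∧ Icc c d ⊆ Icc a' b' ∧
      Icc c d ⊆ Metric.ball x1 ε ∧ ∀ p ∈ bdry c d, F p ≠ F x1 := by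
  obtain ⟨hr, hc⟩ := h.avoid h1 h2 h3 h4 h5 h6 (F x1) hq hne
  obtain ⟨⟨l1, l2⟩, ⟨l3, l4⟩⟩ := hx
  obtain ⟨c1, c1l, c1u, hc1⟩ := exists_ae_between hc (u := max a'.1 (x1.1 - ε)) (v := x1.1)
    (le_max_left _ _) (max_lt l1 (by linarith)) l2.le
  obtain ⟨d1, d1l, d1u, hd1⟩ := exists_ae_between hc (u := x1.1) (v := min b'.1 (x1.1 + ε))
    l1.le (lt_min l2 (by linarith)) (min_le_left _ _)
  obtain ⟨c2, c2l, c2u, hc2⟩ := exists_ae_between hr (u := max a'.2 (x1.2 - ε)) (v := x1.2)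
    (le_max_left _ _) (max_lt l3 (by linarith)) l4.le
  obtain ⟨d2, d2l, d2u, hd2⟩ := exists_ae_between hr (u := x1.2) (v := min b'.2 (x1.2 + ε))
    l3.le (lt_min l4 (by linarith)) (min_le_left _ _)
  rw [max_lt_iff] at c1l c2l
  rw [lt_min_iff] at d1u d2u
  have hsub : Icc (c1, c2) (d1, d2) ⊆ Icc a' b' :=
    Icc_subset_Icc ⟨c1l.1.le, c2l.1.le⟩ ⟨d1u.1.le, d2u.1.le⟩
  refine ⟨(c1, c2), (d1, d2), c1u.trans d1l, c2u.trans d2l, ⟨⟨c1u.le, c2u.le⟩, ⟨d1l.le, d2l.le⟩⟩, hsub, ?_, ?_⟩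
  · rintro p ⟨⟨p1, p2⟩, ⟨p3, p4⟩⟩
    simp only at p1 p2 p3 p4
    rw [Metric.mem_ball, Prod.dist_eq, max_lt_iff, Real.dist_eq, Real.dist_eq, abs_lt, abs_lt]
    refine ⟨⟨?_, ?_⟩, ⟨?_, ?_⟩⟩ <;> linarith
  · rintro ⟨p1, p2⟩ ⟨hp, hpb⟩
    have hp' := hsub hp
    have m1 : p1 ∈ Icc a'.1 b'.1 := ⟨hp'.1.1, hp'.2.1⟩
    have m2 : p2 ∈ Icc a'.2 b'.2 := ⟨hp'.1.2, hp'.2.2⟩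
    simp only at hpb
    rcases hpb with rfl | rfl | rfl | rfl
    · exact hc1 _ m2
    · exact hd1 _ m2
    · exact hc2 _ m1
    · exact hd2 _ m1

/-- the density set -/
def VV (ν : Measure ℂ) (k : ℕ) : Set ℂ :=
  {y | ∃ δ > 0, ∀ y', ‖y' - y‖ < δ → ∀ ρ, 0 < ρ → ρ < δ →
    k * ENNReal.ofReal (π * ρ ^ 2 / 2) ≤ ν (Metric.closedBall y' ρ)}

lemma isOpen_VV (ν : Measure ℂ) (k : ℕ) : IsOpen (VV ν k) := by
  rw [Metric.isOpen_iff]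
  rintro y ⟨δ, hδ, H⟩
  refine ⟨δ / 2, by positivity, fun z hz => ⟨δ / 2, by positivity, fun y' hy' ρ h0 h1 => ?_⟩⟩
  refine H y' ?_ ρ h0 (by linarith)
  rw [Metric.mem_ball, dist_eq_norm] at hz
  have : ‖y' - y‖ ≤ ‖y' - z‖ + ‖z - y‖ := by simpa using norm_add_le (y' - z) (z - y)
  linarith

def nn (ν : Measure ℂ) (y : ℂ) : ℝ≥0∞ := ⨆ k : ℕ, (VV ν k).indicator (fun _ => (k : ℝ≥0∞)) y

lemma lsc_nn (ν : Measure ℂ) : LowerSemicontinuous (nn ν) := by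
  unfold nn
  exact lowerSemicontinuous_iSup fun k => (isOpen_VV ν k).lowerSemicontinuous_indicator zero_le

lemma nn_le_rnDeriv (ν : Measure ℂ) [IsFiniteMeasure ν] : ∀ᵐ y, nn ν y ≤ 2 * ν.rnDeriv volume y := by
  filter_upwards [Besicovitch.ae_tendsto_rnDeriv ν volume] with y hy
  refine iSup_le fun k => ?_
  by_cases hk : y ∈ VV ν k
  · rw [indicator_of_mem hk]
    obtain ⟨δ, hδ, H⟩ := hk
    have : (k : ℝ≥0∞) / 2 ≤ ν.rnDeriv volume y := by
      refine ge_of_tendsto hy ?_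
      filter_upwards [Ioo_mem_nhdsGT hδ] with ρ hρ
      have h1 := H y (by simpa using hδ) ρ hρ.1 hρ.2
      rw [ENNReal.le_div_iff_mul_le (Or.inl (by simp [Complex.volume_closedBall, hρ.1, NNReal.pi_pos.ne']))
        (Or.inl (measure_closedBall_lt_top.ne))]
      refine le_trans (le_of_eq ?_) h1
      rw [Complex.volume_closedBall, div_eq_mul_inv, mul_assoc]
      congr 1
      have e : π * ρ ^ 2 / 2 = 2⁻¹ * (ρ ^ 2 * π) := by ring
      rw [e, ENNReal.ofReal_mul (by positivity), ENNReal.ofReal_mul (by positivity), ENNReal.ofReal_pow hρ.1.le,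
        ENNReal.ofReal_inv_of_pos (by norm_num), ENNReal.ofReal_ofNat]
      congr 2
      rw [← NNReal.coe_real_pi, ENNReal.ofReal_coe_nnreal]
    rw [ENNReal.div_le_iff (by norm_num) (by norm_num)] at this
    rwa [mul_comm]
  · rw [indicator_of_notMem hk]; exact zero_le

/-- pushforward of Jacobian -/
def nu (a' b' : ℝ × ℝ) (F Fx Fy : ℝ × ℝ → ℂ) : Measure ℂ :=
  Measure.map F ((volume.restrict (Icc a' b')).withDensity fun p => ENNReal.ofReal (crs (Fx p) (Fy p)))

lemma aem (h : Dist2 a b F Fx Fy Fn M K) :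
    AEMeasurable F ((volume.restrict (Icc a b)).withDensity fun p => ENNReal.ofReal (crs (Fx p) (Fy p))) :=
  (h.app.cont.aemeasurable measurableSet_Icc).mono_ac (withDensity_absolutelyContinuous _ _)

lemma nu_finite (h : Dist2 a b F Fx Fy Fn M K) : IsFiniteMeasure (nu a b F Fx Fy) := by
  have hJ := integrable_crs h.app.memx h.app.memy
  have := isFiniteMeasure_withDensity_ofReal hJ.hasFiniteIntegral
  unfold nu
  infer_instance

lemma nu_apply (h : Dist2 a b F Fx Fy Fn M K) {B : Set ℂ} (hB : MeasurableSet B) :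
    nu a b F Fx Fy B = ∫⁻ p in Icc a b ∩ F ⁻¹' B, ENNReal.ofReal (crs (Fx p) (Fy p)) := by
  rw [nu, Measure.map_apply_of_aemeasurable h.aem hB, withDensity_apply', Measure.restrict_restrict' measurableSet_Icc,
    inter_comm]

lemma nu_lintegral (h : Dist2 a b F Fx Fy Fn M K) {g : ℂ → ℝ≥0∞} (hg : Measurable g) :
    ∫⁻ y, g y ∂(nu a b F Fx Fy) = ∫⁻ p in Icc a b, g (F p) * ENNReal.ofReal (crs (Fx p) (Fy p)) := by
  rw [nu, lintegral_map' hg.aemeasurable h.aem]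
  have hJ := (integrable_crs h.app.memx h.app.memy).aestronglyMeasurable.aemeasurable.ennreal_ofReal
  have hFm := h.app.cont.aemeasurable (μ := volume) measurableSet_Icc
  refine (lintegral_withDensity_eq_lintegral_mul₀ hJ (hg.comp_aemeasurable hFm)).trans ?_
  simp [mul_comm]

lemma area (h : Dist2 a b F Fx Fy Fn M K) {g : ℂ → ℝ≥0∞} (hg : Measurable g) :
    ∫⁻ y, g y * nn (nu a b F Fx Fy) y ≤
      2 * ∫⁻ p in Icc a b, g (F p) * ENNReal.ofReal (crs (Fx p) (Fy p)) := by
  have := h.nu_finite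
  set ν := nu a b F Fx Fy with hν
  rw [← h.nu_lintegral hg]
  calc ∫⁻ y, g y * nn ν y ≤ ∫⁻ y, 2 * (ν.rnDeriv volume y * g y) := by
        refine lintegral_mono_ae ?_
        filter_upwards [nn_le_rnDeriv ν] with y hy
        calc g y * nn ν y ≤ g y * (2 * ν.rnDeriv volume y) := by gcongr
          _ = _ := by ring
    _ = 2 * ∫⁻ y, ν.rnDeriv volume y * g y := lintegral_const_mul' _ _ (by norm_num)
    _ = 2 * ∫⁻ y, g y ∂(volume.withDensity (ν.rnDeriv volume)) := by
        rw [lintegral_withDensity_eq_lintegral_mul _ (Measure.measurable_rnDeriv _ _) hg]; rfl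
    _ ≤ 2 * ∫⁻ y, g y ∂ν := by
        gcongr
        exact Measure.withDensity_rnDeriv_le _ _

lemma encard_le {s : Set (ℝ × ℝ)} {c : ℝ≥0∞} (H : ∀ S : Finset (ℝ × ℝ), (S : Set (ℝ × ℝ)) ⊆ s → (S.card : ℝ≥0∞) ≤ c) :
    (s.encard : ℝ≥0∞) ≤ c := by
  by_cases hs : s.Finite
  · have := H hs.toFinset (by simp)
    rw [hs.encard_eq_coe_toFinset_card]
    simpa using this
  · have hs' : s.Infinite := hs
    have : c = ⊤ := by
      refine ENNReal.eq_top_of_forall_nnreal_le fun r => ?_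
      obtain ⟨n, hn⟩ := exists_nat_ge r
      obtain ⟨t, ht, htc⟩ := hs'.exists_subset_card_eq n
      have := H t ht
      rw [htc] at this
      refine le_trans ?_ this
      exact_mod_cast hn
    rw [this]; exact le_top

lemma mult_le (h : Dist2 a b F Fx Fy Fn M K) {a' b' : ℝ × ℝ} (h1 : a.1 < a'.1) (h2 : a'.1 < b'.1)
    (h3 : b'.1 < b.1) (h4 : a.2 < a'.2) (h5 : a'.2 < b'.2) (h6 : b'.2 < b.2)
    {q : ℝ × ℝ} (hq : q ∈ Icc a' b') {y : ℂ} (hne : F q ≠ y) :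
    (((Ioo a'.1 b'.1 ×ˢ Ioo a'.2 b'.2) ∩ F ⁻¹' {y}).encard : ℝ≥0∞) ≤ nn (nu a' b' F Fx Fy) y := by
  have hsub : Icc a' b' ⊆ Icc a b := Icc_subset_Icc ⟨h1.le, h4.le⟩ ⟨h3.le, h6.le⟩
  have h' := h.mono hsub
  refine encard_le fun S hS => ?_
  suffices hy : y ∈ VV (nu a' b' F Fx Fy) S.card by
    refine le_trans ?_ (le_iSup _ S.card)
    rw [indicator_of_mem hy]
  obtain ⟨ε, hε, hsep⟩ : ∃ ε > 0, ∀ x ∈ S, ∀ x' ∈ S, x ≠ x' → 2 * ε ≤ dist x x' := by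
    rcases (S.offDiag).eq_empty_or_nonempty with h0 | h0
    · refine ⟨1, one_pos, fun x hx x' hx' hn => ?_⟩
      have : (x, x') ∈ S.offDiag := by simp [hx, hx', hn]
      simp [h0] at this
    · obtain ⟨z, hz, hmin⟩ := Finset.exists_min_image S.offDiag (fun z => dist z.1 z.2) h0
      rw [Finset.mem_offDiag] at hz
      have : 0 < dist z.1 z.2 := dist_pos.2 hz.2.2
      refine ⟨dist z.1 z.2 / 2, by positivity, fun x hx x' hx' hn => ?_⟩
      have := hmin (x, x') (by simp [hx, hx', hn])
      simp only at this
      linarith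
  have hrect : ∀ x ∈ S, ∃ c d : ℝ × ℝ, Icc c d ⊆ Icc a' b' ∧ Icc c d ⊆ Metric.ball x ε ∧
      ∃ δ > 0, ∀ y', ‖y' - y‖ < δ → ∀ ρ, 0 < ρ → ρ < δ →
      ENNReal.ofReal (π * ρ ^ 2 / 2) ≤
        ∫⁻ p in Icc c d ∩ F ⁻¹' (Metric.closedBall y' ρ), ENNReal.ofReal (crs (Fx p) (Fy p)) := by
    intro x hx
    have hxS := hS hx
    have hFx : F x = y := hxS.2
    obtain ⟨c, d, r1, r2, r3, r4, r5, r6⟩ := h.exists_rect h1 h2 h3 h4 h5 h6 hq hxS.1 (by rw [hFx]; exact hne) hε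
    have := (h'.mono r4).density r1 r2 r3 r6
    rw [hFx] at this
    exact ⟨c, d, r4, r5, this⟩
  choose! c d r4 r5 δ hδ H using hrect
  obtain ⟨δ0, hδ0, hδm⟩ : ∃ δ0 > 0, ∀ x ∈ S, δ0 ≤ δ x := by
    rcases S.eq_empty_or_nonempty with h0 | h0
    · exact ⟨1, one_pos, by simp [h0]⟩
    · obtain ⟨z, hz, hmin⟩ := Finset.exists_min_image S δ h0
      exact ⟨δ z, hδ z hz, hmin⟩
  refine ⟨δ0, hδ0, fun y' hy' ρ hρ0 hρ => ?_⟩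
  rw [h'.nu_apply Metric.isClosed_closedBall.measurableSet]
  have hms : ∀ x ∈ S, MeasurableSet (Icc (c x) (d x) ∩ F ⁻¹' (Metric.closedBall y' ρ)) := fun x hx =>
    ((h'.mono (r4 x hx)).app.cont.preimage_isClosed_of_isClosed isClosed_Icc Metric.isClosed_closedBall).measurableSet
  calc (S.card : ℝ≥0∞) * ENNReal.ofReal (π * ρ ^ 2 / 2) = ∑ x ∈ S, ENNReal.ofReal (π * ρ ^ 2 / 2) := by
        rw [Finset.sum_const, nsmul_eq_mul]
    _ ≤ ∑ x ∈ S, ∫⁻ p in Icc (c x) (d x) ∩ F ⁻¹' (Metric.closedBall y' ρ), ENNReal.ofReal (crs (Fx p) (Fy p)) :=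
        Finset.sum_le_sum fun x hx => H x hx y' (hy'.trans_le (hδm x hx)) ρ hρ0 (hρ.trans_le (hδm x hx))
    _ = ∫⁻ p in ⋃ x ∈ S, Icc (c x) (d x) ∩ F ⁻¹' (Metric.closedBall y' ρ), ENNReal.ofReal (crs (Fx p) (Fy p)) := by
        rw [lintegral_biUnion_finset _ hms]
        intro x hx x' hx' hn
        refine Set.disjoint_left.2 fun p hp hp' => ?_
        have e1 := r5 x hx hp.1
        have e2 := r5 x' hx' hp'.1
        rw [Metric.mem_ball] at e1 e2
        have e3 := hsep x hx x' hx' hn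
        have e4 := dist_triangle_left x x' p
        linarith
    _ ≤ _ := by
        refine lintegral_mono_set ?_
        refine iUnion₂_subset fun x hx => inter_subset_inter_left _ (r4 x hx)

end Dist2

open MeasureTheory Set Filter
open scoped ENNReal Real Topology


structure Cut (a b : ℝ) (χ χ' : ℝ → ℝ) : Prop where
  a0 : 0 < a
  ab : a < b
  der : ∀ t, HasDerivAt χ (χ' t) t
  cont : Continuous χ'
  nonneg : ∀ t, 0 ≤ χ t
  le_one : ∀ t, χ t ≤ 1
  dnonneg : ∀ t, 0 ≤ χ' t
  zero : ∀ t, t ≤ a → χ t = 0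
  one : ∀ t, b ≤ t → χ t = 1
  dzero : ∀ t, t < a → χ' t = 0
  done : ∀ t, b < t → χ' t = 0

lemma exists_cut {a b : ℝ} (ha : 0 < a) (hab : a < b) : ∃ χ χ', Cut a b χ χ' := by
  have hba : 0 < b - a := sub_pos.2 hab
  set χ : ℝ → ℝ := fun t => Real.smoothTransition ((t - a) / (b - a)) with hχ
  have hcd : ContDiff ℝ 1 χ := by
    have : ContDiff ℝ 1 Real.smoothTransition := Real.smoothTransition.contDiff (n := 1)
    exact this.comp (by fun_prop)
  have hz : ∀ t, t ≤ a → χ t = 0 := fun t ht =>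
    Real.smoothTransition.zero_of_nonpos (div_nonpos_of_nonpos_of_nonneg (by linarith) hba.le)
  have ho : ∀ t, b ≤ t → χ t = 1 := fun t ht =>
    Real.smoothTransition.one_of_one_le (by rw [one_le_div hba]; linarith)
  have hmono : Monotone χ := fun s t hst => Real.smoothTransition.monotone (by gcongr)
  refine ⟨χ, deriv χ, ha, hab, fun t => ((hcd.differentiable (by norm_num)) t).hasDerivAt,
    hcd.continuous_deriv (by norm_num), fun t => Real.smoothTransition.nonneg _,
    fun t => Real.smoothTransition.le_one _, fun t => hmono.deriv_nonneg, hz, ho, fun t ht => ?_, fun t ht => ?_⟩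
  · have : χ =ᶠ[𝓝 t] fun _ => 0 := by
      filter_upwards [Iio_mem_nhds ht] with u hu using hz u (le_of_lt hu)
    rw [this.deriv_eq]; simp
  · have : χ =ᶠ[𝓝 t] fun _ => 1 := by
      filter_upwards [Ioi_mem_nhds ht] with u hu using ho u (le_of_lt hu)
    rw [this.deriv_eq]; simp

def LL (R t : ℝ) : ℝ := Real.log R - Real.log t

lemma LL_ge {R T t : ℝ} (hR : Real.exp 1 * (T + 2) ≤ R) (hT : 0 ≤ T) (ht0 : 0 < t) (ht : t ≤ T + 2) :
    1 ≤ LL R t := by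
  unfold LL
  have h1 : Real.log (Real.exp 1 * t) ≤ Real.log R := by
    apply Real.log_le_log (by positivity)
    refine le_trans ?_ hR
    gcongr
  rw [Real.log_mul (by positivity) ht0.ne', Real.log_exp] at h1
  linarith

def GLp (χ : ℝ → ℝ) (R t : ℝ) : ℝ := χ t / (t * LL R t)
def GLd (χ χ' : ℝ → ℝ) (R t : ℝ) : ℝ := χ' t / (t * LL R t) - χ t * (LL R t - 1) / (t * LL R t) ^ 2

namespace Cut
variable {a b R T t : ℝ} {χ χ' : ℝ → ℝ}

lemma hasDerivAt_GL (h : Cut a b χ χ') (hR : Real.exp 1 * (T + 2) ≤ R) (hT : 0 ≤ T) (ht : t ∈ Icc 0 T) :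
    HasDerivAt (GLp χ R) (GLd χ χ' R t) t := by
  rcases lt_or_ge t a with hlt | hge
  · have e : GLd χ χ' R t = 0 := by rw [GLd, h.dzero t hlt, h.zero t hlt.le]; simp
    rw [e]
    refine (hasDerivAt_const t (0:ℝ)).congr_of_eventuallyEq ?_
    filter_upwards [Iio_mem_nhds hlt] with u hu
    rw [GLp, h.zero u (le_of_lt hu), zero_div]
  · have t0 : 0 < t := h.a0.trans_le hge
    have hL := LL_ge hR hT t0 (by linarith [ht.2])
    have d1 : HasDerivAt (LL R) (-t⁻¹) t := by
      have := (Real.hasDerivAt_log t0.ne').const_sub (Real.log R)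
      exact this
    have d2 := (hasDerivAt_id t).mul d1
    have hne : t * LL R t ≠ 0 := by positivity
    have d3 := (h.der t).div d2 hne
    refine d3.congr_deriv ?_
    simp only [GLd, id, Pi.mul_apply]
    field_simp
    ring

lemma continuousOn_GLd (h : Cut a b χ χ') (hR : Real.exp 1 * (T + 2) ≤ R) (hT : 0 ≤ T) :
    ContinuousOn (GLd χ χ' R) (Icc 0 T) := by
  intro t ht
  apply ContinuousAt.continuousWithinAt
  rcases lt_or_ge t a with hlt | hge
  · refine (continuousAt_const (y := (0:ℝ))).congr ?_
    filter_upwards [Iio_mem_nhds hlt] with u hu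
    rw [GLd, h.dzero u hu, h.zero u (le_of_lt hu)]; simp
  · have t0 : 0 < t := h.a0.trans_le hge
    have hL := LL_ge hR hT t0 (by linarith [ht.2])
    have hne : t * LL R t ≠ 0 := by positivity
    have c1 : ContinuousAt (LL R) t := continuousAt_const.sub (Real.continuousAt_log t0.ne')
    have c2 := (h.der t).continuousAt
    have c3 := h.cont.continuousAt (x := t)
    have c4 : ContinuousAt (fun t => t * LL R t) t := continuousAt_id.mul c1
    unfold GLd
    exact (c3.div c4 hne).sub ((c2.mul (c1.sub continuousAt_const)).div (c4.pow 2) (pow_ne_zero _ hne))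

lemma GL_ineq (h : Cut a b χ χ') (hR : Real.exp 1 * (T + 2) ≤ R) (hT : 0 ≤ T) (ht : t ∈ Icc 0 T) :
    2 * χ' t / LL R t ≤ 2 * GLp χ R t + 2 * t * GLd χ χ' R t - t * GLp χ R t ^ 2 := by
  rcases lt_or_ge t a with hlt | hge
  · rw [GLd, GLp, h.dzero t hlt, h.zero t hlt.le]; simp
  · have t0 : 0 < t := h.a0.trans_le hge
    have hL := LL_ge hR hT t0 (by linarith [ht.2])
    have e : 2 * GLp χ R t + 2 * t * GLd χ χ' R t - t * GLp χ R t ^ 2 = 2 * χ' t / LL R t +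
      (χ t * (2 - χ t)) / (t * LL R t ^ 2) := by
      unfold GLp GLd
      field_simp
      ring
    rw [e]
    have h1 := h.nonneg t
    have h2 : 0 ≤ 2 - χ t := by linarith [h.le_one t]
    have : 0 ≤ (χ t * (2 - χ t)) / (t * LL R t ^ 2) := by positivity
    linarith

lemma div_nonneg_LL (h : Cut a b χ χ') (hR : Real.exp 1 * (T + 2) ≤ R) (hT : 0 ≤ T) (ht : t ≤ T + 2) :
    0 ≤ 2 * χ' t / LL R t := by
  rcases lt_or_ge t a with hlt | hge
  · rw [h.dzero t hlt]; simp
  · have t0 : 0 < t := h.a0.trans_le hge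
    have hL := LL_ge hR hT t0 ht
    have := h.dnonneg t
    positivity

/-- integral of the derivative over radii -/
lemma radial {r r1 : ℝ} (hr : 0 < r) (hr1 : r < r1) (h : Cut (r ^ 2) (r1 ^ 2) χ χ') :
    ∫⁻ ρ in Ioc r r1, ENNReal.ofReal (ρ * χ' (ρ ^ 2)) = ENNReal.ofReal (1 / 2) := by
  have hd : ∀ x ∈ uIcc r r1, HasDerivAt (fun ρ => χ (ρ ^ 2) / 2) (x * χ' (x ^ 2)) x := by
    intro x _
    have := ((h.der (x ^ 2)).comp x (hasDerivAt_pow 2 x)).div_const 2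
    refine this.congr_deriv ?_
    push_cast; ring
  have hc : Continuous fun x => x * χ' (x ^ 2) := by have := h.cont; fun_prop
  have hi := intervalIntegral.integral_eq_sub_of_hasDerivAt hd (hc.intervalIntegrable _ _)
  rw [h.one _ le_rfl, h.zero _ le_rfl, intervalIntegral.integral_of_le hr1.le] at hi
  rw [← ofReal_integral_eq_lintegral_ofReal (hc.integrableOn_Ioc), hi]
  · simp
  · filter_upwards [ae_restrict_mem measurableSet_Ioc] with x hx
    exact mul_nonneg (hr.trans hx.1).le (h.dnonneg _)

end Cut

open MeasureTheory Set Filter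
open scoped ENNReal Real Topology


def cpt (ρ θ : ℝ) : ℂ := (ρ : ℂ) * ((Real.cos θ : ℂ) + (Real.sin θ : ℂ) * Complex.I)

lemma norm_cpt {ρ : ℝ} (hρ : 0 ≤ ρ) (θ : ℝ) : ‖cpt ρ θ‖ = ρ := by
  have : (Real.cos θ : ℂ) + (Real.sin θ : ℂ) * Complex.I = Complex.exp (θ * Complex.I) := by
    rw [Complex.exp_mul_I]; push_cast; rfl
  rw [cpt, this, norm_mul, Complex.norm_exp_ofReal_mul_I, mul_one, Complex.norm_real, Real.norm_of_nonneg hρ]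

lemma continuous_cpt : Continuous (fun p : ℝ × ℝ => cpt p.1 p.2) := by
  unfold cpt; fun_prop

def circ (n : ℂ → ℝ≥0∞) (y0 : ℂ) (ρ : ℝ) : ℝ≥0∞ := ∫⁻ θ in Ioo (-π) π, n (y0 + cpt ρ θ)

lemma circ_lsc {n : ℂ → ℝ≥0∞} (hn : LowerSemicontinuous n) (y0 : ℂ) {r : ℝ} {c : ℝ≥0∞} (hc : c < circ n y0 r) :
    ∀ᶠ ρ in 𝓝 r, c < circ n y0 ρ := by
  by_contra hcon
  have hf := Filter.not_eventually.1 hcon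
  obtain ⟨u, hu, hub⟩ := exists_seq_forall_of_frequently hf
  refine absurd hc (not_lt.2 ?_)
  have hm : ∀ ρ, Measurable fun θ => n (y0 + cpt ρ θ) := fun ρ =>
    hn.measurable.comp (by unfold cpt; fun_prop)
  calc circ n y0 r ≤ ∫⁻ θ in Ioo (-π) π, liminf (fun j => n (y0 + cpt (u j) θ)) atTop := by
        refine lintegral_mono fun θ => ?_
        have ht : Tendsto (fun j => y0 + cpt (u j) θ) atTop (𝓝 (y0 + cpt r θ)) := by
          have : Continuous fun ρ => y0 + cpt ρ θ := by unfold cpt; fun_prop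
          exact (this.tendsto r).comp hu
        refine (LowerSemicontinuousAt.le_liminf (hn (y0 + cpt r θ))).trans ?_
        exact Filter.liminf_le_liminf_of_le ht
    _ ≤ liminf (fun j => circ n y0 (u j)) atTop := lintegral_liminf_le fun j => hm _
    _ ≤ c := by
        refine Filter.liminf_le_of_le (by isBoundedDefault) fun b hb => ?_
        obtain ⟨j, hj⟩ := hb.exists
        exact hj.trans (not_lt.1 (hub j))

lemma polar_formula {n : ℂ → ℝ≥0∞} (hn : Measurable n) (y0 : ℂ) {u : ℝ → ℝ≥0∞} (hu : Measurable u) :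
    ∫⁻ z, u ‖z - y0‖ * n z = ∫⁻ ρ in Ioi (0:ℝ), (ENNReal.ofReal ρ * u ρ) * circ n y0 ρ := by
  have e1 : ∫⁻ z, u ‖z - y0‖ * n z = ∫⁻ w, u ‖w‖ * n (y0 + w) := by
    rw [← lintegral_add_left_eq_self _ y0]
    simp
  rw [e1, ← Complex.lintegral_comp_polarCoord_symm, polarCoord_target, Measure.volume_eq_prod,
    ← Measure.prod_restrict, lintegral_prod]
  · refine setLIntegral_congr_fun measurableSet_Ioi fun ρ hρ => ?_
    have hm : Measurable fun θ => n (y0 + cpt ρ θ) := hn.comp (by unfold cpt; fun_prop)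
    simp only [circ]
    rw [← lintegral_const_mul _ hm]
    refine lintegral_congr fun θ => ?_
    have : Complex.polarCoord.symm (ρ, θ) = cpt ρ θ := by
      rw [Complex.polarCoord_symm_apply]; rfl
    rw [this, norm_cpt (le_of_lt hρ), smul_eq_mul, mul_assoc]
  · apply Measurable.aemeasurable
    have : (fun p : ℝ × ℝ => Complex.polarCoord.symm p) = fun p => cpt p.1 p.2 := by
      funext p
      rw [Complex.polarCoord_symm_apply]; rfl
    have hmm : Measurable fun p : ℝ × ℝ => Complex.polarCoord.symm p := by
      rw [this]; exact continuous_cpt.measurable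
    exact (Measurable.ennreal_ofReal measurable_fst).mul ((hu.comp hmm.norm).mul (hn.comp (hmm.const_add y0)))

lemma periodic_lintegral {g : ℝ → ℝ≥0∞} (hg : ∀ θ, g (θ + 2 * π) = g θ) :
    ∫⁻ θ in Icc 0 (2 * π), g θ = ∫⁻ θ in Ioo (-π) π, g θ := by
  have hp : Function.Periodic g (2 * π) := hg
  have e1 : ∫⁻ θ in Icc 0 (2 * π), g θ = ∫⁻ θ in Ioc 0 (0 + 2 * π), g θ := by
    rw [zero_add]; exact setLIntegral_congr Ioc_ae_eq_Icc.symm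
  have e2 : ∫⁻ θ in Ioo (-π) π, g θ = ∫⁻ θ in Ioc (-π) (-π + 2 * π), g θ := by
    have : -π + 2 * π = π := by ring
    rw [this]; exact setLIntegral_congr Ioo_ae_eq_Ioc
  rw [e1, e2]
  refine (isAddFundamentalDomain_Ioc (T := 2 * π) (by positivity) 0).setLIntegral_eq
    (isAddFundamentalDomain_Ioc (T := 2 * π) (by positivity) (-π)) g ?_
  rintro ⟨_, ⟨k, rfl⟩⟩ x
  have := hp.int_mul k x
  simpa [AddSubgroup.vadd_def, add_comm] using this

namespace Dist2

variable {a b : ℝ × ℝ} {F Fx Fy : ℝ × ℝ → ℂ} {Fn : ℕ → ℝ × ℝ → ℂ} {M : ℝ} {K : ℝ × ℝ → ℝ}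

lemma circ_bound (h : Dist2 a b F Fx Fy Fn M K) {a' b' : ℝ × ℝ} (h1 : a.1 < a'.1) (h2 : a'.1 < b'.1)
    (h3 : b'.1 < b.1) (h4 : a.2 < a'.2) (h5 : a'.2 < b'.2) (h6 : b'.2 < b.2) (y0 : ℂ) :
    ∃ C : ℝ, 0 ≤ C ∧ ∃ R, 1 ≤ R ∧ ∀ r, 0 < r → r < 1 →
      circ (nn (nu a' b' F Fx Fy)) y0 r ≤ ENNReal.ofReal (C * LL R (r ^ 2)) := by
  obtain ⟨C, hC0, hC⟩ := h.star2 h1 h2.le h3 h4 h5.le h6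
  have hsub : Icc a' b' ⊆ Icc a b := Icc_subset_Icc ⟨h1.le, h4.le⟩ ⟨h3.le, h6.le⟩
  have h' := h.mono hsub
  have hA := h'.app
  set n := nn (nu a' b' F Fx Fy) with hn
  have hlsc : LowerSemicontinuous n := lsc_nn _
  set T := (M + ‖y0‖) ^ 2 with hTdef
  have hT0 : 0 ≤ T := sq_nonneg _
  set R := Real.exp 1 * (T + 2) with hRdef
  have hR1 : 1 ≤ R := by
    have := Real.add_one_le_exp (1:ℝ)
    nlinarith
  have hmemF : ∀ p ∈ Icc a' b', nsq (F p - y0) ∈ Icc 0 T := fun p hp =>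
    ⟨nsq_nonneg _, Approx.nsq_le (hA.bddF hp) le_rfl⟩
  refine ⟨2 * C, by positivity, R, hR1, fun r hr0 hr1 => ?_⟩
  have hLr : 1 ≤ LL R (r ^ 2) := LL_ge le_rfl hT0 (by positivity) (by nlinarith)
  by_contra hcon
  push Not at hcon
  obtain ⟨c, hc1, hc2⟩ := exists_between hcon
  obtain ⟨η, hη, hηc⟩ := Metric.eventually_nhds_iff.1 (circ_lsc hlsc y0 hc2)
  set r1 := min (r + η / 2) 1 with hr1def
  have hrr1 : r < r1 := lt_min (by linarith) hr1
  have hr11 : r1 ≤ 1 := min_le_right _ _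
  have hr1η : r1 ≤ r + η / 2 := min_le_left _ _
  have hr10 : 0 < r1 := hr0.trans hrr1
  obtain ⟨χ, χ', hχ⟩ := exists_cut (a := r ^ 2) (b := r1 ^ 2) (by positivity) (by gcongr)
  set g : ℂ → ℝ≥0∞ := fun z => ENNReal.ofReal (2 * χ' (nsq (z - y0)) / LL R (nsq (z - y0))) with hg
  have hgm : Measurable g := by
    have m1 : Measurable fun z : ℂ => nsq (z - y0) := (continuous_nsq.comp (by fun_prop)).measurable
    have m2 : Measurable fun z : ℂ => χ' (nsq (z - y0)) := hχ.cont.measurable.comp m1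
    have m3 : Measurable fun z : ℂ => LL R (nsq (z - y0)) := by
      unfold LL
      exact (Real.measurable_log.comp m1).const_sub _
    exact ((m2.const_mul 2).div m3).ennreal_ofReal
  -- upper bound
  have hup : ∫⁻ p in Icc a' b', g (F p) * ENNReal.ofReal (crs (Fx p) (Fy p)) ≤ ENNReal.ofReal C := by
    have hst := hC y0 T le_rfl (GLp χ R) (GLd χ χ' R) (fun t ht => hχ.hasDerivAt_GL le_rfl hT0 ht)
      (hχ.continuousOn_GLd le_rfl hT0) (fun t ht => (hχ.div_nonneg_LL (R := R) le_rfl hT0 (by linarith [ht.2])).trans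
        (hχ.GL_ineq le_rfl hT0 ht))
    have hGc : ContinuousOn (GLp χ R) (Icc 0 T) := fun t ht =>
      (hχ.hasDerivAt_GL le_rfl hT0 ht).continuousAt.continuousWithinAt
    have hGc' : ContinuousOn (GLd χ χ' R) (Icc 0 T) := hχ.continuousOn_GLd le_rfl hT0
    have hg1 : ContinuousOn (fun t => 2 * GLp χ R t + 2 * t * GLd χ χ' R t - t * GLp χ R t ^ 2) (Icc 0 T) := by fun_prop
    have i1 := int_term hA.cont (fun p hp => hA.bddF hp) y0 le_rfl hg1 (continuous_const (y := (1:ℝ)))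
      (integrable_crs hA.memx hA.memy)
    simp only [one_mul] at i1
    refine le_trans ?_ (ENNReal.ofReal_le_ofReal hst)
    rw [ofReal_integral_eq_lintegral_ofReal i1]
    · refine lintegral_mono_ae ?_
      filter_upwards [h'.jac_nonneg, ae_restrict_mem measurableSet_Icc] with p hJ hm
      have hin := hχ.GL_ineq (R := R) le_rfl hT0 (hmemF p hm)
      have hnn := hχ.div_nonneg_LL (R := R) le_rfl hT0 (t := nsq (F p - y0)) (by linarith [(hmemF p hm).2])
      rw [hg, ← ENNReal.ofReal_mul hnn]
      apply ENNReal.ofReal_le_ofReal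
      gcongr
    · filter_upwards [h'.jac_nonneg, ae_restrict_mem measurableSet_Icc] with p hJ hm
      have hin := hχ.GL_ineq (R := R) le_rfl hT0 (hmemF p hm)
      have hnn := hχ.div_nonneg_LL (R := R) le_rfl hT0 (t := nsq (F p - y0)) (by linarith [(hmemF p hm).2])
      exact mul_nonneg (hnn.trans hin) hJ
  have hup2 := (h'.area hgm).trans (mul_le_mul_right hup 2)
  -- lower bound
  set u : ℝ → ℝ≥0∞ := fun ρ => ENNReal.ofReal (χ' (ρ ^ 2) * (2 / LL R (r ^ 2))) with hu
  have hum : Measurable u := by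
    have := hχ.cont
    exact (by fun_prop : Continuous fun ρ : ℝ => χ' (ρ ^ 2) * (2 / LL R (r ^ 2))).measurable.ennreal_ofReal
  have hug : ∀ z, u ‖z - y0‖ ≤ g z := by
    intro z
    rw [hu, hg]
    simp only [← nsq_eq_norm]
    apply ENNReal.ofReal_le_ofReal
    set t := nsq (z - y0)
    rcases lt_or_ge t (r ^ 2) with hlt | hge
    · rw [hχ.dzero t hlt]; simp
    rcases lt_or_ge (r1 ^ 2) t with hlt2 | hge2
    · rw [hχ.done t hlt2]; simp
    have t0 : 0 < t := lt_of_lt_of_le (by positivity) hge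
    have hL := LL_ge (R := R) le_rfl hT0 t0 (by nlinarith)
    have hLL : LL R t ≤ LL R (r ^ 2) := by
      unfold LL
      have := Real.log_le_log (by positivity) hge
      linarith
    have := hχ.dnonneg t
    calc χ' t * (2 / LL R (r ^ 2)) ≤ χ' t * (2 / LL R t) := by gcongr
      _ = _ := by ring
  have hlow : ENNReal.ofReal (1 / LL R (r ^ 2)) * c ≤ 2 * ENNReal.ofReal C := by
    calc ENNReal.ofReal (1 / LL R (r ^ 2)) * c
        = (ENNReal.ofReal (2 / LL R (r ^ 2)) * ∫⁻ ρ in Ioc r r1, ENNReal.ofReal (ρ * χ' (ρ ^ 2))) * c := by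
          rw [Cut.radial hr0 hrr1 hχ, ← ENNReal.ofReal_mul (by positivity)]
          congr 2; ring
      _ = ∫⁻ ρ in Ioc r r1, ENNReal.ofReal (2 / LL R (r ^ 2)) * ENNReal.ofReal (ρ * χ' (ρ ^ 2)) * c := by
          rw [← lintegral_const_mul' _ _ ENNReal.ofReal_ne_top, ← lintegral_mul_const]
          have := hχ.cont
          have : Measurable fun ρ => ENNReal.ofReal (ρ * χ' (ρ ^ 2)) :=
            (by fun_prop : Continuous fun ρ : ℝ => ρ * χ' (ρ ^ 2)).measurable.ennreal_ofReal
          exact this.const_mul _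
      _ ≤ ∫⁻ ρ in Ioc r r1, (ENNReal.ofReal ρ * u ρ) * circ n y0 ρ := by
          refine setLIntegral_mono' measurableSet_Ioc fun ρ hρ => ?_
          have hρ0 : 0 < ρ := hr0.trans hρ.1
          have e : ENNReal.ofReal (2 / LL R (r ^ 2)) * ENNReal.ofReal (ρ * χ' (ρ ^ 2)) = ENNReal.ofReal ρ * u ρ := by
            rw [hu, ← ENNReal.ofReal_mul (by positivity), ← ENNReal.ofReal_mul hρ0.le]
            congr 1; ring
          rw [e]
          gcongr
          refine (hηc ?_).le
          rw [Real.dist_eq, abs_lt]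
          constructor <;> linarith [hρ.1, hρ.2]
      _ ≤ ∫⁻ ρ in Ioi (0:ℝ), (ENNReal.ofReal ρ * u ρ) * circ n y0 ρ :=
          lintegral_mono_set fun ρ hρ => hr0.trans hρ.1
      _ = ∫⁻ z, u ‖z - y0‖ * n z := (polar_formula hlsc.measurable y0 hum).symm
      _ ≤ ∫⁻ z, g z * n z := lintegral_mono fun z => by gcongr; exact hug z
      _ ≤ _ := hup2
  have hc3 : c ≤ ENNReal.ofReal (2 * C * LL R (r ^ 2)) := by
    calc c = ENNReal.ofReal (LL R (r ^ 2)) * (ENNReal.ofReal (1 / LL R (r ^ 2)) * c) := by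
          rw [← mul_assoc, ← ENNReal.ofReal_mul (by positivity)]
          have : LL R (r ^ 2) * (1 / LL R (r ^ 2)) = 1 := by field_simp
          rw [this]; simp
      _ ≤ ENNReal.ofReal (LL R (r ^ 2)) * (2 * ENNReal.ofReal C) := by gcongr
      _ = _ := by
          rw [← ENNReal.ofReal_ofNat, ← ENNReal.ofReal_mul (by norm_num), ← ENNReal.ofReal_mul (by positivity)]
          congr 1; ring
  exact absurd hc1 (not_lt.2 hc3)

lemma final (h : Dist2 a b F Fx Fy Fn M K) {a' b' : ℝ × ℝ} (h1 : a.1 < a'.1) (h2 : a'.1 < b'.1)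
    (h3 : b'.1 < b.1) (h4 : a.2 < a'.2) (h5 : a'.2 < b'.2) (h6 : b'.2 < b.2)
    {x0 : ℝ × ℝ} (hx0 : x0 ∈ Icc a' b') :
    ∃ r₀ ∈ Ioo (0 : ℝ) 1, ∃ C : ℝ, 0 < C ∧ ∀ r : ℝ, 0 < r → r < r₀ →
      ∫⁻ θ in Icc (0 : ℝ) (2 * π), (((Ioo a'.1 b'.1 ×ˢ Ioo a'.2 b'.2) ∩ F ⁻¹' {F x0 + cpt r θ}).encard : ℝ≥0∞)
        ≤ ENNReal.ofReal (C * Real.log (1 / r)) := by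
  obtain ⟨C, hC0, R, hR, H⟩ := h.circ_bound h1 h2 h3 h4 h5 h6 (F x0)
  have hR0 : 0 < R := by linarith
  refine ⟨min (1 / 2) (1 / R), ⟨by positivity, (min_le_left _ _).trans_lt (by norm_num)⟩, 3 * C + 1, by positivity,
    fun r hr0 hr => ?_⟩
  have hr1 : r < 1 := hr.trans_le ((min_le_left _ _).trans (by norm_num))
  have hrR : r ≤ 1 / R := hr.le.trans (min_le_right _ _)
  have hle : C * LL R (r ^ 2) ≤ (3 * C + 1) * Real.log (1 / r) := by
    have l1 : 0 ≤ Real.log (1 / r) := Real.log_nonneg (by rw [one_le_div hr0]; exact hr1.le)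
    have l2 : Real.log R ≤ Real.log (1 / r) := Real.log_le_log hR0 (by
      rw [le_div_iff₀ hr0]; rw [le_div_iff₀ hR0] at hrR; linarith)
    have l3 : LL R (r ^ 2) = Real.log R + 2 * Real.log (1 / r) := by
      rw [LL, Real.log_pow, one_div, Real.log_inv]; push_cast; ring
    rw [l3]
    nlinarith
  refine le_trans ?_ (ENNReal.ofReal_le_ofReal hle)
  refine le_trans ?_ (H r hr0 hr1)
  rw [circ, ← periodic_lintegral (g := fun θ => nn (nu a' b' F Fx Fy) (F x0 + cpt r θ))]
  · refine lintegral_mono fun θ => ?_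
    refine h.mult_le h1 h2 h3 h4 h5 h6 hx0 ?_
    intro he
    have : cpt r θ = 0 := by simpa using he.symm
    have h0 := norm_cpt hr0.le θ
    rw [this, norm_zero] at h0
    exact hr0.ne h0
  · intro θ
    simp [cpt]

end Dist2

open MeasureTheory Set Filter
open scoped ENNReal Real Topology Convolution


section moll

abbrev PP : Type := ℝ × ℝ

/-- mollification -/
def mol (φ : ContDiffBump (0 : ℝ × ℝ)) (g : ℝ × ℝ → ℂ) : ℝ × ℝ → ℂ :=
  (φ.normed volume) ⋆[ContinuousLinearMap.lsmul ℝ ℝ, volume] g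

lemma lint_normed (φ : ContDiffBump (0 : ℝ × ℝ)) : ∫⁻ t, ENNReal.ofReal (φ.normed volume t) = 1 := by
  rw [← ofReal_integral_eq_lintegral_ofReal φ.integrable_normed (Eventually.of_forall φ.nonneg_normed),
    φ.integral_normed, ENNReal.ofReal_one]

lemma young2 (φ : ContDiffBump (0 : ℝ × ℝ)) {g : ℝ × ℝ → ℂ} (hg : Measurable g) :
    eLpNorm (mol φ g) 2 volume ≤ eLpNorm g 2 volume := by
  have hk : Measurable fun t => ENNReal.ofReal (φ.normed volume t) :=
    φ.continuous_normed.measurable.ennreal_ofReal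
  rw [eLpNorm_eq_lintegral_rpow_enorm_toReal (by norm_num) (by norm_num),
    eLpNorm_eq_lintegral_rpow_enorm_toReal (by norm_num) (by norm_num)]
  simp only [ENNReal.toReal_ofNat]
  gcongr ?_ ^ _
  calc ∫⁻ x, ‖mol φ g x‖ₑ ^ (2:ℝ)
      ≤ ∫⁻ x, ∫⁻ t, ENNReal.ofReal (φ.normed volume t) * ‖g (x - t)‖ₑ ^ (2:ℝ) := by
        refine lintegral_mono fun x => ?_
        have hgx : Measurable fun t => ‖g (x - t)‖ₑ := (hg.comp (measurable_id.const_sub x)).enorm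
        have e1 : ‖mol φ g x‖ₑ ≤ ∫⁻ t, (ENNReal.ofReal (φ.normed volume t)) ^ (1 / 2 : ℝ) *
            ((ENNReal.ofReal (φ.normed volume t)) ^ (1 / 2 : ℝ) * ‖g (x - t)‖ₑ) := by
          unfold mol
          rw [convolution_def]
          refine (enorm_integral_le_lintegral_enorm _).trans (lintegral_mono fun t => le_of_eq ?_)
          rw [← mul_assoc, ← ENNReal.rpow_add_of_nonneg _ _ (by norm_num) (by norm_num)]
          norm_num
          congr 1
          rw [← ofReal_norm, Complex.norm_real, Real.norm_of_nonneg (φ.nonneg_normed t)]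
        have e2 := ENNReal.lintegral_mul_le_Lp_mul_Lq volume (p := 2) (q := 2) (by constructor <;> norm_num)
          (f := fun t => (ENNReal.ofReal (φ.normed volume t)) ^ (1 / 2 : ℝ))
          (g := fun t => (ENNReal.ofReal (φ.normed volume t)) ^ (1 / 2 : ℝ) * ‖g (x - t)‖ₑ)
          (hk.pow_const _).aemeasurable ((hk.pow_const _).mul hgx).aemeasurable
        have e3 := e1.trans e2
        have s1 : ∀ t, ((ENNReal.ofReal (φ.normed volume t)) ^ (1 / 2 : ℝ)) ^ (2:ℝ) = ENNReal.ofReal (φ.normed volume t) :=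
          fun t => by rw [← ENNReal.rpow_mul]; norm_num
        simp only [ENNReal.mul_rpow_of_nonneg _ _ (zero_le_two (α := ℝ)), s1, lint_normed, ENNReal.one_rpow, one_mul] at e3
        calc ‖mol φ g x‖ₑ ^ (2:ℝ) ≤ _ := ENNReal.rpow_le_rpow e3 (by norm_num)
          _ = _ := by rw [← ENNReal.rpow_mul]; norm_num
    _ = ∫⁻ t, ∫⁻ x, ENNReal.ofReal (φ.normed volume t) * ‖g (x - t)‖ₑ ^ (2:ℝ) := by
        refine lintegral_lintegral_swap (Measurable.aemeasurable ?_)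
        exact (hk.comp measurable_snd).mul ((hg.comp (measurable_fst.sub measurable_snd)).enorm.pow_const _)
    _ = ∫⁻ t, ENNReal.ofReal (φ.normed volume t) * ∫⁻ x, ‖g x‖ₑ ^ (2:ℝ) := by
        refine lintegral_congr fun t => ?_
        rw [lintegral_const_mul' _ _ ENNReal.ofReal_ne_top,
          lintegral_sub_right_eq_self (fun x => ‖g x‖ₑ ^ (2:ℝ)) t]
    _ = _ := by rw [lintegral_mul_const _ hk, lint_normed, one_mul]

lemma continuous_mol (φ : ContDiffBump (0 : ℝ × ℝ)) {g : ℝ × ℝ → ℂ} (hg : LocallyIntegrable g) :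
    Continuous (mol φ g) :=
  φ.hasCompactSupport_normed.continuous_convolution_left _ φ.continuous_normed hg

lemma mol_sub (φ : ContDiffBump (0 : ℝ × ℝ)) {g h : ℝ × ℝ → ℂ} (hg : LocallyIntegrable g)
    (hh : LocallyIntegrable h) : mol φ (fun x => g x - h x) = fun x => mol φ g x - mol φ h x := by
  funext x
  have i1 := (φ.hasCompactSupport_normed (μ := volume)).convolutionExists_left (ContinuousLinearMap.lsmul ℝ ℝ) φ.continuous_normed hg x
  have i2 := (φ.hasCompactSupport_normed (μ := volume)).convolutionExists_left (ContinuousLinearMap.lsmul ℝ ℝ) φ.continuous_normed hh x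
  unfold mol
  simp only [convolution_def, map_sub]
  exact integral_sub i1 i2

lemma mol_L2 {φ : ℕ → ContDiffBump (0 : ℝ × ℝ)} (hφ : Tendsto (fun n => (φ n).rOut) atTop (𝓝 0))
    {g : ℝ × ℝ → ℂ} (hg : Measurable g) (hg2 : MemLp g 2 volume) (a b : ℝ × ℝ) :
    Tendsto (fun n => eLpNorm (fun p => mol (φ n) g p - g p) 2 (volume.restrict (Icc a b))) atTop (𝓝 0) := by
  rw [ENNReal.tendsto_nhds_zero]
  intro ε hε
  obtain ⟨h, hhc, hgh, hcont, hh2⟩ := hg2.exists_hasCompactSupport_eLpNorm_sub_le (by norm_num)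
    (ε := ε / 3) (by simpa using hε.ne')
  have hgl : LocallyIntegrable g := hg2.locallyIntegrable (by norm_num)
  have hhl : LocallyIntegrable h := hcont.locallyIntegrable
  have huc := hhc.uniformContinuous_of_continuous hcont
  set V := (volume.restrict (Icc a b)) univ ^ ((2:ℝ≥0∞).toReal⁻¹) with hV
  have hVt : V ≠ ⊤ := ENNReal.rpow_ne_top_of_nonneg (by norm_num) (by
    rw [Measure.restrict_apply_univ]; exact isCompact_Icc.measure_lt_top.ne)
  obtain ⟨δ, hδ0, hδ⟩ : ∃ δ : ℝ, 0 < δ ∧ V * ENNReal.ofReal δ ≤ ε / 3 := by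
    have ht : Tendsto (fun δ : ℝ => V * ENNReal.ofReal δ) (𝓝[>] 0) (𝓝 (V * ENNReal.ofReal 0)) := by
      refine ENNReal.Tendsto.const_mul ?_ (Or.inr hVt)
      exact ((ENNReal.continuous_ofReal.tendsto 0)).mono_left nhdsWithin_le_nhds
    rw [ENNReal.ofReal_zero, mul_zero] at ht
    have := ht.eventually (ge_mem_nhds (show (0:ℝ≥0∞) < ε / 3 by
      rw [ENNReal.div_pos_iff]; exact ⟨hε.ne', by norm_num⟩))
    obtain ⟨δ, h1, h2⟩ := (this.and self_mem_nhdsWithin).exists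
    exact ⟨δ, h2, h1⟩
  obtain ⟨η, hη, hηd⟩ := Metric.uniformContinuous_iff.1 huc δ hδ0
  filter_upwards [hφ.eventually (gt_mem_nhds hη)] with n hn
  have e : (fun p => mol (φ n) g p - g p) =
      (mol (φ n) (fun x => g x - h x)) + (fun p => mol (φ n) h p - h p) + (fun p => h p - g p) := by
    funext p
    simp only [Pi.add_apply, mol_sub (φ n) hgl hhl]
    ring
  have hm1 : Measurable fun x => g x - h x := hg.sub hcont.measurable
  have c1 := continuous_mol (φ n) hgl
  have c2 := continuous_mol (φ n) hhl
  have a1 : AEStronglyMeasurable (mol (φ n) (fun x => g x - h x)) (volume.restrict (Icc a b)) := by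
    rw [mol_sub (φ n) hgl hhl]
    exact (c1.sub c2).aestronglyMeasurable
  have a2 : AEStronglyMeasurable (fun p => mol (φ n) h p - h p) (volume.restrict (Icc a b)) :=
    (c2.sub hcont).aestronglyMeasurable
  have a3 : AEStronglyMeasurable (fun p => h p - g p) (volume.restrict (Icc a b)) :=
    (hcont.measurable.sub hg).aestronglyMeasurable
  have t1 : eLpNorm (mol (φ n) (fun x => g x - h x)) 2 (volume.restrict (Icc a b)) ≤ ε / 3 :=
    ((eLpNorm_mono_measure _ Measure.restrict_le_self).trans (young2 (φ n) hm1)).trans hgh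
  have t3 : eLpNorm (fun p => h p - g p) 2 (volume.restrict (Icc a b)) ≤ ε / 3 := by
    refine (eLpNorm_mono_measure _ Measure.restrict_le_self).trans (le_trans (le_of_eq ?_) hgh)
    exact eLpNorm_sub_comm _ _ _ _
  have t2 : eLpNorm (fun p => mol (φ n) h p - h p) 2 (volume.restrict (Icc a b)) ≤ ε / 3 := by
    refine (eLpNorm_le_of_ae_bound (C := δ) (Eventually.of_forall fun p => ?_)).trans hδ
    rw [← dist_eq_norm]
    refine (φ n).dist_normed_convolution_le hcont.aestronglyMeasurable fun x hx => (hηd ?_).le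
    exact (Metric.mem_ball.1 hx).trans hn
  rw [e]
  calc _ ≤ eLpNorm (mol (φ n) (fun x => g x - h x) + (fun p => mol (φ n) h p - h p)) 2 (volume.restrict (Icc a b)) +
        eLpNorm (fun p => h p - g p) 2 (volume.restrict (Icc a b)) := eLpNorm_add_le (a1.add a2) a3 (by norm_num)
    _ ≤ (ε / 3 + ε / 3) + ε / 3 := by
        gcongr
        exact (eLpNorm_add_le a1 a2 (by norm_num)).trans (by gcongr)
    _ = ε := ENNReal.add_thirds ε

end moll

open MeasureTheory Set Filter
open scoped ENNReal Real Topology Convolution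


section moll2

lemma mol_fderiv (φ : ContDiffBump (0 : ℝ × ℝ)) {g : ℝ × ℝ → ℂ} (hg : LocallyIntegrable g) (x v : ℝ × ℝ) :
    fderiv ℝ (mol φ g) x v = ∫ t, (fderiv ℝ (φ.normed volume) (x - t) v) • g t := by
  have hN : ContDiff ℝ 1 (φ.normed (volume : Measure (ℝ × ℝ))) := φ.contDiff_normed (n := 1)
  have hd := (φ.hasCompactSupport_normed (μ := volume)).hasFDerivAt_convolution_left (ContinuousLinearMap.lsmul ℝ ℝ) hN hg x
  have e : fderiv ℝ (mol φ g) x = _ := hd.fderiv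
  have hi := ((φ.hasCompactSupport_normed (μ := volume)).fderiv ℝ).convolutionExists_left
    ((ContinuousLinearMap.lsmul ℝ ℝ : ℝ →L[ℝ] ℂ →L[ℝ] ℂ).precompL (ℝ × ℝ)) (hN.continuous_fderiv one_ne_zero) hg x
  have hi2 := hi.integrable_swap
  rw [e, convolution_eq_swap, ContinuousLinearMap.integral_apply hi2]
  rfl

/-- weak directional derivative -/
def WeakD (U : Set (ℝ × ℝ)) (F V : ℝ × ℝ → ℂ) (v : ℝ × ℝ) : Prop :=
  ∀ φ : ℝ × ℝ → ℝ, ContDiff ℝ (⊤ : ℕ∞) φ → HasCompactSupport φ → tsupport φ ⊆ U →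
    (∫ x in U, (fderiv ℝ φ x v) • F x) = - ∫ x in U, φ x • V x

lemma ind_int {U P : Set (ℝ × ℝ)} (hPU : P ⊆ U) {w : ℝ × ℝ → ℝ} (hw : ∀ z, z ∉ P → w z = 0) (F : ℝ × ℝ → ℂ) :
    ∫ z in U, w z • F z = ∫ z, w z • P.indicator F z := by
  have : (fun z => w z • P.indicator F z) = fun z => w z • F z := by
    funext z
    by_cases hz : z ∈ P
    · rw [indicator_of_mem hz]
    · rw [hw z hz, zero_smul, zero_smul]
  rw [this]
  refine setIntegral_eq_integral_of_forall_compl_eq_zero fun z hz => ?_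
  rw [hw z fun h => hz (hPU h), zero_smul]

lemma mol_weak {U P : Set (ℝ × ℝ)} (hPU : P ⊆ U) {F V : ℝ × ℝ → ℂ} {v : ℝ × ℝ} (hV : WeakD U F V v)
    (hF : LocallyIntegrable (P.indicator F)) (φ : ContDiffBump (0 : ℝ × ℝ)) {x : ℝ × ℝ}
    (hx : Metric.closedBall x φ.rOut ⊆ P) :
    fderiv ℝ (mol φ (P.indicator F)) x v = mol φ (P.indicator V) x := by
  rw [mol_fderiv φ hF]
  have hN : ContDiff ℝ (⊤ : ℕ∞) (φ.normed (volume : Measure (ℝ × ℝ))) := φ.contDiff_normed (n := ⊤)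
  have hsub : ContDiff ℝ (⊤ : ℕ∞) fun z : ℝ × ℝ => x - z := contDiff_const.sub contDiff_id
  set ψ : ℝ × ℝ → ℝ := fun z => φ.normed volume (x - z) with hψ
  have hmem : ∀ z, x - z ∈ Metric.closedBall (0 : ℝ × ℝ) φ.rOut → z ∈ Metric.closedBall x φ.rOut := by
    intro z hz
    rw [mem_closedBall_zero_iff] at hz
    rw [Metric.mem_closedBall, dist_comm, dist_eq_norm]; exact hz
  have hts : tsupport ψ ⊆ Metric.closedBall x φ.rOut := by
    refine closure_minimal (fun z hz => ?_) Metric.isClosed_closedBall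
    refine hmem z ?_
    rw [← φ.tsupport_normed_eq (μ := volume)]
    exact subset_tsupport _ hz
  have hcs : HasCompactSupport ψ :=
    HasCompactSupport.of_support_subset_isCompact (isCompact_closedBall x φ.rOut) ((subset_tsupport _).trans hts)
  have h := hV ψ (hN.comp hsub) hcs (hts.trans (hx.trans hPU))
  have hfd : ∀ z, fderiv ℝ ψ z v = - fderiv ℝ (φ.normed volume) (x - z) v := by
    intro z
    have h1 : HasFDerivAt (φ.normed (volume : Measure (ℝ × ℝ))) (fderiv ℝ (φ.normed volume) (x - z)) (x - z) :=
      (hN.differentiable (by simp) _).hasFDerivAt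
    have h2 : HasFDerivAt (fun z : ℝ × ℝ => x - z) (-(ContinuousLinearMap.id ℝ (ℝ × ℝ))) z :=
      (hasFDerivAt_id z).const_sub x
    have h3 : fderiv ℝ ψ z = _ := (h1.comp z h2).fderiv
    rw [h3]
    simp
  have z1 : ∀ z, z ∉ P → ψ z = 0 := fun z hz => by
    by_contra hne
    exact hz (hx (hts (subset_tsupport _ hne)))
  have z2 : ∀ z, z ∉ P → fderiv ℝ ψ z v = 0 := fun z hz => by
    by_contra hne
    refine hz (hx (hts ?_))
    refine tsupport_fderiv_subset ℝ (subset_tsupport _ ?_)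
    intro h0
    apply hne
    rw [h0]; rfl
  rw [ind_int hPU z2, ind_int hPU z1] at h
  simp only [hfd, neg_smul, integral_neg, neg_inj] at h
  rw [h]
  unfold mol
  rw [convolution_eq_swap]
  rfl

lemma exists_approx {U : Set (ℝ × ℝ)} (hU : IsOpen U) {F Fx Fy : ℝ × ℝ → ℂ} (hF : ContinuousOn F U)
    (hx : WeakD U F Fx (1, 0)) (hy : WeakD U F Fy (0, 1)) (hxm : Measurable Fx) (hym : Measurable Fy)
    (hx2 : ∀ A ⊆ U, IsCompact A → MemLp Fx 2 (volume.restrict A))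
    (hy2 : ∀ A ⊆ U, IsCompact A → MemLp Fy 2 (volume.restrict A))
    {a b : ℝ × ℝ} (hab : Icc a b ⊆ U) : ∃ Fn M, Approx a b F Fx Fy Fn M := by
  obtain ⟨η, hη, hηU⟩ := (isCompact_Icc (a := a) (b := b)).exists_cthickening_subset_open hU hab
  set P := Metric.cthickening η (Icc a b) with hP
  have hPc : IsCompact P := isCompact_Icc.cthickening
  have hPm : MeasurableSet P := hPc.measurableSet
  have hsub : Icc a b ⊆ P := Metric.self_subset_cthickening _
  have hFP : ContinuousOn F P := hF.mono hηU
  have hFi : Integrable (P.indicator F) := (integrable_indicator_iff hPm).2 (hFP.integrableOn_compact hPc)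
  have hFl := hFi.locallyIntegrable
  have hball : ∀ x ∈ Icc a b, Metric.closedBall x η ⊆ P := fun x hx => Metric.closedBall_subset_cthickening hx η
  let φ : ℕ → ContDiffBump (0 : ℝ × ℝ) := fun n => ⟨η / (n + 2) / 2, η / (n + 2), by positivity, by
    have : 0 < η / (n + 2) := by positivity
    linarith⟩
  have hφr : ∀ n, (φ n).rOut = η / (n + 2) := fun n => rfl
  have hφt : Tendsto (fun n => (φ n).rOut) atTop (𝓝 0) := by
    simp only [hφr]
    refine Tendsto.div_atTop tendsto_const_nhds ?_
    exact tendsto_atTop_add_const_right _ _ tendsto_natCast_atTop_atTop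
  have hφη : ∀ n, (φ n).rOut ≤ η := fun n => by
    rw [hφr]
    exact div_le_self hη.le (by have : (0:ℝ) ≤ n := Nat.cast_nonneg n
                                linarith)
  have hsm : ∀ n, ContDiff ℝ 2 (mol (φ n) (P.indicator F)) := fun n =>
    ((φ n).hasCompactSupport_normed (μ := volume)).contDiff_convolution_left (n := 2) _ (φ n).contDiff_normed hFl
  have hunif : TendstoUniformlyOn (fun n => mol (φ n) (P.indicator F)) F atTop (Icc a b) := by
    rw [Metric.tendstoUniformlyOn_iff]
    intro ε hε
    obtain ⟨δ, hδ, hδF⟩ := Metric.uniformContinuousOn_iff.1 (hPc.uniformContinuousOn_of_continuous hFP) (ε / 2) (half_pos hε)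
    filter_upwards [hφt.eventually (gt_mem_nhds hδ)] with n hn x hx
    have hxP := hsub hx
    have : dist (mol (φ n) (P.indicator F) x) (P.indicator F x) ≤ ε / 2 := by
      refine (φ n).dist_normed_convolution_le hFi.aestronglyMeasurable fun z hz => ?_
      have hzP : z ∈ P := hball x hx (Metric.closedBall_subset_closedBall (hφη n) (Metric.ball_subset_closedBall hz))
      rw [indicator_of_mem hzP, indicator_of_mem hxP]
      exact (hδF z hzP x hxP ((Metric.mem_ball.1 hz).trans hn)).le
    rw [indicator_of_mem hxP] at this
    rw [dist_comm]
    linarith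
  obtain ⟨M0, hM0⟩ := (isCompact_Icc (a := a) (b := b)).exists_bound_of_continuousOn (hF.mono hab)
  obtain ⟨N, hN⟩ := eventually_atTop.1 (Metric.tendstoUniformlyOn_iff.1 hunif 1 one_pos)
  have key : ∀ (v : ℝ × ℝ) (V : ℝ × ℝ → ℂ), WeakD U F V v → Measurable V → MemLp V 2 (volume.restrict P) →
      Tendsto (fun n => eLpNorm (fun p => fderiv ℝ (mol (φ (n + N)) (P.indicator F)) p v - V p) 2 (volume.restrict (Icc a b)))
        atTop (𝓝 0) := by
    intro v V hV hVm hV2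
    have hI : MemLp (P.indicator V) 2 volume := (memLp_indicator_iff_restrict hPm).2 hV2
    have h := (mol_L2 hφt (hVm.indicator hPm) hI a b).comp (tendsto_add_atTop_nat N)
    refine h.congr fun n => ?_
    refine eLpNorm_congr_ae ?_
    filter_upwards [ae_restrict_mem measurableSet_Icc] with p hp
    rw [mol_weak hηU hV hFl (φ (n + N)) ((Metric.closedBall_subset_closedBall (hφη _)).trans (hball p hp)),
      indicator_of_mem (hsub hp)]
  refine ⟨fun n => mol (φ (n + N)) (P.indicator F), M0 + 1, ?_⟩
  exact
  { smooth := fun n => hsm _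
    cont := hF.mono hab
    unif := fun u hu => (tendsto_add_atTop_nat N).eventually (hunif u hu)
    bdd := fun n p hp => by
      have h1 := hN (n + N) (Nat.le_add_left _ _) p hp
      have h2 := hM0 p hp
      rw [dist_comm, dist_eq_norm] at h1
      have h3 := norm_le_norm_add_norm_sub' (mol (φ (n + N)) (P.indicator F) p) (F p)
      linarith
    memx := hx2 _ hab isCompact_Icc
    memy := hy2 _ hab isCompact_Icc
    convx := key _ _ hx hxm (hx2 _ hηU hPc)
    convy := key _ _ hy hym (hy2 _ hηU hPc) }

end moll2

open MeasureTheory Set Filter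
open scoped ENNReal Real Topology Convolution


section transfer

/-- coordinates on the plane -/
def eE : (ℝ × ℝ) ≃L[ℝ] E2 :=
  (ContinuousLinearEquiv.finTwoArrow ℝ ℝ).symm.trans (EuclideanSpace.equiv (Fin 2) ℝ).symm

lemma eE_zero (p : ℝ × ℝ) : eE p 0 = p.1 := rfl
lemma eE_one (p : ℝ × ℝ) : eE p 1 = p.2 := rfl
lemma eE_symm_fst (x : E2) : (eE.symm x).1 = x 0 := rfl
lemma eE_symm_snd (x : E2) : (eE.symm x).2 = x 1 := rfl

lemma eE_mp : MeasurePreserving (eE : ℝ × ℝ → E2) volume volume := by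
  have h1 := (volume_preserving_finTwoArrow ℝ).symm
  have h2 := EuclideanSpace.volume_preserving_symm_measurableEquiv_toLp (Fin 2)
  exact h2.symm.comp h1

lemma eE_me : MeasurableEmbedding (eE : ℝ × ℝ → E2) := eE.toHomeomorph.measurableEmbedding

/-- identification of the plane with the complex numbers -/
def eC : E2 ≃L[ℝ] ℂ := eE.symm.trans Complex.equivRealProdCLM.symm

lemma eC_re (x : E2) : (eC x).re = x 0 := rfl
lemma eC_im (x : E2) : (eC x).im = x 1 := rfl

lemma eC_norm (x : E2) : ‖eC x‖ = ‖x‖ := by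
  rw [EuclideanSpace.norm_eq, Complex.norm_eq_sqrt_sq_add_sq, eC_re, eC_im]
  simp [Fin.sum_univ_two]

lemma eC_circle (r θ : ℝ) : eC (circlePt r θ) = cpt r θ := by
  apply Complex.ext
  · rw [eC_re]; simp [circlePt, cpt, -Complex.ofReal_cos, -Complex.ofReal_sin]
  · rw [eC_im]; simp [circlePt, cpt, -Complex.ofReal_cos, -Complex.ofReal_sin]

lemma eE_10 : eE (1, 0) = EuclideanSpace.single 0 1 := by
  ext i; fin_cases i
  · exact (eE_zero _).trans (by simp)
  · exact (eE_one _).trans (by simp)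

lemma eE_01 : eE (0, 1) = EuclideanSpace.single 1 1 := by
  ext i; fin_cases i
  · exact (eE_zero _).trans (by simp)
  · exact (eE_one _).trans (by simp)

lemma det_crs (A : E2 →L[ℝ] E2) : A.det =
    crs (eC (A (EuclideanSpace.single 0 1))) (eC (A (EuclideanSpace.single 1 1))) := by
  have h := LinearMap.det_toMatrix (EuclideanSpace.basisFun (Fin 2) ℝ).toBasis (A : E2 →ₗ[ℝ] E2)
  rw [ContinuousLinearMap.det, ← h, Matrix.det_fin_two]
  simp only [LinearMap.toMatrix_apply, crs, eC_re, eC_im]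
  simp [EuclideanSpace.basisFun_apply]
  ring

lemma eC_bound (A : E2 →L[ℝ] E2) (i : Fin 2) : ‖eC (A (EuclideanSpace.single i 1))‖ ≤ ‖A‖ := by
  rw [eC_norm]
  refine (A.le_opNorm _).trans ?_
  simp

end transfer

open MeasureTheory Set Filter
open scoped ENNReal Real Topology Convolution


section mainproof

lemma weakD_transfer {Ω : Set E2} {f : E2 → E2} {Df : E2 → E2 →L[ℝ] E2} (hf : MemW12loc Ω f Df) (i : Fin 2)
    {v : ℝ × ℝ} (hv : eE v = EuclideanSpace.single i 1) :
    WeakD (eE ⁻¹' Ω) (fun p => eC (f (eE p))) (fun p => eC (Df (eE p) (EuclideanSpace.single i 1))) v := by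
  intro φ hφ hcs hts
  have hs : ContDiff ℝ (⊤ : ℕ∞) (φ ∘ eE.symm) := hφ.comp eE.symm.contDiff
  have hcs2 : HasCompactSupport (φ ∘ eE.symm) := hcs.comp_homeomorph eE.symm.toHomeomorph
  have hts2 : tsupport (φ ∘ eE.symm) ⊆ Ω := by
    have h1 : tsupport (φ ∘ eE.symm) ⊆ eE.symm ⁻¹' tsupport φ := tsupport_comp_subset_preimage φ eE.symm.continuous
    intro x hx
    have := hts (h1 hx)
    simpa using this
  have h := hf.2.2.2 _ hs hcs2 hts2 i
  have hfd : ∀ p, fderiv ℝ (φ ∘ eE.symm) (eE p) (EuclideanSpace.single i 1) = fderiv ℝ φ p v := by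
    intro p
    rw [ContinuousLinearEquiv.comp_right_fderiv, ← hv]
    simp
  rw [← eE_mp.setIntegral_preimage_emb eE_me, ← eE_mp.setIntegral_preimage_emb eE_me] at h
  simp only [hfd, Function.comp_apply, ContinuousLinearEquiv.symm_apply_apply] at h
  have h2 := congrArg eC h
  rw [map_neg, ← ContinuousLinearEquiv.integral_comp_comm, ← ContinuousLinearEquiv.integral_comp_comm] at h2
  simpa only [map_smul] using h2

lemma memLp_transfer {Ω : Set E2} {f : E2 → E2} {Df : E2 → E2 →L[ℝ] E2} (hf : MemW12loc Ω f Df) (i : Fin 2)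
    (A : Set (ℝ × ℝ)) (hA : A ⊆ eE ⁻¹' Ω) (hAc : IsCompact A) :
    MemLp (fun p => eC (Df (eE p) (EuclideanSpace.single i 1))) 2 (volume.restrict A) := by
  have hm : Measurable fun p => eC (Df (eE p) (EuclideanSpace.single i 1)) :=
    eC.continuous.measurable.comp ((hf.2.1.apply_continuousLinearMap _).comp eE.continuous.measurable)
  refine ⟨hm.aestronglyMeasurable, ?_⟩
  rw [eLpNorm_lt_top_iff_lintegral_rpow_enorm_lt_top (by norm_num) (by norm_num)]
  have h := hf.2.2.1 (eE '' A) (image_subset_iff.2 hA) (hAc.image eE.continuous)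
  have hpre : eE ⁻¹' (eE '' A) = A := preimage_image_eq _ eE.injective
  rw [← eE_mp.setLIntegral_comp_preimage_emb eE_me, hpre] at h
  refine lt_of_le_of_lt (lintegral_mono fun p => ?_) h
  simp only [ENNReal.toReal_ofNat, ENNReal.rpow_ofNat]
  rw [← ofReal_norm, ← ENNReal.ofReal_pow (norm_nonneg _)]
  exact ENNReal.ofReal_le_ofReal (pow_le_pow_left₀ (norm_nonneg _) (eC_bound _ i) 2)

theorem main_aux
    (Ω : Set E2) (hΩopen : IsOpen Ω)
    (f : E2 → E2) (Df : E2 → E2 →L[ℝ] E2)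
    (hcont : ContinuousOn f Ω)
    (hf : MemW12loc Ω f Df)
    (K : E2 → ℝ) (hKmeas : Measurable K) (hK1 : ∀ x, 1 ≤ K x)
    (hKloc : ∀ A : Set E2, A ⊆ Ω → IsCompact A →
      ∫⁻ x in A, ENNReal.ofReal (K x) < ⊤)
    (hdist : ∀ᵐ x ∂(volume.restrict Ω), ‖Df x‖ ^ 2 ≤ K x * (Df x).det)
    (x₀ : E2)
    (s : ℝ) (hs : 0 < s) (hball : Metric.closedBall x₀ (2 * s) ⊆ Ω) :
    ∃ r₀ ∈ Ioo (0 : ℝ) 1, ∃ C : ℝ, 0 < C ∧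
      ∀ r : ℝ, 0 < r → r < r₀ →
        ∫⁻ θ in Icc (0 : ℝ) (2 * π),
            mult f (Metric.ball x₀ s) (f x₀ + circlePt r θ)
          ≤ ENNReal.ofReal (C * Real.log (1 / r)) := by
  set U := eE ⁻¹' Ω with hUdef
  have hU : IsOpen U := hΩopen.preimage eE.continuous
  set F : ℝ × ℝ → ℂ := fun p => eC (f (eE p)) with hFdef
  have hF : ContinuousOn F U :=
    eC.continuous.comp_continuousOn (hcont.comp eE.continuous.continuousOn (mapsTo_preimage _ _))
  have hm : ∀ i : Fin 2, Measurable fun p => eC (Df (eE p) (EuclideanSpace.single i 1)) := fun i =>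
    eC.continuous.measurable.comp ((hf.2.1.apply_continuousLinearMap _).comp eE.continuous.measurable)
  set p0 : ℝ × ℝ := (x₀ 0, x₀ 1) with hp0
  have hep0 : eE p0 = x₀ := eE.apply_symm_apply x₀
  have nrm : ∀ p : ℝ × ℝ, ‖eE p - x₀‖ ^ 2 = (p.1 - x₀ 0) ^ 2 + (p.2 - x₀ 1) ^ 2 := by
    intro p
    rw [EuclideanSpace.norm_sq_eq, Fin.sum_univ_two]
    simp only [PiLp.sub_apply, eE_zero, eE_one, Real.norm_eq_abs, sq_abs]
  set a : ℝ × ℝ := (x₀ 0 - 1.3 * s, x₀ 1 - 1.3 * s) with ha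
  set b : ℝ × ℝ := (x₀ 0 + 1.3 * s, x₀ 1 + 1.3 * s) with hb
  set a' : ℝ × ℝ := (x₀ 0 - 1.1 * s, x₀ 1 - 1.1 * s) with ha'
  set b' : ℝ × ℝ := (x₀ 0 + 1.1 * s, x₀ 1 + 1.1 * s) with hb'
  have hab : Icc a b ⊆ U := by
    intro p hp
    apply hball
    obtain ⟨⟨h1, h2⟩, h3, h4⟩ := hp
    simp only [ha, hb] at h1 h2 h3 h4
    rw [Metric.mem_closedBall, dist_eq_norm]
    refine abs_le_of_sq_le_sq' ?_ (by positivity) |>.2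
    rw [nrm]
    nlinarith [mul_nonneg (sub_nonneg.2 h1) (sub_nonneg.2 h3), mul_nonneg (sub_nonneg.2 h2) (sub_nonneg.2 h4), mul_pos hs hs]
  obtain ⟨Fn, M, hA⟩ := exists_approx hU hF (weakD_transfer hf 0 eE_10) (weakD_transfer hf 1 eE_01) (hm 0) (hm 1)
    (memLp_transfer hf 0) (memLp_transfer hf 1) hab
  have hd2 : ∀ᵐ p ∂(volume.restrict (Icc a b)), ‖Df (eE p)‖ ^ 2 ≤ K (eE p) * (Df (eE p)).det := by
    have := (eE_mp.restrict_preimage_emb eE_me Ω).quasiMeasurePreserving.ae hdist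
    exact ae_restrict_of_ae_restrict_of_subset hab this
  have hD : Dist2 a b F _ _ Fn M (fun p => K (eE p)) :=
    { app := hA
      K1 := fun p => hK1 _
      Kint := by
        refine ⟨(hKmeas.comp eE.continuous.measurable).aestronglyMeasurable, ?_⟩
        rw [hasFiniteIntegral_iff_ofReal (Eventually.of_forall fun p => zero_le_one.trans (hK1 _))]
        have h := hKloc (eE '' Icc a b) (image_subset_iff.2 hab) (isCompact_Icc.image eE.continuous)
        have hpre : eE ⁻¹' (eE '' Icc a b) = Icc a b := preimage_image_eq _ eE.injective
        rwa [← eE_mp.setLIntegral_comp_preimage_emb eE_me, hpre] at h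
      dx := by
        filter_upwards [hd2] with p hp
        rw [← det_crs]
        exact (pow_le_pow_left₀ (norm_nonneg _) (eC_bound _ 0) 2).trans hp
      dy := by
        filter_upwards [hd2] with p hp
        rw [← det_crs]
        exact (pow_le_pow_left₀ (norm_nonneg _) (eC_bound _ 1) 2).trans hp }
  obtain ⟨r₀, hr₀, C, hC, hfin⟩ := hD.final (a' := a') (b' := b') (x0 := p0) (by simp only [ha, ha']; linarith) (by simp only [ha', hb']; linarith)
    (by simp only [hb, hb']; linarith) (by simp only [ha, ha']; linarith) (by simp only [ha', hb']; linarith)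
    (by simp only [hb, hb']; linarith)
    ⟨⟨by simp only [ha', hp0]; linarith, by simp only [ha', hp0]; linarith⟩,
      by simp only [hb', hp0]; linarith, by simp only [hb', hp0]; linarith⟩
  refine ⟨r₀, hr₀, C, hC, fun r h0 h1 => le_trans (lintegral_mono fun θ => ?_) (hfin r h0 h1)⟩
  unfold mult
  have hsubs : Metric.ball x₀ s ∩ f ⁻¹' {f x₀ + circlePt r θ} ⊆
      eE '' ((Ioo a'.1 b'.1 ×ˢ Ioo a'.2 b'.2) ∩ F ⁻¹' {F p0 + cpt r θ}) := by
    rintro x ⟨hx, hfx⟩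
    refine ⟨eE.symm x, ⟨?_, ?_⟩, eE.apply_symm_apply x⟩
    · rw [Metric.mem_ball, dist_eq_norm] at hx
      have hn := nrm (eE.symm x)
      rw [eE.apply_symm_apply] at hn
      have hlt : ‖x - x₀‖ ^ 2 < s ^ 2 := pow_lt_pow_left₀ hx (norm_nonneg _) two_ne_zero
      have e1 := abs_lt_of_sq_lt_sq' (a := (eE.symm x).1 - x₀ 0) (b := s) (by nlinarith [sq_nonneg ((eE.symm x).2 - x₀ 1)]) hs.le
      have e2 := abs_lt_of_sq_lt_sq' (a := (eE.symm x).2 - x₀ 1) (b := s) (by nlinarith [sq_nonneg ((eE.symm x).1 - x₀ 0)]) hs.le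
      simp only [ha', hb', mem_prod, mem_Ioo]
      refine ⟨⟨?_, ?_⟩, ?_, ?_⟩ <;> linarith [e1.1, e1.2, e2.1, e2.2]
    · have hfx' : f x = f x₀ + circlePt r θ := hfx
      show eC (f (eE (eE.symm x))) = eC (f (eE p0)) + cpt r θ
      rw [eE.apply_symm_apply, hep0, hfx', map_add, eC_circle]
  have hle : (Metric.ball x₀ s ∩ f ⁻¹' {f x₀ + circlePt r θ}).encard ≤
      ((Ioo a'.1 b'.1 ×ˢ Ioo a'.2 b'.2) ∩ F ⁻¹' {F p0 + cpt r θ}).encard :=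
    (encard_le_encard hsubs).trans (encard_image_le _ _)
  exact ENat.toENNReal_le.2 hle

end mainproof

/-- **Euclidean case of Proposition 4.2.** For a continuous mapping of finite distortion
with locally integrable distortion, around every point `x₀` with `B̄(x₀, 2s) ⊆ Ω` one
has the logarithmic multiplicity bound
`∫₀^{2π} N(f(x₀) + r e^{iθ}, f, B(x₀, s)) dθ ≤ C log(1/r)` for all small `r`. -/
theorem multiplicity_log_bound
    (Ω : Set E2) (hΩopen : IsOpen Ω)
    (f : E2 → E2) (Df : E2 → E2 →L[ℝ] E2)
    (hcont : ContinuousOn f Ω)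
    (hf : MemW12loc Ω f Df)
    (K : E2 → ℝ) (hKmeas : Measurable K) (hK1 : ∀ x, 1 ≤ K x)
    (hKloc : ∀ A : Set E2, A ⊆ Ω → IsCompact A →
      ∫⁻ x in A, ENNReal.ofReal (K x) < ⊤)
    (hdist : ∀ᵐ x ∂(volume.restrict Ω), ‖Df x‖ ^ 2 ≤ K x * (Df x).det)
    (x₀ : E2) (hx₀ : x₀ ∈ Ω)
    (s : ℝ) (hs : 0 < s) (hball : Metric.closedBall x₀ (2 * s) ⊆ Ω) :
    ∃ r₀ ∈ Ioo (0 : ℝ) 1, ∃ C : ℝ, 0 < C ∧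
      ∀ r : ℝ, 0 < r → r < r₀ →
        ∫⁻ θ in Icc (0 : ℝ) (2 * π),
            mult f (Metric.ball x₀ s) (f x₀ + circlePt r θ)
          ≤ ENNReal.ofReal (C * Real.log (1 / r)) := by
  exact main_aux Ω hΩopen f Df hcont hf K hKmeas hK1 hKloc hdist x₀ s hs hball
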